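/- For integers n, t ≥ 1 and ℓ₁, …, ℓ_t ≥ n/(100t) with ℓ₁ + ⋯ + ℓ_t ≤ n, every strongly 10¹⁴t-connected n-vertex semicomplete digraph D with 2t distinct vertices x₁, …, x_t, y₁, …, y_t ∈ V(D) contains t pairwise vertex-disjoint directed paths P₁, …, P_t such that for each i ∈ [t], the path P_i starts at x_i, ends at y_i, and |V(P_i)| = ℓ_i. -/

import Mathlib

/-- A digraph on the vertex type `V`, given by its adjacency (directed edge) relation. -/
structure Digr (V : Type) where
  Adj : V → V → Prop

namespace Digr

variable {V : Type}

/-- No loops. -/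
def Loopless (G : Digr V) : Prop := ∀ v, ¬ G.Adj v v

/-- A tournament: every pair of distinct vertices is joined by exactly one directed edge. -/
def IsTournament (G : Digr V) : Prop :=
  G.Loopless ∧ ∀ u v : V, u ≠ v → (G.Adj u v ↔ ¬ G.Adj v u)

/-- A semicomplete digraph: every pair of distinct vertices is joined by at least one
directed edge (edges in both directions are allowed). -/
def IsSemicomplete (G : Digr V) : Prop :=
  G.Loopless ∧ ∀ u v : V, u ≠ v → (G.Adj u v ∨ G.Adj v u)

/-- Out-neighbourhood `N⁺_G(v)`. -/
def outN (G : Digr V) (v : V) : Set V := {u | G.Adj v u}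

/-- In-neighbourhood `N⁻_G(v)`. -/
def inN (G : Digr V) (v : V) : Set V := {u | G.Adj u v}

/-- Union of two digraphs (on the same vertex type). -/
def union (G H : Digr V) : Digr V := ⟨fun a b => G.Adj a b ∨ H.Adj a b⟩

/-- `l` is a directed path of `G` lying inside the vertex set `A`, from `u` to `v`. -/
def IsPathOn (G : Digr V) (A : Set V) (u v : V) (l : List V) : Prop :=
  l.Nodup ∧ l.Chain' G.Adj ∧ (∀ x ∈ l, x ∈ A) ∧ l.head? = some u ∧ l.getLast? = some v

/-- There is a directed path of `G` inside `A` from `u` to `v`. -/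
def Reaches (G : Digr V) (A : Set V) (u v : V) : Prop :=
  ∃ l, G.IsPathOn A u v l

/-- The induced subdigraph of `G` on `W` is strongly `k`-connected: `|W| ≥ k + 1` and for
every ordered pair of distinct vertices of `W` and every `S ⊆ W ∖ {u,v}` with `|S| ≤ k - 1`
there is a directed path from `u` to `v` avoiding `S`. -/
def StronglyConnOn (G : Digr V) (W : Set V) (k : ℕ) : Prop :=
  k + 1 ≤ W.ncard ∧
  ∀ u ∈ W, ∀ v ∈ W, u ≠ v → ∀ S : Set V, S ⊆ W \ {u, v} → S.ncard < k →
    G.Reaches (W \ S) u v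

/-- Strong `c`-connectedness for a real parameter `c` (the condition on the removed set `S`
is `|S| ≤ c - 1`). -/
def StronglyConnOnR (G : Digr V) (W : Set V) (c : ℝ) : Prop :=
  c + 1 ≤ (W.ncard : ℝ) ∧
  ∀ u ∈ W, ∀ v ∈ W, u ≠ v → ∀ S : Set V, S ⊆ W \ {u, v} → (S.ncard : ℝ) ≤ c - 1 →
    G.Reaches (W \ S) u v

/-- `l` is a directed cycle of `G` (length at least 3) whose vertex set is `C`. -/
def IsCycleOn (G : Digr V) (C : Set V) (l : List V) : Prop :=
  3 ≤ l.length ∧ l.Nodup ∧ (∀ x, x ∈ l ↔ x ∈ C) ∧ l.Chain' G.Adj ∧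
  ∃ a b, l.getLast? = some a ∧ l.head? = some b ∧ G.Adj a b

/-- The pair `(v, U)` is `k`-connected in the induced subdigraph of `G` on `A`: after
deleting any `S ⊆ A ∖ {v}` with `|S| ≤ k - 1` there is a path from `v` to some vertex
of `U ∖ S` inside `A ∖ S`. -/
def VtxSetConn (G : Digr V) (A : Set V) (v : V) (U : Set V) (k : ℕ) : Prop :=
  ∀ S : Set V, S ⊆ A \ {v} → S.ncard < k → ∃ u ∈ U \ S, G.Reaches (A \ S) v u

/-- The pair `(U, v)` is `k`-connected in the induced subdigraph of `G` on `A`. -/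
def SetVtxConn (G : Digr V) (A : Set V) (U : Set V) (v : V) (k : ℕ) : Prop :=
  ∀ S : Set V, S ⊆ A \ {v} → S.ncard < k → ∃ u ∈ U \ S, G.Reaches (A \ S) u v

end Digr

open Digr

namespace Linkage

variable {V : Type}

theorem exists_isChain_merge {r : V → V → Prop} (hr : ∀ u v, u ≠ v → r u v ∨ r v u) (q : V) :
    ∀ (N : ℕ) (C Y : List V) (p : V), C.length + Y.length = N → (p :: Y ++ [q]).IsChain r →
      C.IsChain r → (∀ c ∈ C, c ∉ Y) → (∀ c ∈ C.head?, r p c) → (∀ c ∈ C.getLast?, r c q) →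
      ∃ W, (p :: W ++ [q]).IsChain r ∧ Y.Sublist W ∧ W.Perm (C ++ Y) := by
  intro N
  induction N with
  | zero =>
    intro C Y p hN hP hC hd hh hl
    have hC0 : C = [] := List.eq_nil_of_length_eq_zero (by omega)
    subst hC0
    exact ⟨Y, hP, List.Sublist.refl _, by simp⟩
  | succ N ih =>
    intro C Y p hN hP hC hd hh hl
    rcases C with _ | ⟨c, C⟩
    · exact ⟨Y, hP, List.Sublist.refl _, by simp⟩
    rcases Y with _ | ⟨y, Y⟩
    · refine ⟨c :: C, ?_, by simp, by simp⟩
      have h1 : r p c := hh c (by simp)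
      rw [List.cons_append, List.cons_append, List.isChain_cons_cons]
      refine ⟨h1, ?_⟩
      rw [← List.cons_append, List.isChain_append]
      refine ⟨hC, by simp, ?_⟩
      intro a ha b hb
      simp at hb
      subst hb
      exact hl a ha
    · have hcy : c ≠ y := by
        intro h
        exact hd c (by simp) (by simp [h])
      simp only [List.cons_append, List.isChain_cons_cons] at hP
      by_cases h : r y c
      · obtain ⟨W, h1, h2, h3⟩ := ih (c :: C) Y y (by simp at hN ⊢; omega) hP.2 hC
          (fun a ha hy => hd a ha (by simp [hy])) (by simpa using h) hl
        refine ⟨y :: W, ?_, h2.cons_cons y, ?_⟩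
        · simp only [List.cons_append, List.isChain_cons_cons]
          exact ⟨hP.1, h1⟩
        · exact (h3.cons y).trans List.perm_middle.symm
      · have h' : r c y := (hr c y hcy).resolve_right h
        obtain ⟨W, h1, h2, h3⟩ := ih C (y :: Y) c (by simp at hN ⊢; omega)
          (by simp only [List.cons_append, List.isChain_cons_cons]; exact ⟨h', hP.2⟩)
          hC.tail (fun a ha hy => hd a (by simp [ha]) hy)
          (by
            intro a ha
            rcases C with _ | ⟨c', C⟩
            · simp at ha
            · simp at ha
              subst ha
              simp only [List.isChain_cons_cons] at hC
              exact hC.1)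
          (by
            intro a ha
            rcases C with _ | ⟨c', C⟩
            · simp at ha
            · exact hl a (by simpa using ha))
        refine ⟨c :: W, ?_, h2.trans (List.sublist_cons_self _ _), ?_⟩
        · simp only [List.cons_append, List.isChain_cons_cons]
          exact ⟨hh c (by simp), h1⟩
        · exact h3.cons c

/-- `C` is empty or can be placed between two vertices occurring in this order in `P`. -/
def Insertable (r : V → V → Prop) (P C : List V) : Prop :=
  C = [] ∨ ∃ p q, [p, q].Sublist P ∧ (∀ c ∈ C.head?, r p c) ∧ ∀ c ∈ C.getLast?, r c q

theorem Insertable.mono {r : V → V → Prop} {P P' C : List V} (h : Insertable r P C)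
    (hP : P.Sublist P') : Insertable r P' C := by
  rcases h with h | ⟨p, q, h, h'⟩
  · exact Or.inl h
  · exact Or.inr ⟨p, q, h.trans hP, h'⟩

theorem exists_isChain_insert {r : V → V → Prop} (hr : ∀ u v, u ≠ v → r u v ∨ r v u)
    {P C : List V} (hP : P.IsChain r) (hC : C.IsChain r) (hd : ∀ c ∈ C, c ∉ P)
    (hi : Insertable r P C) :
    ∃ P' : List V, P'.IsChain r ∧ P.Sublist P' ∧ P'.Perm (C ++ P) ∧ P'.head? = P.head? ∧
      P'.getLast? = P.getLast? := by
  rcases hi with hi | ⟨p, q, hpq, hh, hl⟩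
  · subst hi
    exact ⟨P, hP, List.Sublist.refl _, by simp, rfl, rfl⟩
  obtain ⟨X, P2, rfl, hp1, hq⟩ := List.cons_sublist_iff.1 hpq
  obtain ⟨X, T, rfl⟩ := List.append_of_mem hp1
  obtain ⟨Y, Z, rfl⟩ := List.append_of_mem (List.singleton_sublist.1 hq)
  have key : ∀ W : List V, (X ++ p :: (W ++ q :: Z)).IsChain r ↔
      (X ++ [p]).IsChain r ∧ (p :: W ++ [q]).IsChain r ∧ (q :: Z).IsChain r := by
    intro W
    rw [List.isChain_split, ← List.cons_append, List.isChain_split (l₁ := p :: W)]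
  have e0 : X ++ p :: T ++ (Y ++ q :: Z) = X ++ p :: ((T ++ Y) ++ q :: Z) := by simp
  rw [e0] at hP hd ⊢
  rw [key] at hP
  obtain ⟨W, h1, h2, h3⟩ := exists_isChain_merge hr q _ C (T ++ Y) p rfl hP.2.1 hC
    (fun c hc h => hd c hc (by simp at h ⊢; tauto)) hh hl
  refine ⟨X ++ p :: (W ++ q :: Z), (key W).2 ⟨hP.1, h1, hP.2.2⟩, ?_, ?_, ?_, ?_⟩
  · exact (List.Sublist.refl X).append ((h2.append (List.Sublist.refl _)).cons_cons p)
  · classical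
    rw [List.perm_iff_count] at h3 ⊢
    intro a
    have := h3 a
    simp only [List.count_append, List.count_cons] at this ⊢
    omega
  · cases X <;> simp
  · simp [List.getLast?_append, List.getLast?_cons]

theorem exists_isChain_insert_many {r : V → V → Prop} (hr : ∀ u v, u ≠ v → r u v ∨ r v u) :
    ∀ (Cs : List (List V)) (P : List V), P.IsChain r →
      (∀ C ∈ Cs, C.IsChain r ∧ Insertable r P C) → (Cs.flatten ++ P).Nodup →
    ∃ P' : List V, P'.IsChain r ∧ P.Sublist P' ∧ P'.Perm (Cs.flatten ++ P) ∧ P'.head? = P.head? ∧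
      P'.getLast? = P.getLast? := by
  intro Cs
  induction Cs with
  | nil => intro P hP _ _; exact ⟨P, hP, List.Sublist.refl _, by simp, rfl, rfl⟩
  | cons C Cs ih =>
    intro P hP hC hn
    have hn1 : (Cs.flatten ++ P).Nodup := by
      rw [List.flatten_cons, List.append_assoc] at hn
      exact hn.of_append_right
    obtain ⟨P', h1, h2, h3, h4, h5⟩ := ih P hP (fun D hD => hC D (by simp [hD])) hn1
    have hC' := hC C (by simp)
    obtain ⟨P'', g1, g2, g3, g4, g5⟩ := exists_isChain_insert hr h1 hC'.1
      (by
        intro c hc hcP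
        rw [List.flatten_cons, List.append_assoc] at hn
        exact (List.disjoint_of_nodup_append hn) hc (h3.mem_iff.1 hcP))
      (hC'.2.mono h2)
    refine ⟨P'', g1, h2.trans g2, ?_, g4.trans h4, g5.trans h5⟩
    rw [List.flatten_cons, List.append_assoc]
    exact g3.trans (h3.append_left C)

/-- Hall's theorem in the case where every set of candidates is at least as large as the
index set. -/
theorem exists_injective_choice {ι α : Type*} [Fintype ι] [DecidableEq α] (C : ι → Finset α)
    (h : ∀ i, Fintype.card ι ≤ (C i).card) : ∃ f : ι → α, Function.Injective f ∧ ∀ i, f i ∈ C i := by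
  classical
  rw [← Finset.all_card_le_biUnion_card_iff_exists_injective]
  intro s
  rcases s.eq_empty_or_nonempty with rfl | ⟨i, hi⟩
  · simp
  · calc s.card ≤ Fintype.card ι := Finset.card_le_univ s
      _ ≤ (C i).card := h i
      _ ≤ _ := Finset.card_le_card (Finset.subset_biUnion_of_mem C hi)

/-- No member of `l` sends an edge to `u`. -/
def Undom (r : V → V → Prop) (l : List V) (u : V) : Prop := ∀ a ∈ l, ¬ r a u

open scoped Classical in
theorem exists_dominates_half {r : V → V → Prop} (hr : ∀ u v, u ≠ v → r u v ∨ r v u)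
    (U : Finset V) (hU : U.Nonempty) :
    ∃ a ∈ U, 2 * (U.filter fun u => u ≠ a ∧ ¬ r a u).card ≤ U.card := by
  by_contra! hcon
  have hswap : ∑ a ∈ U, (U.filter fun u => u ≠ a ∧ ¬ r a u).card =
      ∑ a ∈ U, (U.filter fun u => u ≠ a ∧ ¬ r u a).card := by
    have := Finset.sum_card_bipartiteAbove_eq_sum_card_bipartiteBelow (s := U) (t := U)
      (fun a u => u ≠ a ∧ ¬ r a u)
    simp only [Finset.bipartiteAbove, Finset.bipartiteBelow] at this
    rw [this]
    refine Finset.sum_congr rfl fun a _ => ?_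
    congr 1
    ext u
    simp [ne_comm]
  have h2 : ∑ a ∈ U, ((U.filter fun u => u ≠ a ∧ ¬ r a u).card +
      (U.filter fun u => u ≠ a ∧ ¬ r u a).card) ≤ ∑ _a ∈ U, U.card := by
    refine Finset.sum_le_sum fun a _ => ?_
    rw [← Finset.card_union_of_disjoint]
    · exact Finset.card_le_card (by
        intro u hu
        simp only [Finset.mem_union, Finset.mem_filter] at hu
        tauto)
    · rw [Finset.disjoint_filter]
      rintro u _ ⟨h1, h2⟩ ⟨_, h3⟩
      exact (hr u a h1).elim h3 h2
  have h3 : ∑ _a ∈ U, U.card < ∑ a ∈ U, 2 * (U.filter fun u => u ≠ a ∧ ¬ r a u).card :=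
    Finset.sum_lt_sum_of_nonempty hU fun a ha => hcon a ha
  rw [← Finset.mul_sum] at h3
  rw [Finset.sum_add_distrib, ← hswap] at h2
  omega

open scoped Classical in
theorem exists_dominating_chain [Fintype V] {r : V → V → Prop}
    (hr : ∀ u v, u ≠ v → r u v ∨ r v u) (Z : Finset V) (hZ : ∃ v, v ∉ Z) (c : ℕ) :
    ∃ l : List V, l ≠ [] ∧ l.length ≤ c + 1 ∧ l.Nodup ∧ l.IsChain r ∧ (∀ a ∈ l, a ∉ Z) ∧
      ∀ v, v ∉ Z → 2 ^ c * (Finset.univ.filter fun u => u ∉ Z ∧ u ∉ l ∧ Undom r l u).card ≤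
        (Finset.univ.filter fun u => r u v).card := by
  induction c with
  | zero =>
    obtain ⟨a, ha, hmin⟩ := Finset.exists_min_image (Finset.univ.filter fun v => v ∉ Z)
      (fun v => (Finset.univ.filter fun u => u ∉ Z ∧ u ≠ v ∧ ¬ r v u).card)
      (by obtain ⟨v, hv⟩ := hZ; exact ⟨v, by simp [hv]⟩)
    refine ⟨[a], by simp, by simp, by simp, by simp, by simpa using ha, ?_⟩
    intro v hv
    have h1 := hmin v (by simp [hv])
    simp only [pow_zero, one_mul, Undom, List.mem_singleton, forall_eq]
    refine h1.trans (Finset.card_le_card ?_)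
    intro u hu
    simp only [Finset.mem_filter, Finset.mem_univ, true_and] at hu ⊢
    exact (hr u v hu.2.1).resolve_right hu.2.2
  | succ c ih =>
    obtain ⟨l, h0, h1, h2, h3, h4, h5⟩ := ih
    set U := Finset.univ.filter fun u => u ∉ Z ∧ u ∉ l ∧ Undom r l u with hUdef
    rcases U.eq_empty_or_nonempty with hU | hU
    · refine ⟨l, h0, by omega, h2, h3, h4, fun v hv => ?_⟩
      rw [← hUdef, hU]
      simp
    · obtain ⟨a, haU, ha⟩ := exists_dominates_half hr U hU
      simp only [hUdef, Finset.mem_filter, Finset.mem_univ, true_and] at haU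
      refine ⟨a :: l, by simp, by simp; omega, by simp [haU.2.1, h2], ?_, ?_, ?_⟩
      · rcases l with _ | ⟨b, l⟩
        · simp
        · rw [List.isChain_cons_cons]
          refine ⟨?_, h3⟩
          refine (hr a b ?_).resolve_right (haU.2.2 b (by simp))
          rintro rfl
          exact haU.2.1 (by simp)
      · intro b hb
        rcases List.mem_cons.1 hb with rfl | hb
        · exact haU.1
        · exact h4 b hb
      · intro v hv
        have h6 := h5 v hv
        have h7 : (Finset.univ.filter fun u => u ∉ Z ∧ u ∉ a :: l ∧ Undom r (a :: l) u) ⊆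
            U.filter fun u => u ≠ a ∧ ¬ r a u := by
          intro u hu
          rw [Finset.mem_filter] at hu
          rw [Finset.mem_filter, hUdef, Finset.mem_filter]
          obtain ⟨_, h1, h2, h3⟩ := hu
          simp only [List.mem_cons, not_or] at h2
          exact ⟨⟨Finset.mem_univ _, h1, h2.2, fun b hb => h3 b (List.mem_cons_of_mem _ hb)⟩,
            h2.1, h3 a List.mem_cons_self⟩
        have h8 := Finset.card_le_card h7
        calc 2 ^ (c + 1) * _ = 2 ^ c * (2 * (Finset.univ.filter fun u =>
              u ∉ Z ∧ u ∉ a :: l ∧ Undom r (a :: l) u).card) := by ring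
          _ ≤ 2 ^ c * U.card := Nat.mul_le_mul_left _ (by omega)
          _ ≤ _ := h6

open scoped Classical in
theorem exists_dominating_family [Fintype V] {κ : Type} [Fintype κ] (rel : κ → V → V → Prop)
    (hr : ∀ k u v, u ≠ v → rel k u v ∨ rel k v u) (X : Finset V) (c : ℕ)
    (hX : X.card + Fintype.card κ * (c + 1) < Fintype.card V) :
    ∃ A : κ → List V, (∀ k, A k ≠ []) ∧ (∀ k, (A k).length ≤ c + 1) ∧ (∀ k, (A k).Nodup) ∧
      (∀ k, (A k).IsChain (rel k)) ∧ (∀ k, ∀ a ∈ A k, a ∉ X) ∧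
      (∀ k k', k ≠ k' → ∀ a ∈ A k, a ∉ A k') ∧
      ∀ R : Finset V, X ⊆ R → (∀ k, ∀ a ∈ A k, a ∈ R) → ∀ k v, v ∉ R →
        2 ^ c * (Finset.univ.filter fun u => u ∉ R ∧ Undom (rel k) (A k) u).card ≤
          (Finset.univ.filter fun u => rel k u v).card := by
  have key : ∀ s : Finset κ, ∃ A : κ → List V, (∀ k ∉ s, A k = []) ∧ (∀ k ∈ s, A k ≠ []) ∧
      (∀ k, (A k).length ≤ c + 1) ∧ (∀ k, (A k).Nodup) ∧
      (∀ k, (A k).IsChain (rel k)) ∧ (∀ k, ∀ a ∈ A k, a ∉ X) ∧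
      (∀ k k', k ≠ k' → ∀ a ∈ A k, a ∉ A k') ∧
      ∀ R : Finset V, X ⊆ R → (∀ k, ∀ a ∈ A k, a ∈ R) → ∀ k ∈ s, ∀ v, v ∉ R →
        2 ^ c * (Finset.univ.filter fun u => u ∉ R ∧ Undom (rel k) (A k) u).card ≤
          (Finset.univ.filter fun u => rel k u v).card := by
    intro s
    induction s using Finset.induction_on with
    | empty => exact ⟨fun _ => [], by simp, by simp, by simp, by simp, by simp, by simp, by simp,
        by simp⟩
    | insert k₀ s hk₀ ih =>
      obtain ⟨A, h0, h1, h2, h3, h4, h5, h6, h7⟩ := ih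
      set Z := X ∪ s.biUnion fun k => (A k).toFinset with hZ
      have hZc : Z.card < Fintype.card V := by
        have e1 : (s.biUnion fun k => (A k).toFinset).card ≤ s.card * (c + 1) :=
          Finset.card_biUnion_le_card_mul _ _ _ fun k _ =>
            (List.toFinset_card_le _).trans (h2 k)
        have e2 := Finset.card_union_le X (s.biUnion fun k => (A k).toFinset)
        have e3 : s.card * (c + 1) ≤ Fintype.card κ * (c + 1) :=
          Nat.mul_le_mul_right _ (Finset.card_le_univ s)
        rw [← hZ] at e2
        omega
      have hZe : ∃ v, v ∉ Z := by
        by_contra! h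
        rw [Finset.eq_univ_of_forall h, Finset.card_univ] at hZc
        exact lt_irrefl _ hZc
      obtain ⟨l, l0, l1, l2, l3, l4, l5⟩ := exists_dominating_chain (hr k₀) Z hZe c
      have hAZ : ∀ k, ∀ a ∈ A k, a ∈ Z := by
        intro k a ha
        by_cases hk : k ∈ s
        · exact Finset.mem_union_right _ (Finset.mem_biUnion.2 ⟨k, hk, by simpa using ha⟩)
        · simp [h0 k hk] at ha
      refine ⟨Function.update A k₀ l, ?_, ?_, ?_, ?_, ?_, ?_, ?_, ?_⟩
      · intro k hk
        simp only [Finset.mem_insert, not_or] at hk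
        rw [Function.update_of_ne hk.1]
        exact h0 k hk.2
      · intro k hk
        by_cases e : k = k₀
        · subst e; simpa using l0
        · rw [Function.update_of_ne e]
          exact h1 k (Finset.mem_of_mem_insert_of_ne hk e)
      · intro k
        by_cases e : k = k₀
        · subst e; simpa using l1
        · rw [Function.update_of_ne e]; exact h2 k
      · intro k
        by_cases e : k = k₀
        · subst e; simpa using l2
        · rw [Function.update_of_ne e]; exact h3 k
      · intro k
        by_cases e : k = k₀
        · subst e; simpa using l3
        · rw [Function.update_of_ne e]; exact h4 k
      · intro k a ha haX
        by_cases e : k = k₀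
        · subst e
          rw [Function.update_self] at ha
          exact l4 a ha (Finset.mem_union_left _ haX)
        · rw [Function.update_of_ne e] at ha; exact h5 k a ha haX
      · intro k k' hkk a ha ha'
        by_cases e : k = k₀
        · subst e
          rw [Function.update_self] at ha
          rw [Function.update_of_ne (Ne.symm hkk)] at ha'
          exact l4 a ha (hAZ _ a ha')
        · rw [Function.update_of_ne e] at ha
          by_cases e' : k' = k₀
          · subst e'
            rw [Function.update_self] at ha'
            exact l4 a ha' (hAZ _ a ha)
          · rw [Function.update_of_ne e'] at ha'
            exact h6 k k' hkk a ha ha'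
      · intro R hXR hAR k hk v hv
        have hAR' : ∀ k, ∀ a ∈ A k, a ∈ R := by
          intro k a ha
          by_cases e : k = k₀
          · subst e; simp [h0 k hk₀] at ha
          · exact hAR k a (by rwa [Function.update_of_ne e])
        by_cases e : k = k₀
        · subst e
          rw [Function.update_self]
          have hlR : ∀ a ∈ l, a ∈ R := fun a ha => hAR k a (by rwa [Function.update_self])
          have hZR : Z ⊆ R := by
            rw [hZ]
            refine Finset.union_subset hXR (Finset.biUnion_subset.2 fun k _ a ha => ?_)
            exact hAR' k a (by simpa using ha)
          refine le_trans ?_ (l5 v fun h => hv (hZR h))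
          refine Nat.mul_le_mul_left _ (Finset.card_le_card ?_)
          intro u hu
          simp only [Finset.mem_filter, Finset.mem_univ, true_and] at hu ⊢
          exact ⟨fun h => hu.1 (hZR h), fun h => hu.1 (hlR u h), hu.2⟩
        · rw [Function.update_of_ne e]
          exact h7 R hXR hAR' k (Finset.mem_of_mem_insert_of_ne hk e) v hv
  obtain ⟨A, -, h1, h2, h3, h4, h5, h6, h7⟩ := key Finset.univ
  exact ⟨A, fun k => h1 k (Finset.mem_univ k), h2, h3, h4, h5, h6, fun R hX hA k =>
    h7 R hX hA k (Finset.mem_univ k)⟩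

open scoped Classical in
/-- Menger's theorem for two disjoint vertex sets of equal size, one of them consisting of sources
and the other of sinks. -/
theorem exists_disjoint_paths [Fintype V] (r : V → V → Prop) (X Y : Finset V)
    (hX : ∀ x ∈ X, ∀ u, ¬ r u x)
    (hconn : ∀ S : Finset V, S.card < X.card → ∃ (l : List V) (x : V), x ∈ X ∧ l.head? = some x ∧
      (∃ y ∈ Y, y ∈ l) ∧ l.IsChain r ∧ ∀ v ∈ l, v ∉ S) :
    ∃ Q : V → List V, (∀ x ∈ X, (Q x).head? = some x) ∧
      (∀ x ∈ X, ∃ y ∈ Y, (Q x).getLast? = some y) ∧ (∀ x ∈ X, (Q x).IsChain r) ∧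
      (∀ x ∈ X, (Q x).Nodup) ∧ ∀ x ∈ X, ∀ x' ∈ X, x ≠ x' → ∀ v ∈ Q x, v ∉ Q x' := by
  -- Hall's theorem yields an injective successor function
  have hall : ∃ f : {v // v ∉ Y} → V, Function.Injective f ∧
      ∀ v, f v ∈ Finset.univ.filter fun w => w ∉ X ∧ (w = v.1 ∨ r v.1 w) := by
    rw [← Finset.all_card_le_biUnion_card_iff_exists_injective]
    intro A₀
    by_contra! hlt
    set A : Finset V := A₀.map (Function.Embedding.subtype _) with hA
    set B : Finset V := A₀.biUnion fun v => Finset.univ.filter fun w => w ∉ X ∧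
      (w = v.1 ∨ r v.1 w) with hB
    have hAc : A.card = A₀.card := Finset.card_map _
    have hmA : ∀ v, v ∈ A → v ∉ Y := by
      intro v hv
      rw [hA, Finset.mem_map] at hv
      obtain ⟨a, _, rfl⟩ := hv
      exact a.2
    have hmB : ∀ w, w ∈ B ↔ w ∉ X ∧ ∃ v ∈ A, w = v ∨ r v w := by
      intro w
      simp only [hB, hA, Finset.mem_biUnion, Finset.mem_filter, Finset.mem_univ, true_and,
        Finset.mem_map, Function.Embedding.subtype_apply]
      constructor
      · rintro ⟨a, ha, h1, h2⟩
        exact ⟨h1, a.1, ⟨a, ha, rfl⟩, h2⟩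
      · rintro ⟨h1, v, ⟨a, ha, rfl⟩, h2⟩
        exact ⟨a, ha, h1, h2⟩
    have hS : ((X \ A) ∪ (B \ A)).card < X.card := by
      have e1 := Finset.card_union_le (X \ A) (B \ A)
      have e2 := Finset.card_sdiff_add_card_inter B A
      have e3 := Finset.card_sdiff_add_card_inter X A
      have e4 := Finset.card_sdiff_add_card_inter A X
      have e5 : (A \ X).card ≤ (B ∩ A).card := by
        refine Finset.card_le_card fun v hv => ?_
        rw [Finset.mem_sdiff] at hv
        rw [Finset.mem_inter, hmB]
        exact ⟨⟨hv.2, v, hv.1, Or.inl rfl⟩, hv.1⟩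
      rw [Finset.inter_comm] at e4
      omega
    obtain ⟨l, x, hx, hlx, ⟨y, hy, hyl⟩, hl, hlS⟩ := hconn _ hS
    have hstay : ∀ (l : List V) (a : V), a ∈ A → (a :: l).IsChain r →
        (∀ v ∈ l, v ∉ (X \ A) ∪ (B \ A)) → ∀ v ∈ l, v ∈ A := by
      intro l
      induction l with
      | nil => simp
      | cons b l ih =>
        intro a ha hc hS v hv
        rw [List.isChain_cons_cons] at hc
        have hb : b ∈ A := by
          by_contra hbA
          have hbB : b ∈ B := (hmB b).2 ⟨fun h => hX b h a hc.1, a, ha, Or.inr hc.1⟩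
          exact hS b List.mem_cons_self (Finset.mem_union_right _ (Finset.mem_sdiff.2 ⟨hbB, hbA⟩))
        rcases List.mem_cons.1 hv with rfl | hv
        · exact hb
        · exact ih b hb hc.2 (fun v hv => hS v (List.mem_cons_of_mem _ hv)) v hv
    rcases l with _ | ⟨z, l⟩
    · simp at hlx
    · obtain rfl : z = x := by simpa using hlx
      have hzA : z ∈ A := by
        by_contra h
        exact hlS z List.mem_cons_self (Finset.mem_union_left _ (Finset.mem_sdiff.2 ⟨hx, h⟩))
      rcases List.mem_cons.1 hyl with rfl | hyl
      · exact hmA _ hzA hy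
      · exact hmA _ (hstay l z hzA hl (fun v hv => hlS v (List.mem_cons_of_mem _ hv)) y hyl) hy
  obtain ⟨f, hfi, hf⟩ := hall
  simp only [Finset.mem_filter, Finset.mem_univ, true_and] at hf
  set g : V → V := fun v => if h : v ∉ Y then f ⟨v, h⟩ else v with hg
  have hgi : ∀ a b, a ∉ Y → b ∉ Y → g a = g b → a = b := by
    intro a b ha hb h
    simp only [hg, ha, hb, not_false_eq_true, dif_pos] at h
    simpa using hfi h
  have hgX : ∀ a, a ∉ Y → g a ∉ X := by
    intro a ha
    simp only [hg, ha, not_false_eq_true, dif_pos]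
    exact (hf ⟨a, ha⟩).1
  have hgr : ∀ a, a ∉ Y → g a = a ∨ r a (g a) := by
    intro a ha
    simp only [hg, ha, not_false_eq_true, dif_pos]
    exact (hf ⟨a, ha⟩).2
  have hcancel : ∀ i d x x', x ∈ X → x' ∈ X → (∀ j < i, g^[j] x ∉ Y) →
      (∀ j < i + d, g^[j] x' ∉ Y) → g^[i] x = g^[i + d] x' → d = 0 ∧ x = x' := by
    intro i
    induction i with
    | zero =>
      intro d x x' hx hx' _ h2 h
      rcases d with _ | d
      · exact ⟨rfl, by simpa using h⟩
      · exfalso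
        rw [Nat.zero_add, Function.iterate_succ_apply', Function.iterate_zero, id_eq] at h
        exact hgX _ (h2 d (by omega)) (h ▸ hx)
    | succ i ih =>
      intro d x x' hx hx' h1 h2 h
      refine ih d x x' hx hx' (fun j hj => h1 j (by omega)) (fun j hj => h2 j (by omega)) ?_
      rw [show i + 1 + d = (i + d) + 1 by omega, Function.iterate_succ_apply',
        Function.iterate_succ_apply'] at h
      exact hgi _ _ (h1 i (by omega)) (h2 (i + d) (by omega)) h
  have hhit : ∀ x ∈ X, ∃ m, g^[m] x ∈ Y := by
    intro x hx
    by_contra! hne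
    obtain ⟨i, j, hij, h⟩ := Finite.exists_ne_map_eq_of_infinite fun m => g^[m] x
    have hlt : ∀ i j, i < j → g^[i] x ≠ g^[j] x := by
      intro i j hij h
      obtain ⟨d, rfl⟩ := Nat.exists_eq_add_of_le hij.le
      have := (hcancel i d x x hx hx (fun j _ => hne j) (fun j _ => hne j) h).1
      omega
    rcases Nat.lt_or_gt_of_ne hij with h' | h'
    · exact hlt i j h' h
    · exact hlt j i h' h.symm
  choose! m₀ hm₀ using hhit
  have hm' : ∀ x, ∃ m, x ∈ X → g^[m] x ∈ Y ∧ ∀ j < m, g^[j] x ∉ Y := by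
    intro x
    by_cases hx : x ∈ X
    · have : ∃ m, g^[m] x ∈ Y := ⟨_, hm₀ x hx⟩
      exact ⟨Nat.find this, fun _ => ⟨Nat.find_spec this, fun j hj => Nat.find_min this hj⟩⟩
    · exact ⟨0, fun h => absurd h hx⟩
  choose m hm using hm'
  have hdis : ∀ x ∈ X, ∀ x' ∈ X, ∀ i j, i ≤ m x → j ≤ m x' → g^[i] x = g^[j] x' →
      i = j ∧ x = x' := by
    have aux : ∀ x ∈ X, ∀ x' ∈ X, ∀ i j, i ≤ m x → j ≤ m x' → i ≤ j → g^[i] x = g^[j] x' →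
        i = j ∧ x = x' := by
      intro x hx x' hx' i j hi hj hij h
      obtain ⟨d, rfl⟩ := Nat.exists_eq_add_of_le hij
      have := hcancel i d x x' hx hx' (fun j hj => (hm x hx).2 j (by omega))
        (fun j hj => (hm x' hx').2 j (by omega)) h
      exact ⟨by omega, this.2⟩
    intro x hx x' hx' i j hi hj h
    rcases le_total i j with h' | h'
    · exact aux x hx x' hx' i j hi hj h' h
    · have := aux x' hx' x hx j i hj hi h' h.symm
      exact ⟨this.1.symm, this.2.symm⟩
  refine ⟨fun x => (List.range (m x + 1)).map fun i => g^[i] x, ?_, ?_, ?_, ?_, ?_⟩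
  · intro x _
    simp [List.range_succ_eq_map]
  · intro x hx
    exact ⟨g^[m x] x, (hm x hx).1, by simp [List.range_succ]⟩
  · intro x hx
    rw [List.isChain_iff_getElem]
    intro i hi
    simp only [List.length_map, List.length_range] at hi
    simp only [List.getElem_map, List.getElem_range]
    rw [Function.iterate_succ_apply']
    refine (hgr _ ((hm x hx).2 i (by omega))).resolve_left fun h => ?_
    rw [← Function.iterate_succ_apply' g] at h
    have := (hdis x hx x hx (i + 1) i (by omega) (by omega) h).1
    omega
  · intro x hx
    refine List.Nodup.map_on ?_ List.nodup_range
    intro i hi j hj h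
    rw [List.mem_range] at hi hj
    exact (hdis x hx x hx i j (by omega) (by omega) h).1
  · intro x hx x' hx' hne v hv hv'
    rw [List.mem_map] at hv hv'
    obtain ⟨i, hi, rfl⟩ := hv
    obtain ⟨j, hj, h⟩ := hv'
    rw [List.mem_range] at hi hj
    exact hne (hdis x' hx' x hx j i (by omega) (by omega) h).2.symm

theorem exists_final_chain {r : V → V → Prop} {B : List V} (hB : B.IsChain r) {e b y : V}
    (hb : b ∈ B) (heb : r e b) (hy : B.getLast? = some y) :
    ∃ β, (β ++ [y]).Sublist B ∧ (e :: β ++ [y]).IsChain r := by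
  obtain ⟨X, Y, rfl⟩ := List.append_of_mem hb
  obtain ⟨β, hβ⟩ : ∃ β, b :: Y = β ++ [y] := by
    refine ⟨(b :: Y).dropLast, (List.dropLast_append_getLast? y ?_).symm⟩
    rw [List.getLast?_append_of_ne_nil _ (by simp)] at hy
    simpa using hy
  refine ⟨β, ?_, ?_⟩
  · rw [← hβ]; exact List.sublist_append_right _ _
  · rw [List.cons_append, ← hβ, List.isChain_cons_cons]
    exact ⟨heb, (List.isChain_append.1 hB).2.1⟩

theorem exists_initial_chain {r : V → V → Prop} {A : List V} (hA : A.IsChain r) {f a x : V}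
    (ha : a ∈ A) (haf : r a f) (hx : A.head? = some x) :
    ∃ α, (x :: α).Sublist A ∧ (x :: α ++ [f]).IsChain r := by
  have hA' : A.reverse.IsChain (flip r) := by
    rw [List.isChain_reverse]; exact hA
  obtain ⟨β, h1, h2⟩ := exists_final_chain (r := flip r) hA' (e := f) (b := a) (y := x)
    (by simpa using ha) haf (by simpa using hx)
  refine ⟨β.reverse, ?_, ?_⟩
  · have := h1.reverse
    simpa using this
  · have : ((f :: β ++ [x]).reverse).IsChain r := by
      rw [List.isChain_reverse]; exact h2
    simpa using this

variable {J S : Type}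

/-- Disjoint chains from `e s` to `f s`, leaving through a linker `B j`, entering through a
linker `A j`, and otherwise avoiding `R`. -/
structure GapSystem (r : V → V → Prop) (R : Finset V) (A B : J → List V) (e f : S → V) (c L : ℕ)
    (β q α : S → List V) : Prop where
  chain : ∀ s, (e s :: (β s ++ q s ++ α s) ++ [f s]).IsChain r
  nodup : ∀ s, (β s ++ q s ++ α s).Nodup
  disj : ∀ s s', s ≠ s' → ∀ v ∈ β s ++ q s ++ α s, v ∉ β s' ++ q s' ++ α s'
  left : ∀ s, (β s).length ≤ c ∧ ∃ j, ∀ v ∈ β s, v ∈ B j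
  right : ∀ s, (α s).length ≤ c ∧ ∃ j, ∀ v ∈ α s, v ∈ A j
  mid : ∀ s, (q s).length ≤ L ∧ ∀ v ∈ q s, v ∉ R

theorem GapSystem.reverse {r : V → V → Prop} {R : Finset V} {A B : J → List V} {e f : S → V}
    {c L : ℕ} {β q α : S → List V} (h : GapSystem r R A B e f c L β q α) :
    GapSystem (flip r) R (fun j => (B j).reverse) (fun j => (A j).reverse) f e c L
      (fun s => (α s).reverse) (fun s => (q s).reverse) (fun s => (β s).reverse) := by
  have e1 : ∀ s, (α s).reverse ++ (q s).reverse ++ (β s).reverse =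
      (β s ++ q s ++ α s).reverse := by simp
  refine ⟨fun s => ?_, fun s => ?_, fun s s' hs v => ?_, fun s => ?_, fun s => ?_, fun s => ?_⟩
  · have := h.chain s
    rw [e1, show f s :: (β s ++ q s ++ α s).reverse ++ [e s] =
      (e s :: (β s ++ q s ++ α s) ++ [f s]).reverse by simp, List.isChain_reverse]
    exact this
  · rw [e1, List.nodup_reverse]; exact h.nodup s
  · rw [e1, e1, List.mem_reverse, List.mem_reverse]; exact h.disj s s' hs v
  · simpa using h.right s
  · simpa using h.left s
  · simpa using h.mid s

open scoped Classical in
theorem GapSystem.improve [Fintype S] [Fintype J] {r : V → V → Prop}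
    (hr : ∀ u v, u ≠ v → r u v ∨ r v u) {R : Finset V}
    {A B : J → List V} {e f : S → V} {c L : ℕ} {β q α : S → List V}
    (h : GapSystem r R A B e f c L β q α) (hA : ∀ j, (A j).IsChain r) (hA0 : ∀ j, A j ≠ [])
    (hAl : ∀ j, (A j).length ≤ c) (hAn : ∀ j, (A j).Nodup) (hAR : ∀ j, ∀ a ∈ A j, a ∈ R)
    (hBR : ∀ j, ∀ a ∈ B j, a ∈ R)
    (hAA : ∀ j j', j ≠ j' → ∀ a ∈ A j, a ∉ A j') (hAB : ∀ j j', ∀ a ∈ A j, a ∉ B j')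
    (hf : ∀ s, 10 * (Finset.univ.filter fun j => Undom r (A j) (f s)).card ≤ Fintype.card J)
    (hS : 10 * Fintype.card S < Fintype.card J) {w : V} (hwR : w ∉ R) (hwq : ∀ s, w ∉ q s)
    (hw : Fintype.card J ≤ 5 * (Finset.univ.filter fun j => Undom r (A j) w).card)
    {s : S} {q₁ q₂ : List V} {p : V} (hq : q s = q₁ ++ p :: q₂) (hpw : r p w)
    (hlong : c + 1 < q₂.length) :
    ∃ q' α' : S → List V, GapSystem r R A B e f c L β q' α' ∧
      ∑ s, (β s ++ q' s ++ α' s).length < ∑ s, (β s ++ q s ++ α s).length := by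
  choose jr hjr using fun s => (h.right s).2
  obtain ⟨j, hj1, hj2, hj3⟩ : ∃ j, Undom r (A j) w ∧ ¬ Undom r (A j) (f s) ∧ ∀ s', jr s' ≠ j := by
    by_contra! hcon
    have hsub : (Finset.univ.filter fun j => Undom r (A j) w) ⊆
        (Finset.univ.filter fun j => Undom r (A j) (f s)) ∪ Finset.univ.image jr := by
      intro j hj
      simp only [Finset.mem_filter, Finset.mem_univ, true_and, Finset.mem_union,
        Finset.mem_image] at hj ⊢
      by_cases h' : Undom r (A j) (f s)
      · exact Or.inl h'
      · exact Or.inr (hcon j hj h')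
    have h1 := (Finset.card_le_card hsub).trans (Finset.card_union_le _ _)
    have h2 : (Finset.univ.image jr).card ≤ Fintype.card S := Finset.card_image_le
    have h3 := hf s
    omega
  obtain ⟨x, hx⟩ : ∃ x, (A j).head? = some x := by
    cases hAj : A j with
    | nil => exact absurd hAj (hA0 j)
    | cons x l => exact ⟨x, rfl⟩
  have hxA : x ∈ A j := List.mem_of_mem_head? hx
  simp only [Undom, not_forall, not_not] at hj2
  obtain ⟨a, ha, haf⟩ := hj2
  obtain ⟨α₀, hα1, hα2⟩ := exists_initial_chain (hA j) ha haf hx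
  have hwx : r w x := by
    refine (hr w x ?_).resolve_right (hj1 x hxA)
    rintro rfl
    exact hwR (hAR j _ hxA)
  have hAα : ∀ v ∈ x :: α₀, v ∈ A j := fun v hv => hα1.subset hv
  have hpq : p ∈ q s := by rw [hq]; simp
  have hq1 : ∀ v ∈ q₁ ++ [p, w], v ∈ q s ∨ v = w := by
    intro v hv
    rw [hq]
    simp at hv ⊢
    tauto
  have hold : ∀ s', ∀ v, v = w ∨ v ∈ A j → v ∉ β s' ++ q s' ++ α s' := by
    intro s' v hv hv'
    simp only [List.mem_append] at hv'
    obtain ⟨j', hj'⟩ := (h.left s').2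
    rcases hv with rfl | hv
    · rcases hv' with (hv' | hv') | hv'
      · exact hwR (hBR _ _ (hj' _ hv'))
      · exact hwq _ hv'
      · exact hwR (hAR _ _ (hjr s' _ hv'))
    · rcases hv' with (hv' | hv') | hv'
      · exact hAB _ _ v hv (hj' _ hv')
      · exact (h.mid s').2 v hv' (hAR _ _ hv)
      · exact hAA _ _ (hj3 s') v (hjr s' _ hv') hv
  have hnew : ∀ v ∈ β s ++ (q₁ ++ [p, w]) ++ x :: α₀,
      v ∈ β s ++ q s ++ α s ∨ v = w ∨ v ∈ A j := by
    intro v hv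
    simp only [List.mem_append, or_assoc] at hv ⊢
    rcases hv with hv | hv
    · exact Or.inl hv
    rcases hv with hv | hv
    · have := hq1 v (by simpa using Or.inl hv)
      tauto
    rcases hv with hv | hv
    · have := hq1 v (by simpa using Or.inr hv)
      tauto
    · exact Or.inr (Or.inr (Or.inr (Or.inr (hAα v hv))))
  refine ⟨Function.update q s (q₁ ++ [p, w]), Function.update α s (x :: α₀),
    ⟨?_, ?_, ?_, h.left, ?_, ?_⟩, ?_⟩
  · intro s'
    by_cases hs : s' = s
    · subst hs
      simp only [Function.update_self]
      have h1 := h.chain s'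
      rw [hq, show e s' :: (β s' ++ (q₁ ++ p :: q₂) ++ α s') ++ [f s'] =
        (e s' :: (β s' ++ q₁)) ++ p :: (q₂ ++ α s' ++ [f s']) by simp, List.isChain_split] at h1
      rw [show e s' :: (β s' ++ (q₁ ++ [p, w]) ++ x :: α₀) ++ [f s'] =
        (e s' :: (β s' ++ q₁)) ++ p :: (w :: (x :: α₀ ++ [f s'])) by simp, List.isChain_split]
      refine ⟨h1.1, ?_⟩
      rw [List.isChain_cons_cons, List.cons_append, List.isChain_cons_cons]
      exact ⟨hpw, hwx, hα2⟩
    · rw [Function.update_of_ne hs, Function.update_of_ne hs]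
      exact h.chain s'
  · intro s'
    by_cases hs : s' = s
    · subst hs
      simp only [Function.update_self]
      have h1 := h.nodup s'
      rw [hq, show β s' ++ (q₁ ++ p :: q₂) ++ α s' =
        (β s' ++ (q₁ ++ [p])) ++ (q₂ ++ α s') by simp] at h1
      rw [show β s' ++ (q₁ ++ [p, w]) ++ x :: α₀ =
        (β s' ++ (q₁ ++ [p])) ++ (w :: x :: α₀) by simp, List.nodup_append]
      refine ⟨h1.of_append_left, ?_, ?_⟩
      · rw [List.nodup_cons]
        exact ⟨fun hw' => hwR (hAR _ _ (hAα _ hw')), hα1.nodup (hAn j)⟩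
      · rintro v hv _ hv' rfl
        refine hold s' v ?_ ?_
        · rcases List.mem_cons.1 hv' with hv' | hv'
          · exact Or.inl hv'
          · exact Or.inr (hAα _ hv')
        · rw [hq]
          simp only [List.mem_append, List.mem_cons] at hv ⊢
          simp at hv
          tauto
    · rw [Function.update_of_ne hs, Function.update_of_ne hs]
      exact h.nodup s'
  · intro s₁ s₂ hne v hv hv'
    by_cases hs : s₁ = s
    · subst hs
      rw [Function.update_of_ne hne.symm, Function.update_of_ne hne.symm] at hv'
      simp only [Function.update_self] at hv
      rcases hnew v hv with hv | hv
      · exact h.disj _ _ hne v hv hv'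
      · exact hold _ v hv hv'
    · rw [Function.update_of_ne hs, Function.update_of_ne hs] at hv
      by_cases hs' : s₂ = s
      · subst hs'
        simp only [Function.update_self] at hv'
        rcases hnew v hv' with hv' | hv'
        · exact h.disj _ _ hne v hv hv'
        · exact hold _ v hv' hv
      · rw [Function.update_of_ne hs', Function.update_of_ne hs'] at hv'
        exact h.disj _ _ hne v hv hv'
  · intro s'
    by_cases hs : s' = s
    · subst hs
      simp only [Function.update_self]
      exact ⟨hα1.length_le.trans (hAl j), j, hAα⟩
    · rw [Function.update_of_ne hs]
      exact h.right s'
  · intro s'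
    by_cases hs : s' = s
    · subst hs
      simp only [Function.update_self]
      have h1 := h.mid s'
      refine ⟨?_, ?_⟩
      · rw [hq] at h1
        simp at h1 ⊢
        omega
      · intro v hv
        rcases hq1 v hv with hv | rfl
        · exact h1.2 v hv
        · exact hwR
    · rw [Function.update_of_ne hs]
      exact h.mid s'
  · refine Finset.sum_lt_sum (fun s' _ => ?_) ⟨s, Finset.mem_univ s, ?_⟩
    all_goals
      have hα3 := hα1.length_le.trans (hAl j)
    · by_cases hs : s' = s
      · subst hs
        simp only [Function.update_self]
        rw [hq]
        simp at hα3 ⊢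
        omega
      · rw [Function.update_of_ne hs, Function.update_of_ne hs]
    · simp only [Function.update_self]
      rw [hq]
      simp at hα3 ⊢
      omega

theorem exists_edges_of_chain {r : V → V → Prop} {b : V} :
    ∀ {m : List V} {a : V}, (a :: m ++ [b]).IsChain r → ∀ v ∈ m, (∃ u, r u v) ∧ ∃ u, r v u
  | [], _, _, _, hv => by simp at hv
  | c :: m, a, h, v, hv => by
    simp only [List.cons_append, List.isChain_cons_cons] at h
    rcases List.mem_cons.1 hv with rfl | hv
    · refine ⟨⟨a, h.1⟩, ?_⟩
      rcases m with _ | ⟨d, m⟩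
      · exact ⟨b, by simpa using h.2⟩
      · simp only [List.cons_append, List.isChain_cons_cons] at h
        exact ⟨d, h.2.1⟩
    · exact exists_edges_of_chain (m := m) h.2 v hv

theorem isChain_restrict {r : V → V → Prop} {P Q : V → Prop} {l : List V} {x y : V}
    (hl : l.IsChain r) (hn : l.Nodup) (hx : l.head? = some x) (hy : l.getLast? = some y)
    (hP : ∀ v ∈ l, v ≠ y → P v) (hQ : ∀ v ∈ l, v ≠ x → Q v) :
    l.IsChain fun u v => r u v ∧ P u ∧ Q v := by
  rw [List.isChain_iff_getElem] at hl ⊢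
  intro i hi
  refine ⟨hl i hi, hP _ (List.getElem_mem _) fun h => ?_, hQ _ (List.getElem_mem _) fun h => ?_⟩
  · rw [List.getLast?_eq_getElem?, List.getElem?_eq_some_iff] at hy
    obtain ⟨h1, h2⟩ := hy
    rw [← h2, hn.getElem_inj_iff] at h
    omega
  · rw [List.head?_eq_getElem?, List.getElem?_eq_some_iff] at hx
    obtain ⟨h1, h2⟩ := hx
    rw [← h2, hn.getElem_inj_iff] at h
    omega

variable {J S : Type}

open scoped Classical in
theorem exists_linker_paths [Fintype V] [Fintype J] {r : V → V → Prop} {R : Finset V} {k : ℕ}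
    (hconn : ∀ T : Finset V, T.card < k → ∀ u v, u ∉ T → v ∉ T → u ≠ v →
      ∃ l : List V, l.Nodup ∧ l.IsChain r ∧ l.head? = some u ∧ l.getLast? = some v ∧
        ∀ w ∈ l, w ∉ T)
    (hk : R.card + Fintype.card J ≤ k) {a b : J → V} (ha : Function.Injective a)
    (hb : Function.Injective b) (hab : ∀ i j, a i ≠ b j) (haR : ∀ j, a j ∈ R)
    (hbR : ∀ j, b j ∈ R) :
    ∃ (q : J → List V) (σ : J → J), Function.Injective σ ∧
      (∀ j, (b j :: q j ++ [a (σ j)]).IsChain r) ∧ (∀ j, (q j).Nodup) ∧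
      (∀ j, ∀ v ∈ q j, v ∉ R) ∧ ∀ i j, i ≠ j → ∀ v ∈ q i, v ∉ q j := by
  set X : Finset V := Finset.univ.image b with hX
  set Y : Finset V := Finset.univ.image a with hY
  have hXc : X.card = Fintype.card J := by
    rw [hX, Finset.card_image_of_injective _ hb, Finset.card_univ]
  have hYc : Y.card = Fintype.card J := by
    rw [hY, Finset.card_image_of_injective _ ha, Finset.card_univ]
  have hXR : ∀ x ∈ X, x ∈ R := by
    intro x hx
    obtain ⟨j, _, rfl⟩ := Finset.mem_image.1 hx
    exact hbR j
  have hYR : ∀ x ∈ Y, x ∈ R := by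
    intro x hx
    obtain ⟨j, _, rfl⟩ := Finset.mem_image.1 hx
    exact haR j
  have hXY : ∀ x ∈ X, x ∉ Y := by
    intro x hx hy
    obtain ⟨j, _, rfl⟩ := Finset.mem_image.1 hx
    obtain ⟨i, _, h⟩ := Finset.mem_image.1 hy
    exact hab i j h
  obtain ⟨Q, h1, h2, h3, h4, h5⟩ := exists_disjoint_paths
    (fun u v => r u v ∧ (u ∈ X ∨ u ∉ R) ∧ (v ∈ Y ∨ v ∉ R)) X Y
    (by
      rintro x hx u ⟨-, -, h | h⟩
      · exact hXY x hx h
      · exact h (hXR x hx))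
    (by
      intro S₀ hS₀
      obtain ⟨x, hx, hxS⟩ : ∃ x ∈ X, x ∉ S₀ := by
        by_contra! h
        exact absurd (Finset.card_le_card h) (by omega)
      obtain ⟨y, hy, hyS⟩ : ∃ y ∈ Y, y ∉ S₀ := by
        by_contra! h
        exact absurd (Finset.card_le_card (show Y ⊆ S₀ from h)) (by omega)
      have hxy : x ≠ y := by
        rintro rfl
        exact hXY x hx hy
      obtain ⟨l, l1, l2, l3, l4, l5⟩ := hconn ((R ∪ S₀) \ {x, y}) (by
        have e1 := Finset.card_le_card (Finset.sdiff_subset (s := R ∪ S₀) (t := {x, y}))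
        have e2 := Finset.card_union_le R S₀
        omega) x y (by simp) (by simp) hxy
      have l6 : ∀ v ∈ l, v = x ∨ v = y ∨ (v ∉ R ∧ v ∉ S₀) := by
        intro v hv
        have := l5 v hv
        simp only [Finset.mem_sdiff, Finset.mem_union, Finset.mem_insert,
          Finset.mem_singleton] at this
        tauto
      refine ⟨l, x, hx, l3, ⟨y, hy, List.mem_of_getLast? l4⟩,
        isChain_restrict l2 l1 l3 l4 ?_ ?_, ?_⟩
      · intro v hv hvy
        rcases l6 v hv with rfl | h | h
        · exact Or.inl hx
        · exact absurd h hvy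
        · exact Or.inr h.1
      · intro v hv hvx
        rcases l6 v hv with h | rfl | h
        · exact absurd h hvx
        · exact Or.inl hy
        · exact Or.inr h.1
      · intro v hv
        rcases l6 v hv with rfl | rfl | h
        · exact hxS
        · exact hyS
        · exact h.2)
  have hbX : ∀ j, b j ∈ X := fun j => Finset.mem_image_of_mem b (Finset.mem_univ j)
  have hdec : ∀ j, ∃ (q : List V) (i : J), Q (b j) = b j :: q ++ [a i] := by
    intro j
    obtain ⟨y, hy, hlast⟩ := h2 (b j) (hbX j)
    obtain ⟨i, _, rfl⟩ := Finset.mem_image.1 hy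
    have hhead := h1 (b j) (hbX j)
    rcases hQ : Q (b j) with _ | ⟨z, m⟩
    · simp [hQ] at hhead
    · rw [hQ] at hhead hlast
      obtain rfl : z = b j := by simpa using hhead
      rcases List.eq_nil_or_concat m with rfl | ⟨m', y, rfl⟩
      · exact absurd (by simpa using hlast) (hab i j).symm
      · refine ⟨m', i, ?_⟩
        have : y = a i := by simpa [List.getLast?_cons] using hlast
        simp [this]
  choose q σ hq using hdec
  refine ⟨q, σ, ?_, ?_, ?_, ?_, ?_⟩
  · intro i j hij
    by_contra hne
    refine h5 (b i) (hbX i) (b j) (hbX j) (fun h => hne (hb h)) (a (σ i)) ?_ ?_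
    · rw [hq i]; simp
    · rw [hq j, hij]; simp
  · intro j
    have := h3 (b j) (hbX j)
    rw [hq j] at this
    exact this.imp fun _ _ h => h.1
  · intro j
    have := h4 (b j) (hbX j)
    rw [hq j] at this
    exact (List.nodup_cons.1 this).2.of_append_left
  · intro j v hv
    have := h3 (b j) (hbX j)
    rw [hq j] at this
    obtain ⟨⟨u, -, -, hu⟩, ⟨u', -, hu', -⟩⟩ := exists_edges_of_chain this v hv
    rcases hu with hu | hu
    · rcases hu' with hu' | hu'
      · exact absurd hu (hXY v hu')
      · exact hu'
    · exact hu
  · intro i j hij v hv hv'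
    refine h5 (b i) (hbX i) (b j) (hbX j) (fun h => hij (hb h)) v ?_ ?_
    · rw [hq i]; simp [hv]
    · rw [hq j]; simp [hv']

theorem sum_length_le_card [Fintype V] [Fintype J] {q : J → List V} (hn : ∀ j, (q j).Nodup)
    (hd : ∀ i j, i ≠ j → ∀ v ∈ q i, v ∉ q j) : ∑ j, (q j).length ≤ Fintype.card V := by
  classical
  have h1 : (Finset.univ.biUnion fun j => (q j).toFinset).card = ∑ j, (q j).length := by
    rw [Finset.card_biUnion]
    · exact Finset.sum_congr rfl fun j _ => List.toFinset_card_of_nodup (hn j)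
    · intro i _ j _ hij
      rw [Function.onFun, Finset.disjoint_left]
      intro v hv hv'
      exact hd i j hij v (by simpa using hv) (by simpa using hv')
  rw [← h1]
  exact Finset.card_le_univ _

open scoped Classical in
theorem exists_gapSystem [Fintype V] [Fintype J] [Fintype S] {r : V → V → Prop}
    {R : Finset V} {k c : ℕ}
    (hconn : ∀ T : Finset V, T.card < k → ∀ u v, u ∉ T → v ∉ T → u ≠ v →
      ∃ l : List V, l.Nodup ∧ l.IsChain r ∧ l.head? = some u ∧ l.getLast? = some v ∧
        ∀ w ∈ l, w ∉ T)
    (hk : R.card + Fintype.card J ≤ k) {A B : J → List V} {e f : S → V}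
    (hA : ∀ j, (A j).IsChain r) (hA0 : ∀ j, A j ≠ []) (hAl : ∀ j, (A j).length ≤ c)
    (hAn : ∀ j, (A j).Nodup) (hAR : ∀ j, ∀ a ∈ A j, a ∈ R)
    (hAA : ∀ j j', j ≠ j' → ∀ a ∈ A j, a ∉ A j')
    (hB : ∀ j, (B j).IsChain r) (hB0 : ∀ j, B j ≠ []) (hBl : ∀ j, (B j).length ≤ c)
    (hBn : ∀ j, (B j).Nodup) (hBR : ∀ j, ∀ a ∈ B j, a ∈ R)
    (hBB : ∀ j j', j ≠ j' → ∀ a ∈ B j, a ∉ B j')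
    (hAB : ∀ j j', ∀ a ∈ A j, a ∉ B j')
    (hf : ∀ s, 10 * (Finset.univ.filter fun j => Undom r (A j) (f s)).card ≤ Fintype.card J)
    (he : ∀ s, 10 * (Finset.univ.filter fun j => Undom (flip r) (B j) (e s)).card ≤
      Fintype.card J)
    (hS : 10 * Fintype.card S < Fintype.card J) :
    ∃ β q α : S → List V,
      GapSystem r R A B e f c (4 * Fintype.card V / Fintype.card J) β q α := by
  have hex : ∀ l : List V, l ≠ [] → (∃ x, l.head? = some x) ∧ ∃ x, l.getLast? = some x := by
    intro l hl
    exact ⟨⟨l.head hl, List.head?_eq_some_head hl⟩, ⟨l.getLast hl, List.getLast?_eq_some_getLast hl⟩⟩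
  choose a ha using fun j => (hex (A j) (hA0 j)).1
  choose b hb using fun j => (hex (B j) (hB0 j)).2
  have haA : ∀ j, a j ∈ A j := fun j => List.mem_of_mem_head? (ha j)
  have hbB : ∀ j, b j ∈ B j := fun j => List.mem_of_getLast? (hb j)
  obtain ⟨q, σ, hσ, hq1, hq2, hq3, hq4⟩ := exists_linker_paths hconn hk (a := a) (b := b)
    (fun i j h => by
      by_contra hne
      exact hAA i j hne (a i) (haA i) (h ▸ haA j))
    (fun i j h => by
      by_contra hne
      exact hBB i j hne (b i) (hbB i) (h ▸ hbB j))
    (fun i j h => hAB i j (a i) (haA i) (h ▸ hbB j))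
    (fun j => hAR j _ (haA j)) (fun j => hBR j _ (hbB j))
  set N := Fintype.card J with hN
  set L := 4 * Fintype.card V / N with hL
  have hlong : 4 * (Finset.univ.filter fun j => L < (q j).length).card ≤ N := by
    have hV : 0 < Fintype.card V := by
      obtain ⟨j⟩ : Nonempty J := Fintype.card_pos_iff.1 (by omega)
      exact Fintype.card_pos_iff.2 ⟨a j⟩
    have e1 := sum_length_le_card hq2 hq4
    have e2 : (Finset.univ.filter fun j => L < (q j).length).card * (4 * Fintype.card V) ≤
        N * Fintype.card V := by
      calc _ = ∑ j ∈ Finset.univ.filter fun j => L < (q j).length, 4 * Fintype.card V := by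
            rw [Finset.sum_const, smul_eq_mul]
        _ ≤ ∑ j ∈ Finset.univ.filter fun j => L < (q j).length, N * (q j).length := by
            refine Finset.sum_le_sum fun j hj => ?_
            rw [Finset.mem_filter, hL, Nat.div_lt_iff_lt_mul (by omega)] at hj
            rw [Nat.mul_comm N]
            exact hj.2.le
        _ ≤ ∑ j, N * (q j).length :=
            Finset.sum_le_sum_of_subset (Finset.filter_subset _ _)
        _ ≤ _ := by
            rw [← Finset.mul_sum]
            exact Nat.mul_le_mul_left _ e1
    have e3 : (4 * (Finset.univ.filter fun j => L < (q j).length).card) * Fintype.card V ≤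
        N * Fintype.card V := by
      calc _ = (Finset.univ.filter fun j => L < (q j).length).card * (4 * Fintype.card V) := by ring
        _ ≤ _ := e2
    exact Nat.le_of_mul_le_mul_right e3 hV
  obtain ⟨g, hgi, hg⟩ := exists_injective_choice (ι := S) (fun s => Finset.univ.filter fun j =>
    ¬ Undom (flip r) (B j) (e s) ∧ ¬ Undom r (A (σ j)) (f s) ∧ (q j).length ≤ L) (by
      intro s
      have e1 : (Finset.univ : Finset J) ⊆ (Finset.univ.filter fun j =>
          ¬ Undom (flip r) (B j) (e s) ∧ ¬ Undom r (A (σ j)) (f s) ∧ (q j).length ≤ L) ∪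
          ((Finset.univ.filter fun j => Undom (flip r) (B j) (e s)) ∪
          ((Finset.univ.filter fun j => Undom r (A (σ j)) (f s)) ∪
          Finset.univ.filter fun j => L < (q j).length)) := by
        intro j _
        simp only [Finset.mem_union, Finset.mem_filter, Finset.mem_univ, true_and, ← not_le]
        tauto
      have e2 := (Finset.card_le_card e1).trans ((Finset.card_union_le _ _).trans
        (Nat.add_le_add_left ((Finset.card_union_le _ _).trans
        (Nat.add_le_add_left (Finset.card_union_le _ _) _)) _))
      rw [Finset.card_univ] at e2
      have e3 : (Finset.univ.filter fun j => Undom r (A (σ j)) (f s)).card ≤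
          (Finset.univ.filter fun j => Undom r (A j) (f s)).card := by
        refine Finset.card_le_card_of_injOn σ (fun j hj => ?_) hσ.injOn
        simpa using hj
      have e4 := hf s
      have e5 := he s
      omega)
  simp only [Finset.mem_filter, Finset.mem_univ, true_and] at hg
  have hβ : ∀ s, ∃ β, (β ++ [b (g s)]).Sublist (B (g s)) ∧
      (e s :: β ++ [b (g s)]).IsChain r := by
    intro s
    have := (hg s).1
    simp only [Undom, not_forall, not_not] at this
    obtain ⟨y, hy, hey⟩ := this
    exact exists_final_chain (hB _) hy hey (hb _)
  have hα : ∀ s, ∃ α, (a (σ (g s)) :: α).Sublist (A (σ (g s))) ∧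
      (a (σ (g s)) :: α ++ [f s]).IsChain r := by
    intro s
    have := (hg s).2.1
    simp only [Undom, not_forall, not_not] at this
    obtain ⟨y, hy, hey⟩ := this
    exact exists_initial_chain (hA _) hy hey (ha _)
  choose β hβ1 hβ2 using hβ
  choose α hα1 hα2 using hα
  refine ⟨fun s => β s ++ [b (g s)], fun s => q (g s), fun s => a (σ (g s)) :: α s,
    ⟨?_, ?_, ?_, ?_, ?_, ?_⟩⟩
  · intro s
    have h1 := hq1 (g s)
    rw [show e s :: (β s ++ [b (g s)] ++ q (g s) ++ a (σ (g s)) :: α s) ++ [f s] =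
      (e s :: β s) ++ b (g s) :: (q (g s) ++ (a (σ (g s)) :: α s ++ [f s])) by simp,
      List.isChain_split]
    refine ⟨hβ2 s, ?_⟩
    rw [List.cons_append (a := a (σ (g s))), ← List.cons_append, List.isChain_split]
    exact ⟨h1, hα2 s⟩
  · intro s
    rw [List.nodup_append, List.nodup_append]
    refine ⟨⟨(hβ1 s).nodup (hBn _), hq2 _, ?_⟩, (hα1 s).nodup (hAn _), ?_⟩
    · rintro v hv _ hv' rfl
      exact hq3 _ v hv' (hBR _ _ ((hβ1 s).subset hv))
    · rintro v hv _ hv' rfl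
      rcases List.mem_append.1 hv with hv | hv
      · exact hAB _ _ v ((hα1 s).subset hv') ((hβ1 s).subset hv)
      · exact hq3 _ v hv (hAR _ _ ((hα1 s).subset hv'))
  · intro s s' hne v hv hv'
    have hgne : g s ≠ g s' := fun h => hne (hgi h)
    simp only [List.mem_append (s := β _ ++ [b _] ++ q _), List.mem_append (s := β _ ++ [b _])]
      at hv hv'
    rcases hv with (hv | hv) | hv <;> rcases hv' with (hv' | hv') | hv'
    · exact hBB _ _ hgne v ((hβ1 s).subset hv) ((hβ1 s').subset hv')
    · exact hq3 _ v hv' (hBR _ _ ((hβ1 s).subset hv))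
    · exact hAB _ _ v ((hα1 s').subset hv') ((hβ1 s).subset hv)
    · exact hq3 _ v hv (hBR _ _ ((hβ1 s').subset hv'))
    · exact hq4 _ _ hgne v hv hv'
    · exact hq3 _ v hv (hAR _ _ ((hα1 s').subset hv'))
    · exact hAB _ _ v ((hα1 s).subset hv) ((hβ1 s').subset hv')
    · exact hq3 _ v hv' (hAR _ _ ((hα1 s).subset hv))
    · exact hAA _ _ (fun h => hgne (hσ h)) v ((hα1 s).subset hv) ((hα1 s').subset hv')
  · intro s
    exact ⟨(hβ1 s).length_le.trans (hBl _), g s, fun v hv => (hβ1 s).subset hv⟩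
  · intro s
    exact ⟨(hα1 s).length_le.trans (hAl _), σ (g s), fun v hv => (hα1 s).subset hv⟩
  · intro s
    exact ⟨(hg s).2.2, fun v hv => hq3 _ v hv⟩

section

variable {J S : Type}

open scoped Classical in
theorem card_filter_le_of_short_tail {P : V → Prop} {l : List V} {m : ℕ}
    (h : ∀ l₁ p l₂, l = l₁ ++ p :: l₂ → P p → l₂.length ≤ m) :
    (l.toFinset.filter P).card ≤ m + 1 := by
  refine (Finset.card_le_card (t := (l.reverse.take (m + 1)).toFinset) ?_).trans
    ((List.toFinset_card_le _).trans (by simp))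
  intro v hv
  rw [Finset.mem_filter, List.mem_toFinset] at hv
  obtain ⟨l₁, l₂, rfl⟩ := List.append_of_mem hv.1
  have h1 := h l₁ v l₂ rfl hv.2
  rw [List.mem_toFinset, List.reverse_append, List.reverse_cons, List.append_assoc,
    List.take_append, List.mem_append]
  right
  obtain ⟨d, hd⟩ : ∃ d, m + 1 - l₂.reverse.length = d + 1 := ⟨m - l₂.length, by simp; omega⟩
  rw [hd]
  simp

open scoped Classical in
theorem exists_thin_gapSystem [Fintype V] [Fintype J] [Fintype S] {r : V → V → Prop}
    (hr : ∀ u v, u ≠ v → r u v ∨ r v u) {R : Finset V} {k c : ℕ}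
    (hconn : ∀ T : Finset V, T.card < k → ∀ u v, u ∉ T → v ∉ T → u ≠ v →
      ∃ l : List V, l.Nodup ∧ l.IsChain r ∧ l.head? = some u ∧ l.getLast? = some v ∧
        ∀ w ∈ l, w ∉ T)
    (hk : R.card + Fintype.card J ≤ k) {A B : J → List V} {e f : S → V}
    (hA : ∀ j, (A j).IsChain r) (hA0 : ∀ j, A j ≠ []) (hAl : ∀ j, (A j).length ≤ c)
    (hAn : ∀ j, (A j).Nodup) (hAR : ∀ j, ∀ a ∈ A j, a ∈ R)
    (hAA : ∀ j j', j ≠ j' → ∀ a ∈ A j, a ∉ A j')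
    (hB : ∀ j, (B j).IsChain r) (hB0 : ∀ j, B j ≠ []) (hBl : ∀ j, (B j).length ≤ c)
    (hBn : ∀ j, (B j).Nodup) (hBR : ∀ j, ∀ a ∈ B j, a ∈ R)
    (hBB : ∀ j j', j ≠ j' → ∀ a ∈ B j, a ∉ B j')
    (hAB : ∀ j j', ∀ a ∈ A j, a ∉ B j')
    (hf : ∀ s, 10 * (Finset.univ.filter fun j => Undom r (A j) (f s)).card ≤ Fintype.card J)
    (he : ∀ s, 10 * (Finset.univ.filter fun j => Undom (flip r) (B j) (e s)).card ≤
      Fintype.card J)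
    (hS : 10 * Fintype.card S < Fintype.card J) :
    ∃ β q α : S → List V,
      GapSystem r R A B e f c (4 * Fintype.card V / Fintype.card J) β q α ∧
      (∀ w, w ∉ R → (∀ s, w ∉ q s) →
        Fintype.card J ≤ 5 * (Finset.univ.filter fun j => Undom r (A j) w).card →
        ∀ s, ((q s).toFinset.filter fun v => r v w).card ≤ c + 2) ∧
      (∀ w, w ∉ R → (∀ s, w ∉ q s) →
        Fintype.card J ≤ 5 * (Finset.univ.filter fun j => Undom (flip r) (B j) w).card →
        ∀ s, ((q s).toFinset.filter fun v => r w v).card ≤ c + 2) := by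
  have hex : ∃ m, ∃ β q α : S → List V,
      GapSystem r R A B e f c (4 * Fintype.card V / Fintype.card J) β q α ∧
      ∑ s, (β s ++ q s ++ α s).length = m := by
    obtain ⟨β, q, α, h⟩ := exists_gapSystem hconn hk hA hA0 hAl hAn hAR hAA hB hB0 hBl hBn hBR hBB
      hAB hf he hS
    exact ⟨_, β, q, α, h, rfl⟩
  obtain ⟨β, q, α, h, hm⟩ := Nat.find_spec hex
  have hmin : ∀ β' q' α' : S → List V,
      GapSystem r R A B e f c (4 * Fintype.card V / Fintype.card J) β' q' α' →
      ∑ s, (β s ++ q s ++ α s).length ≤ ∑ s, (β' s ++ q' s ++ α' s).length := by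
    intro β' q' α' h'
    rw [hm]
    exact Nat.find_min' hex ⟨β', q', α', h', rfl⟩
  refine ⟨β, q, α, h, ?_, ?_⟩
  · intro w hwR hwq hw s
    refine card_filter_le_of_short_tail (m := c + 1) fun q₁ p q₂ hq hp => ?_
    by_contra! hlong
    obtain ⟨q', α', h1, h2⟩ := h.improve hr hA hA0 hAl hAn hAR hBR hAA hAB hf hS hwR hwq hw hq hp
      hlong
    exact absurd (hmin _ _ _ h1) (by omega)
  · intro w hwR hwq hw s
    rw [← List.toFinset_reverse]
    refine card_filter_le_of_short_tail (m := c + 1) fun q₁ p q₂ hq hp => ?_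
    by_contra! hlong
    have hU : ∀ j v, Undom (flip r) (B j).reverse v ↔ Undom (flip r) (B j) v := by
      intro j v
      simp [Undom]
    obtain ⟨q', β', h1, h2⟩ := h.reverse.improve (r := flip r) (w := w) (s := s) (p := p)
      (fun u v huv => (hr u v huv).symm)
      (fun j => by rw [List.isChain_reverse]; exact hB j) (fun j => by simpa using hB0 j)
      (fun j => by simpa using hBl j) (fun j => by simpa using hBn j)
      (fun j => by simpa using hBR j) (fun j => by simpa using hAR j)
      (fun j j' hj => by simpa using hBB j j' hj)
      (fun j j' a ha ha' => hAB j' j a (by simpa using ha') (by simpa using ha))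
      (fun s => by simpa only [hU] using he s) hS hwR (fun s => by simpa using hwq s)
      (by simpa only [hU] using hw) hq hp hlong
    have h3 := h1.reverse
    simp only [List.reverse_reverse] at h3
    have h4 := hmin (fun s => (β' s).reverse) (fun s => (q' s).reverse) (fun s => α s) h3
    simp only [List.length_append, List.length_reverse] at h2 h4
    have e1 : ∑ s, ((α s).length + (q' s).length + (β' s).length) =
        ∑ s, ((β' s).length + (q' s).length + (α s).length) :=
      Finset.sum_congr rfl fun s _ => by omega
    have e2 : ∑ s, ((α s).length + (q s).length + (β s).length) =
        ∑ s, ((β s).length + (q s).length + (α s).length) :=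
      Finset.sum_congr rfl fun s _ => by omega
    omega



end

/-- Short disjoint chains covering `W₁ ∪ W₂` whose first vertices avoid `W₁` and whose last
vertices avoid `W₂`. -/
structure ChainCover (r : V → V → Prop) (F W₁ W₂ : Finset V) (C : V → List V) : Prop where
  empty : ∀ w, w ∉ W₁ → w ∉ W₂ → C w = []
  chain : ∀ w, (C w).IsChain r
  nodup : ∀ w, (C w).Nodup
  length_le : ∀ w, (C w).length ≤ 3
  avoid : ∀ w, ∀ v ∈ C w, v ∉ F
  head : ∀ w, ∀ v ∈ (C w).head?, v ∉ W₁
  last : ∀ w, ∀ v ∈ (C w).getLast?, v ∉ W₂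
  disj : ∀ w w', w ≠ w' → ∀ v ∈ C w, v ∉ C w'
  cover : ∀ w, w ∈ W₁ ∨ w ∈ W₂ → ∃ w', w ∈ C w'

theorem ChainCover.reverse {r : V → V → Prop} {F W₁ W₂ : Finset V} {C : V → List V}
    (h : ChainCover r F W₁ W₂ C) : ChainCover (flip r) F W₂ W₁ fun w => (C w).reverse where
  empty w h₁ h₂ := by simp [h.empty w h₂ h₁]
  chain w := by rw [List.isChain_reverse]; exact h.chain w
  nodup w := by simpa using h.nodup w
  length_le w := by simpa using h.length_le w
  avoid w := by simpa using h.avoid w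
  head w := by simpa using h.last w
  last w := by simpa using h.head w
  disj w w' hw := by simpa using h.disj w w' hw
  cover w hw := by simpa using h.cover w hw.symm

open scoped Classical in
theorem exists_chainCover_of_le [Fintype V] {r : V → V → Prop} {F W₁ W₂ : Finset V}
    (h₁ : ∀ w ∈ W₁, w ∉ F) (h₂ : ∀ w ∈ W₂, w ∉ F)
    (d₁ : ∀ w ∈ W₁, 4 * W₁.card ≤ (Finset.univ.filter fun u => r u w ∧ u ∉ F).card)
    (d₂ : ∀ w ∈ W₂, 4 * W₂.card ≤ (Finset.univ.filter fun u => r w u ∧ u ∉ F).card)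
    (hle : W₁.card ≤ W₂.card) : ∃ C, ChainCover r F W₁ W₂ C := by
  obtain ⟨h, hhi, hh⟩ := exists_injective_choice (ι := W₁) (fun w =>
    (Finset.univ.filter fun u => r u w.1 ∧ u ∉ F) \ W₁) (by
      intro w
      have e1 := Finset.le_card_sdiff W₁ (Finset.univ.filter fun u => r u w.1 ∧ u ∉ F)
      have e2 := d₁ w.1 w.2
      rw [Fintype.card_coe]
      omega)
  set H := Finset.univ.image h with hH
  have hHc : H.card ≤ W₁.card := by
    rw [← Fintype.card_coe W₁]
    exact Finset.card_image_le
  obtain ⟨g, hgi, hg⟩ := exists_injective_choice (ι := W₂) (fun w =>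
    (Finset.univ.filter fun u => r w.1 u ∧ u ∉ F) \ (W₁ ∪ (H ∪ W₂))) (by
      intro w
      have e1 := Finset.le_card_sdiff (W₁ ∪ (H ∪ W₂))
        (Finset.univ.filter fun u => r w.1 u ∧ u ∉ F)
      have e2 := d₂ w.1 w.2
      have e3 := Finset.card_union_le W₁ (H ∪ W₂)
      have e4 := Finset.card_union_le H W₂
      rw [Fintype.card_coe]
      omega)
  simp only [Finset.mem_sdiff, Finset.mem_filter, Finset.mem_univ, true_and,
    Finset.mem_union, not_or] at hh hg
  have hHm : ∀ w, h w ∈ H := fun w => Finset.mem_image_of_mem h (Finset.mem_univ w)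
  have hHW : ∀ w ∈ H, w ∉ W₁ ∧ w ∉ F := by
    intro w hw
    obtain ⟨x, _, rfl⟩ := Finset.mem_image.1 hw
    exact ⟨(hh x).2, (hh x).1.2⟩
  -- the chain attached to a special vertex
  set T : V → List V := fun w => if hw : w ∈ W₂ then [g ⟨w, hw⟩] else [] with hT
  set C : V → List V := fun w => if hw : w ∈ W₁ then h ⟨w, hw⟩ :: w :: T w else
    if w ∈ H then [] else if w ∈ W₂ then w :: T w else [] with hC
  have hTm : ∀ w, ∀ v ∈ T w, ∃ hw : w ∈ W₂, v = g ⟨w, hw⟩ := by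
    intro w v hv
    by_cases hw : w ∈ W₂
    · exact ⟨hw, by simpa [hT, hw] using hv⟩
    · simp [hT, hw] at hv
  have hTn : ∀ w, ∀ v ∈ T w, v ∉ W₁ ∧ v ∉ H ∧ v ∉ W₂ ∧ v ∉ F ∧ r w v := by
    intro w v hv
    obtain ⟨hw, rfl⟩ := hTm w v hv
    have := hg ⟨w, hw⟩
    tauto
  have hTi : ∀ w w', w ≠ w' → ∀ v ∈ T w, v ∉ T w' := by
    intro w w' hne v hv hv'
    obtain ⟨hw, rfl⟩ := hTm w v hv
    obtain ⟨hw', e⟩ := hTm w' _ hv'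
    exact hne (by simpa using hgi e)
  have hTl : ∀ w, T w = [] ∨ ∃ v, T w = [v] := by
    intro w
    by_cases hw : w ∈ W₂ <;> simp [hT, hw]
  have hCm : ∀ w, ∀ v ∈ C w, (∃ hw : w ∈ W₁, v = h ⟨w, hw⟩) ∨
      (v = w ∧ (w ∈ W₁ ∨ w ∈ W₂ ∧ w ∉ H)) ∨ v ∈ T w := by
    intro w v hv
    by_cases hw : w ∈ W₁
    · simp only [hC, hw, dif_pos, List.mem_cons] at hv
      rcases hv with hv | hv | hv
      · exact Or.inl ⟨hw, hv⟩
      · exact Or.inr (Or.inl ⟨hv, Or.inl hw⟩)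
      · exact Or.inr (Or.inr hv)
    · by_cases hwH : w ∈ H
      · simp [hC, hw, hwH] at hv
      · by_cases hw2 : w ∈ W₂
        · simp only [hC, hw, hwH, hw2, dif_neg, not_false_eq_true, if_false, if_true,
            List.mem_cons] at hv
          tauto
        · simp [hC, hw, hwH, hw2] at hv
  have hcase : ∀ P : List V → Prop, ∀ w, P [] → (∀ hw : w ∈ W₁, P (h ⟨w, hw⟩ :: w :: T w)) →
      (w ∈ W₂ → w ∉ W₁ → w ∉ H → P (w :: T w)) → P (C w) := by
    intro P w p1 p2 p3
    by_cases hw : w ∈ W₁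
    · simp only [hC, hw, dif_pos]; exact p2 hw
    · by_cases hwH : w ∈ H
      · simp only [hC, hw, dif_neg, not_false_eq_true, hwH, if_true]; exact p1
      · by_cases hw2 : w ∈ W₂
        · simp only [hC, hw, hwH, hw2, dif_neg, not_false_eq_true, if_false, if_true]
          exact p3 hw2 hw hwH
        · simp only [hC, hw, hwH, hw2, dif_neg, not_false_eq_true, if_false]; exact p1
  refine ⟨C, ?_, ?_, ?_, ?_, ?_, ?_, ?_, ?_, ?_⟩
  · intro w hw1 hw2
    simp [hC, hw1, hw2]
  · intro w
    refine hcase (fun l => l.IsChain r) w (by simp) (fun hw => ?_) fun hw _ _ => ?_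
    · rcases hTl w with e | ⟨v, e⟩
      · rw [e]; simpa using (hh ⟨w, hw⟩).1.1
      · have := (hTn w v (by simp [e])).2.2.2.2
        rw [e]; simpa using ⟨(hh ⟨w, hw⟩).1.1, this⟩
    · rcases hTl w with e | ⟨v, e⟩
      · rw [e]; simp
      · have := (hTn w v (by simp [e])).2.2.2.2
        rw [e]; simpa using this
  · intro w
    refine hcase (fun l => l.Nodup) w (by simp) (fun hw => ?_) fun hw _ _ => ?_
    · have hne : h ⟨w, hw⟩ ≠ w := by
        intro e
        have := (hh ⟨w, hw⟩).2
        rw [e] at this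
        exact this hw
      rcases hTl w with e | ⟨v, e⟩
      · rw [e]; simpa using hne
      · have h1 := hTn w v (by simp [e])
        rw [e]
        simp only [List.nodup_cons, List.mem_cons, List.not_mem_nil, or_false, not_or,
          not_false_eq_true, List.nodup_nil, and_true]
        refine ⟨⟨hne, ?_⟩, ?_⟩
        · intro e'
          exact h1.2.1 (e' ▸ hHm _)
        · rintro rfl
          exact h1.1 hw
    · rcases hTl w with e | ⟨v, e⟩
      · rw [e]; simp
      · have h1 := hTn w v (by simp [e])
        rw [e]
        simp only [List.nodup_cons, List.mem_cons, List.not_mem_nil, or_false,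
          not_false_eq_true, List.nodup_nil, and_true]
        rintro rfl
        exact h1.2.2.1 hw
  · intro w
    refine hcase (fun l => l.length ≤ 3) w (by simp) (fun hw => ?_) fun hw _ _ => ?_ <;>
    rcases hTl w with e | ⟨v, e⟩ <;> simp [e]
  · intro w v hv
    rcases hCm w v hv with ⟨hw, rfl⟩ | ⟨rfl, hw⟩ | hv
    · exact (hh _).1.2
    · rcases hw with hw | hw
      · exact h₁ _ hw
      · exact h₂ _ hw.1
    · exact (hTn w v hv).2.2.2.1
  · intro w
    refine hcase (fun l => ∀ v ∈ l.head?, v ∉ W₁) w (by simp) (fun hw => ?_) fun hw hw1 _ => ?_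
    · simpa using (hh ⟨w, hw⟩).2
    · simp [hw1]
  · intro w
    have : ∀ v ∈ (w :: T w).getLast?, v ∉ W₂ := by
      by_cases hw : w ∈ W₂
      · rcases hTl w with e | ⟨v, e⟩
        · simp [hT, hw] at e
        · have := (hTn w v (by simp [e])).2.2.1
          simpa [e] using this
      · simp [hT, hw]
    refine hcase (fun l => ∀ v ∈ l.getLast?, v ∉ W₂) w (by simp) (fun hw => ?_)
      fun hw hw1 _ => this
    rwa [List.getLast?_cons_cons]
  · intro w w' hne v hv hv'
    have aux : ∀ w w', w ≠ w' → ∀ v, (∃ hw : w ∈ W₁, v = h ⟨w, hw⟩) → v ∉ C w' := by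
      rintro w w' hne v ⟨hw, rfl⟩ hv'
      rcases hCm w' _ hv' with ⟨hw', e⟩ | ⟨e, hw'⟩ | hv'
      · exact hne (by simpa using hhi e)
      · rcases hw' with hw' | hw'
        · exact (hh _).2 (e ▸ hw')
        · exact hw'.2 (e ▸ hHm _)
      · exact (hTn _ _ hv').2.1 (hHm _)
    rcases hCm w v hv with hw | ⟨rfl, hw⟩ | hv1
    · exact aux w w' hne v hw hv'
    · rcases hCm w' v hv' with hw' | ⟨rfl, hw'⟩ | hv'
      · exact aux w' v hne.symm v hw' hv
      · exact hne rfl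
      · have := hTn _ _ hv'
        tauto
    · rcases hCm w' v hv' with hw' | ⟨rfl, hw'⟩ | hv'
      · exact aux w' w hne.symm v hw' hv
      · have := hTn _ _ hv1
        tauto
      · exact hTi w w' hne v hv1 hv'
  · intro w hw
    by_cases hw1 : w ∈ W₁
    · exact ⟨w, by simp [hC, hw1]⟩
    · have hw2 := hw.resolve_left hw1
      by_cases hwH : w ∈ H
      · obtain ⟨x, _, rfl⟩ := Finset.mem_image.1 hwH
        exact ⟨x.1, by simp [hC, x.2]⟩
      · exact ⟨w, by simp [hC, hw1, hwH, hw2]⟩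

open scoped Classical in
theorem exists_chainCover [Fintype V] {r : V → V → Prop} {F W₁ W₂ : Finset V}
    (h₁ : ∀ w ∈ W₁, w ∉ F) (h₂ : ∀ w ∈ W₂, w ∉ F)
    (d₁ : ∀ w ∈ W₁, 4 * W₁.card ≤ (Finset.univ.filter fun u => r u w ∧ u ∉ F).card)
    (d₂ : ∀ w ∈ W₂, 4 * W₂.card ≤ (Finset.univ.filter fun u => r w u ∧ u ∉ F).card) :
    ∃ C, ChainCover r F W₁ W₂ C := by
  rcases le_total W₁.card W₂.card with h | h
  · exact exists_chainCover_of_le h₁ h₂ d₁ d₂ h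
  · obtain ⟨C, hC⟩ := exists_chainCover_of_le (r := flip r) h₂ h₁ d₂ d₁ h
    exact ⟨_, hC.reverse⟩

/-- A family of pairwise vertex-disjoint paths. -/
structure Fam {K : Type} (r : V → V → Prop) (comp : K → List V) : Prop where
  chain : ∀ k, (comp k).IsChain r
  nodup : ∀ k, (comp k).Nodup
  disj : ∀ k k', k ≠ k' → ∀ v ∈ comp k, v ∉ comp k'

theorem Fam.eq_of_mem {K : Type} {r : V → V → Prop} {comp : K → List V} (h : Fam r comp)
    {k k' : K} {v : V} (hk : v ∈ comp k) (hk' : v ∈ comp k') : k = k' := by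
  by_contra hne
  exact h.disj k k' hne v hk hk'

theorem Fam.nodup_flatMap {K : Type} {r : V → V → Prop} {comp : K → List V} (h : Fam r comp)
    {l : List K} (hl : l.Nodup) : (l.flatMap comp).Nodup := by
  rw [List.nodup_flatMap]
  refine ⟨fun k _ => h.nodup k, hl.imp fun {a b} hab => ?_⟩
  intro v hv hv'
  exact h.disj a b hab v hv hv'

open scoped Classical in
/-- Concatenate some members of a family into blocks and insert further members into them. -/
theorem Fam.merge {K B : Type} [Fintype K] {r : V → V → Prop}
    (hr : ∀ u v, u ≠ v → r u v ∨ r v u) {comp : K → List V} (h : Fam r comp) (lab : B → List K)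
    (asg : K → Option B) (hl : ∀ b, (lab b).Nodup)
    (hl' : ∀ k b b', k ∈ lab b → k ∈ lab b' → b = b') (hla : ∀ k b, k ∈ lab b → asg k = none)
    (hc : ∀ b, ((lab b).flatMap comp).IsChain r)
    (hi : ∀ k b, asg k = some b → Insertable r ((lab b).flatMap comp) (comp k)) :
    ∃ Q : B → List V,
      Fam r (Sum.elim Q fun k => if asg k = none ∧ ∀ b, k ∉ lab b then comp k else []) ∧
      ∀ b, ((lab b).flatMap comp).Sublist (Q b) ∧
        (Q b).head? = ((lab b).flatMap comp).head? ∧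
        (Q b).getLast? = ((lab b).flatMap comp).getLast? ∧
        (∀ v, v ∈ Q b ↔ (∃ k ∈ lab b, v ∈ comp k) ∨ ∃ k, asg k = some b ∧ v ∈ comp k) ∧
        (Q b).length = ((lab b).flatMap comp).length +
          ∑ k ∈ Finset.univ.filter (fun k => asg k = some b), (comp k).length := by
  have key : ∀ b, ∃ Q : List V, Q.IsChain r ∧ Q.Nodup ∧ ((lab b).flatMap comp).Sublist Q ∧
      Q.head? = ((lab b).flatMap comp).head? ∧
      Q.getLast? = ((lab b).flatMap comp).getLast? ∧
      (∀ v, v ∈ Q ↔ (∃ k ∈ lab b, v ∈ comp k) ∨ ∃ k, asg k = some b ∧ v ∈ comp k) ∧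
      Q.length = ((lab b).flatMap comp).length +
        ∑ k ∈ Finset.univ.filter (fun k => asg k = some b), (comp k).length := by
    intro b
    set I := (Finset.univ.filter fun k => asg k = some b).toList with hI
    have hIm : ∀ k, k ∈ I ↔ asg k = some b := by simp [hI]
    have hIn : I.Nodup := Finset.nodup_toList _
    have hnd : ((I ++ lab b).flatMap comp).Nodup := by
      refine h.nodup_flatMap (List.nodup_append.2 ⟨hIn, hl b, ?_⟩)
      rintro k hk _ hk' rfl
      rw [hIm, hla k b hk'] at hk
      simp at hk
    obtain ⟨Q, h1, h2, h3, h4, h5⟩ := exists_isChain_insert_many hr (I.map comp)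
      ((lab b).flatMap comp) (hc b)
      (by
        intro C hC
        obtain ⟨k, hk, rfl⟩ := List.mem_map.1 hC
        exact ⟨h.chain k, hi k b ((hIm k).1 hk)⟩)
      (by rwa [List.flatMap_append, List.flatMap_def (l := I)] at hnd)
    rw [← List.flatMap_def] at h3
    refine ⟨Q, h1, ?_, h2, h4, h5, ?_, ?_⟩
    · rw [h3.nodup_iff, ← List.flatMap_append]
      exact hnd
    · intro v
      rw [h3.mem_iff, List.mem_append, List.mem_flatMap, List.mem_flatMap, or_comm]
      simp only [hIm]
    · rw [h3.length_eq, List.length_append, Nat.add_comm]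
      congr 1
      rw [List.length_flatMap, hI, Finset.sum_map_toList]
  choose Q hQ1 hQ2 hQ3 hQ4 hQ5 hQ6 hQ7 using key
  refine ⟨Q, ⟨?_, ?_, ?_⟩, fun b => ⟨hQ3 b, hQ4 b, hQ5 b, hQ6 b, hQ7 b⟩⟩
  · rintro (b | k)
    · exact hQ1 b
    · simp only [Sum.elim_inr]
      split_ifs
      · exact h.chain k
      · exact List.isChain_nil
  · rintro (b | k)
    · exact hQ2 b
    · simp only [Sum.elim_inr]
      split_ifs
      · exact h.nodup k
      · exact List.nodup_nil
  · have hQk : ∀ b v, v ∈ Q b → ∃ k, (k ∈ lab b ∨ asg k = some b) ∧ v ∈ comp k := by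
      intro b v hv
      rcases (hQ6 b v).1 hv with ⟨k, h1, h2⟩ | ⟨k, h1, h2⟩
      · exact ⟨k, Or.inl h1, h2⟩
      · exact ⟨k, Or.inr h1, h2⟩
    have hk' : ∀ k v, v ∈ (if asg k = none ∧ ∀ b, k ∉ lab b then comp k else []) →
        asg k = none ∧ (∀ b, k ∉ lab b) ∧ v ∈ comp k := by
      intro k v hv
      split_ifs at hv with hcond
      · exact ⟨hcond.1, hcond.2, hv⟩
      · simp at hv
    have hcross : ∀ b k v, v ∈ Q b →
        v ∉ (if asg k = none ∧ ∀ b, k ∉ lab b then comp k else []) := by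
      intro b k v hv hv'
      obtain ⟨k₁, h1, h2⟩ := hQk b v hv
      obtain ⟨h3, h4, h5⟩ := hk' k v hv'
      obtain rfl := h.eq_of_mem h2 h5
      rcases h1 with h1 | h1
      · exact h4 b h1
      · simp [h1] at h3
    rintro (b | k) (b' | k') hne v hv hv'
    · obtain ⟨k, h1, h2⟩ := hQk b v hv
      obtain ⟨k', h1', h2'⟩ := hQk b' v hv'
      obtain rfl := h.eq_of_mem h2 h2'
      refine hne ?_
      rw [Sum.inl.injEq]
      rcases h1 with h1 | h1 <;> rcases h1' with h1' | h1'
      · exact hl' k b b' h1 h1'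
      · simp [hla k b h1] at h1'
      · simp [hla k b' h1'] at h1
      · simpa [h1] using h1'
    · exact hcross b k' v hv hv'
    · exact hcross b' k v hv' hv
    · exact hne (by rw [h.eq_of_mem (hk' k v hv).2.2 (hk' k' v hv').2.2])

theorem isChain_glue {r : V → V → Prop} {l₁ G l₂ : List V} {u v : V} (h₁ : l₁.IsChain r)
    (h₂ : l₂.IsChain r) (hu : l₁.getLast? = some u) (hv : l₂.head? = some v)
    (hG : (u :: G ++ [v]).IsChain r) : (l₁ ++ G ++ l₂).IsChain r := by
  obtain ⟨m₁, rfl⟩ : ∃ m, l₁ = m ++ [u] := ⟨_, (List.dropLast_append_getLast? u hu).symm⟩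
  rcases l₂ with _ | ⟨w, m₂⟩
  · simp at hv
  · obtain rfl : w = v := by simpa using hv
    rw [show m₁ ++ [u] ++ G ++ w :: m₂ = m₁ ++ u :: (G ++ w :: m₂) by simp, List.isChain_split]
    refine ⟨h₁, ?_⟩
    rw [← List.cons_append, List.isChain_split]
    exact ⟨hG, h₂⟩

/-- The nine connections of one path: inside a block, between the two blocks of a half, and
from the source to the first half, between the halves, and from the second half to the target. -/
abbrev GapKind := (Bool × Bool) ⊕ (Bool ⊕ Fin 3)

/-- The pieces from which the paths indexed by `I` are assembled. -/
inductive Piece (I D E : Type) : Type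
  | tip (i : I) (b : Bool)
  | abs (b : I × Bool × Bool) (s : Bool)
  | gap (g : I × GapKind)
  | sand (d : D)
  | one (e : E)

namespace Piece

variable {I D E : Type}

def toSum : Piece I D E → (I × Bool) ⊕ ((I × Bool × Bool) × Bool) ⊕ (I × GapKind) ⊕ D ⊕ E
  | tip i b => .inl (i, b)
  | abs b s => .inr (.inl (b, s))
  | gap g => .inr (.inr (.inl g))
  | sand d => .inr (.inr (.inr (.inl d)))
  | one e => .inr (.inr (.inr (.inr e)))

theorem toSum_injective : Function.Injective (toSum : Piece I D E → _) := by
  rintro (_ | _ | _ | _ | _) (_ | _ | _ | _ | _) h <;> simp_all [toSum]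

noncomputable instance [Fintype I] [Fintype D] [Fintype E] : Fintype (Piece I D E) :=
  Fintype.ofInjective toSum toSum_injective

/-- The path to which a piece belongs. -/
def owner (blk : D → I × Bool × Bool) (half : E → I × Bool) : Piece I D E → I
  | tip i _ => i
  | abs b _ => b.1
  | gap g => g.1
  | sand d => (blk d).1
  | one e => (half e).1

def sandBlock (blk : D → I × Bool × Bool) : Piece I D E → Option (I × Bool × Bool)
  | sand d => some (blk d)
  | _ => none

def oneHalf (half : E → I × Bool) : (I × Bool × Bool) ⊕ Piece I D E → Option (I × Bool)
  | .inr (one e) => some (half e)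
  | _ => none

end Piece

open Piece

section Labels

variable {I D E : Type}

@[simp] def blockLabels (b : I × Bool × Bool) : List (Piece I D E) :=
  [abs b false, gap (b.1, .inl b.2), abs b true]

@[simp] def halfLabels (b : I × Bool) : List ((I × Bool × Bool) ⊕ Piece I D E) :=
  [.inl (b.1, b.2, false), .inr (gap (b.1, .inr (.inl b.2))), .inl (b.1, b.2, true)]

@[simp] def pathLabels (i : I) : List ((I × Bool) ⊕ ((I × Bool × Bool) ⊕ Piece I D E)) :=
  [.inr (.inr (tip i false)), .inr (.inr (gap (i, .inr (.inr 0)))), .inl (i, false),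
    .inr (.inr (gap (i, .inr (.inr 1)))), .inl (i, true),
    .inr (.inr (gap (i, .inr (.inr 2)))), .inr (.inr (tip i true))]

theorem blockLabels_disjoint (k : Piece I D E) (b b' : I × Bool × Bool)
    (h : k ∈ blockLabels b) (h' : k ∈ blockLabels b') : b = b' := by
  obtain ⟨i, p⟩ := b
  obtain ⟨i', p'⟩ := b'
  simp only [blockLabels, List.mem_cons, List.not_mem_nil, or_false] at h h'
  rcases h with rfl | rfl | rfl <;> simpa using h'

theorem halfLabels_disjoint (k : (I × Bool × Bool) ⊕ Piece I D E) (b b' : I × Bool)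
    (h : k ∈ halfLabels b) (h' : k ∈ halfLabels b') : b = b' := by
  obtain ⟨i, p⟩ := b
  obtain ⟨i', p'⟩ := b'
  simp only [halfLabels, List.mem_cons, List.not_mem_nil, or_false] at h h'
  rcases h with rfl | rfl | rfl <;> simpa using h'

theorem pathLabels_disjoint (k : (I × Bool) ⊕ ((I × Bool × Bool) ⊕ Piece I D E)) (b b' : I)
    (h : k ∈ pathLabels b) (h' : k ∈ pathLabels b') : b = b' := by
  simp only [pathLabels, List.mem_cons, List.not_mem_nil, or_false] at h h'
  rcases h with rfl | rfl | rfl | rfl | rfl | rfl | rfl <;> simpa using h'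

theorem exists_owner_iff {blk : D → I × Bool × Bool} {half : E → I × Bool}
    {M : Piece I D E → Prop} {i : I} :
    (∃ k, owner blk half k = i ∧ M k) ↔
    (((M (tip i false) ∨ M (gap (i, .inr (.inr 0)))) ∨
          (M (.abs (i, false, false) false) ∨ M (gap (i, .inl (false, false))) ∨
                M (.abs (i, false, false) true) ∨ ∃ d, blk d = (i, false, false) ∧ M (sand d)) ∨
            M (gap (i, .inr (.inl false))) ∨
              (M (.abs (i, false, true) false) ∨ M (gap (i, .inl (false, true))) ∨
                M (.abs (i, false, true) true) ∨ ∃ d, blk d = (i, false, true) ∧ M (sand d)) ∨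
                ∃ e, half e = (i, false) ∧ M (one e)) ∨
        M (gap (i, .inr (.inr 1)))) ∨
      (((M (.abs (i, true, false) false) ∨ M (gap (i, .inl (true, false))) ∨
                M (.abs (i, true, false) true) ∨ ∃ d, blk d = (i, true, false) ∧ M (sand d)) ∨
            M (gap (i, .inr (.inl true))) ∨
              (M (.abs (i, true, true) false) ∨ M (gap (i, .inl (true, true))) ∨
                M (.abs (i, true, true) true) ∨ ∃ d, blk d = (i, true, true) ∧ M (sand d)) ∨
                ∃ e, half e = (i, true) ∧ M (one e)) ∨
          M (gap (i, .inr (.inr 2)))) ∨ M (tip i true) := by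
  constructor
  · rintro ⟨k, rfl, h⟩
    rcases k with ⟨i, (_ | _)⟩ | ⟨⟨i, (_ | _), (_ | _)⟩, (_ | _)⟩ |
      ⟨i, (⟨(_ | _), (_ | _)⟩ | ((_ | _) | m))⟩ | d | e
    case sand =>
      rcases hd : blk d with ⟨i, (_ | _), (_ | _)⟩ <;> simp only [owner, hd] <;> grind
    case one =>
      rcases he : half e with ⟨i, (_ | _)⟩ <;> simp only [owner, he] <;> grind
    case mp.gap.inr.inr =>
      simp only [owner]
      match m, h with
      | 0, h => simp [h]
      | 1, h => simp [h]
      | 2, h => simp [h]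
    all_goals simp only [owner, h, true_or, or_true]
  · intro h
    rcases h with (((h | h) | ((h | h | h | ⟨d, hd, h⟩) | h | (h | h | h | ⟨d, hd, h⟩) |
      ⟨d, hd, h⟩)) | h) | ((((h | h | h | ⟨d, hd, h⟩) | h | (h | h | h | ⟨d, hd, h⟩) |
      ⟨d, hd, h⟩) | h) | h)
    all_goals first
      | exact ⟨_, rfl, h⟩
      | exact ⟨sand d, congrArg Prod.fst hd, h⟩
      | exact ⟨one d, congrArg Prod.fst hd, h⟩

end Labels

open scoped Classical in
/-- Assemble a system of disjoint paths from its pieces. -/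
theorem exists_skeleton {I D E : Type} [Fintype I] [Fintype D] [Fintype E] {r : V → V → Prop}
    (hr : ∀ u v, u ≠ v → r u v ∨ r v u) {comp : Piece I D E → List V} (hF : Fam r comp)
    {blk : D → I × Bool × Bool} {half : E → I × Bool} {x y : I → V}
    {aH aL bH bL : I × Bool × Bool → V}
    (hx : ∀ i, comp (tip i false) = [x i]) (hy : ∀ i, comp (tip i true) = [y i])
    (haH : ∀ b, (comp (abs b false)).head? = some (aH b))
    (haL : ∀ b, (comp (abs b false)).getLast? = some (aL b))
    (hbH : ∀ b, (comp (abs b true)).head? = some (bH b))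
    (hbL : ∀ b, (comp (abs b true)).getLast? = some (bL b))
    (hinner : ∀ i h p, (aL (i, h, p) :: comp (gap (i, .inl (h, p))) ++ [bH (i, h, p)]).IsChain r)
    (hmid : ∀ i h, (bL (i, h, false) :: comp (gap (i, .inr (.inl h))) ++
      [aH (i, h, true)]).IsChain r)
    (hfirst : ∀ i, (x i :: comp (gap (i, .inr (.inr 0))) ++ [aH (i, false, false)]).IsChain r)
    (hcross : ∀ i, (bL (i, false, true) :: comp (gap (i, .inr (.inr 1))) ++
      [aH (i, true, false)]).IsChain r)
    (hlast : ∀ i, (bL (i, true, true) :: comp (gap (i, .inr (.inr 2))) ++ [y i]).IsChain r)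
    (hsand : ∀ d, (∃ p ∈ comp (abs (blk d) false), ∀ v ∈ (comp (sand d)).head?, r p v) ∧
      ∃ q ∈ comp (abs (blk d) true), ∀ v ∈ (comp (sand d)).getLast?, r v q)
    (hone : ∀ e, ∃ d d' p q w, comp (one e) = [w] ∧ blk d = ((half e).1, (half e).2, false) ∧
      blk d' = ((half e).1, (half e).2, true) ∧ p ∈ comp (sand d) ∧ q ∈ comp (sand d') ∧
      r p w ∧ r w q) :
    ∃ P : I → List V, Fam r P ∧ (∀ i, (P i).head? = some (x i)) ∧
      (∀ i, (P i).getLast? = some (y i)) ∧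
      (∀ i v, v ∈ P i ↔ ∃ k, owner blk half k = i ∧ v ∈ comp k) ∧
      ∀ i a b, (a ∈ comp (abs (i, false, false) false) ∨
          ∃ e, half e = (i, false) ∧ a ∈ comp (one e)) →
        (b ∈ comp (abs (i, true, true) true) ∨ ∃ e, half e = (i, true) ∧ b ∈ comp (one e)) →
        [a, b].Sublist (P i) := by
  have pair : ∀ {l₁ l₂ G : List V} {a b : V}, a ∈ l₁ → b ∈ l₂ →
      [a, b].Sublist (l₁ ++ G ++ l₂) := by
    intro l₁ l₂ G a b ha hb
    rw [show [a, b] = [a] ++ [] ++ [b] from rfl]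
    exact ((List.singleton_sublist.2 ha).append (List.nil_sublist _)).append
      (List.singleton_sublist.2 hb)
  obtain ⟨Q₁, hQ₁, hQ₁'⟩ := hF.merge hr
    blockLabels (sandBlock blk) (by simp [blockLabels]) blockLabels_disjoint
    (by rintro k b; simp only [blockLabels, List.mem_cons, List.not_mem_nil]; rintro (rfl | rfl | rfl | h)
        <;> first | rfl | exact h.elim)
    (by
      rintro ⟨i, h, p⟩
      have := isChain_glue (hF.chain (abs (i, h, p) false)) (hF.chain (abs (i, h, p) true))
        (haL _) (hbH _) (hinner i h p)
      simpa using this)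
    (by
      intro k b hk
      rcases k with _ | _ | _ | d | _ <;> simp only [sandBlock, reduceCtorEq, Option.some.injEq] at hk
      subst hk
      obtain ⟨⟨p, hp, hp'⟩, q, hq, hq'⟩ := hsand d
      refine Or.inr ⟨p, q, ?_, hp', hq'⟩
      simpa using pair (G := comp (gap ((blk d).1, .inl (blk d).2))) hp hq)
  have h1H : ∀ b, (Q₁ b).head? = some (aH b) := fun b => by
    rw [(hQ₁' b).2.1]; simp [haH]
  have h1L : ∀ b, (Q₁ b).getLast? = some (bL b) := fun b => by
    rw [(hQ₁' b).2.2.1]; simp [hbL]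
  have h1m : ∀ b v, v ∈ Q₁ b ↔ v ∈ comp (abs b false) ∨ v ∈ comp (gap (b.1, .inl b.2)) ∨
      v ∈ comp (abs b true) ∨ ∃ d, blk d = b ∧ v ∈ comp (sand d) := by
    intro b v
    rw [(hQ₁' b).2.2.2.1]
    constructor
    · rintro (⟨k, hk, hv⟩ | ⟨k, hk, hv⟩)
      · simp only [blockLabels, List.mem_cons, List.not_mem_nil, or_false] at hk
        rcases hk with rfl | rfl | rfl <;> tauto
      · rcases k with _ | _ | _ | d | _ <;>
          simp only [sandBlock, reduceCtorEq, Option.some.injEq] at hk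
        exact Or.inr (Or.inr (Or.inr ⟨d, hk, hv⟩))
    · rintro (hv | hv | hv | ⟨d, hd, hv⟩)
      · exact Or.inl ⟨_, by simp, hv⟩
      · exact Or.inl ⟨gap (b.1, .inl b.2), by simp, hv⟩
      · exact Or.inl ⟨abs b true, by simp, hv⟩
      · exact Or.inr ⟨sand d, by simp [sandBlock, hd], hv⟩
  set c₁ : (I × Bool × Bool) ⊕ Piece I D E → List V := _ with hc₁
  change Fam r c₁ at hQ₁
  have e1 : ∀ b, c₁ (.inl b) = Q₁ b := fun b => rfl
  have e2 : ∀ i h, c₁ (.inr (gap (i, .inr h))) = comp (gap (i, .inr h)) := by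
    intro i h
    simp [hc₁, sandBlock]
  have e3 : ∀ e, c₁ (.inr (one e)) = comp (one e) := by
    intro e
    simp [hc₁, sandBlock]
  have e4 : ∀ i b, c₁ (.inr (tip i b)) = comp (tip i b) := by
    intro i b
    simp [hc₁, sandBlock]
  obtain ⟨Q₂, hQ₂, hQ₂'⟩ := hQ₁.merge hr
    halfLabels (oneHalf half) (by simp [halfLabels]) halfLabels_disjoint
    (by rintro k b; simp only [halfLabels, List.mem_cons, List.not_mem_nil]; rintro (rfl | rfl | rfl | h)
        <;> first | rfl | exact h.elim)
    (by
      rintro ⟨i, h⟩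
      have := isChain_glue (hQ₁.chain (.inl (i, h, false))) (hQ₁.chain (.inl (i, h, true)))
        (h1L _) (h1H _) (hmid i h)
      rw [← e2] at this
      simpa using this)
    (by
      intro k b hk
      rcases k with _ | (_ | _ | _ | _ | e) <;>
        simp only [oneHalf, reduceCtorEq, Option.some.injEq] at hk
      subst hk
      obtain ⟨d, d', p, q, w, hw, hd, hd', hp, hq, hpw, hwq⟩ := hone e
      refine Or.inr ⟨p, q, ?_, ?_, ?_⟩
      · have hp' : p ∈ c₁ (.inl ((half e).1, (half e).2, false)) :=
          (h1m _ _).2 (Or.inr (Or.inr (Or.inr ⟨d, hd, hp⟩)))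
        have hq' : q ∈ c₁ (.inl ((half e).1, (half e).2, true)) :=
          (h1m _ _).2 (Or.inr (Or.inr (Or.inr ⟨d', hd', hq⟩)))
        simpa using pair (G := c₁ (.inr (gap ((half e).1, .inr (.inl (half e).2))))) hp' hq'
      · rw [e3, hw]; simpa using hpw
      · rw [e3, hw]; simpa using hwq)
  have h2H : ∀ b, (Q₂ b).head? = some (aH (b.1, b.2, false)) := fun b => by
    rw [(hQ₂' b).2.1]; simp [h1H, e1]
  have h2L : ∀ b, (Q₂ b).getLast? = some (bL (b.1, b.2, true)) := fun b => by
    rw [(hQ₂' b).2.2.1]; simp [h1L, e1]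
  have h2m : ∀ b v, v ∈ Q₂ b ↔ v ∈ Q₁ (b.1, b.2, false) ∨
      v ∈ comp (gap (b.1, .inr (.inl b.2))) ∨
      v ∈ Q₁ (b.1, b.2, true) ∨ ∃ e, half e = b ∧ v ∈ comp (one e) := by
    intro b v
    rw [(hQ₂' b).2.2.2.1]
    constructor
    · rintro (⟨k, hk, hv⟩ | ⟨k, hk, hv⟩)
      · simp only [halfLabels, List.mem_cons, List.not_mem_nil, or_false] at hk
        rcases hk with rfl | rfl | rfl
        · exact Or.inl hv
        · rw [e2] at hv; tauto
        · exact Or.inr (Or.inr (Or.inl hv))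
      · rcases k with _ | (_ | _ | _ | _ | e) <;>
          simp only [oneHalf, reduceCtorEq, Option.some.injEq] at hk
        rw [e3] at hv
        exact Or.inr (Or.inr (Or.inr ⟨e, hk, hv⟩))
    · rintro (hv | hv | hv | ⟨e, he, hv⟩)
      · exact Or.inl ⟨.inl (b.1, b.2, false), by simp, hv⟩
      · exact Or.inl ⟨.inr (gap (b.1, .inr (.inl b.2))), by simp, by rwa [e2]⟩
      · exact Or.inl ⟨.inl (b.1, b.2, true), by simp, hv⟩
      · exact Or.inr ⟨.inr (one e), by simp [oneHalf, he], by rwa [e3]⟩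
  set c₂ : (I × Bool) ⊕ ((I × Bool × Bool) ⊕ Piece I D E) → List V := _ with hc₂
  change Fam r c₂ at hQ₂
  have f1 : ∀ b, c₂ (.inl b) = Q₂ b := fun b => rfl
  have f2 : ∀ i m, c₂ (.inr (.inr (gap (i, .inr (.inr m))))) = comp (gap (i, .inr (.inr m))) := by
    intro i m
    rw [← e2]
    simp [hc₂, oneHalf]
  have f4 : ∀ i b, c₂ (.inr (.inr (tip i b))) = comp (tip i b) := by
    intro i b
    rw [← e4]
    simp [hc₂, oneHalf]
  have hflat : ∀ i, (pathLabels i).flatMap c₂ = ([x i] ++ comp (gap (i, .inr (.inr 0))) ++ Q₂ (i, false)) ++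
      comp (gap (i, .inr (.inr 1))) ++
      (Q₂ (i, true) ++ comp (gap (i, .inr (.inr 2))) ++ [y i]) := by
    intro i
    simp [pathLabels, f1, f2, f4, hx, hy]
  obtain ⟨P, hP, hP'⟩ := hQ₂.merge hr pathLabels (fun _ => none) (by simp [pathLabels])
    pathLabels_disjoint (by simp)
    (by
      intro i
      rw [hflat]
      refine isChain_glue (u := bL (i, false, true)) (v := aH (i, true, false)) ?_ ?_ ?_ ?_
        (hcross i)
      · exact isChain_glue (List.isChain_singleton _) (hQ₂.chain (.inl (i, false))) rfl (h2H _)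
          (hfirst i)
      · exact isChain_glue (hQ₂.chain (.inl (i, true))) (List.isChain_singleton _) (h2L _) rfl
          (hlast i)
      · rw [List.getLast?_append]
        simp [h2L]
      · rw [List.append_assoc, List.head?_append]
        simp [h2H])
    (by simp)
  refine ⟨P, ⟨fun i => hP.chain (.inl i), fun i => hP.nodup (.inl i), fun i j hij =>
    hP.disj (.inl i) (.inl j) (by simpa using hij)⟩, ?_, ?_, ?_, ?_⟩
  · intro i
    rw [(hP' i).2.1, hflat]
    simp
  · intro i
    rw [(hP' i).2.2.1, hflat, ← List.append_assoc, List.getLast?_append]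
    simp
  · intro i v
    have : v ∈ P i ↔ v ∈ (pathLabels i).flatMap c₂ := by
      rw [(hP' i).2.2.2.1, List.mem_flatMap]
      simp
    rw [this, hflat, exists_owner_iff]
    simp only [List.mem_append, h2m, h1m, hx, hy]
  · intro i a b ha hb
    refine List.Sublist.trans ?_ (hP' i).1
    rw [hflat]
    have ha' : a ∈ Q₂ (i, false) := by
      rw [h2m, h1m, h1m]
      tauto
    have hb' : b ∈ Q₂ (i, true) := by
      rw [h2m, h1m, h1m]
      tauto
    exact pair (List.mem_append_right _ ha') (List.mem_append_left _ (List.mem_append_left _ hb'))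

/-- The relation `r`, reversed when `s` is true. -/
def orient (r : V → V → Prop) (s : Bool) : V → V → Prop := if s then flip r else r

theorem le_card_out [Fintype V] {r : V → V → Prop} {k : ℕ} (hk : k + 1 ≤ Fintype.card V)
    (hconn : ∀ T : Finset V, T.card < k → ∀ u v, u ∉ T → v ∉ T → u ≠ v →
      ∃ l : List V, l.Nodup ∧ l.IsChain r ∧ l.head? = some u ∧ l.getLast? = some v ∧
        ∀ w ∈ l, w ∉ T) (v : V) [DecidablePred (r v)] :
    k ≤ (Finset.univ.filter fun u => r v u).card := by
  classical
  by_contra! hlt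
  set T := (Finset.univ.filter fun u => r v u).erase v with hT
  have hTk : T.card < k := (Finset.card_le_card (Finset.erase_subset _ _)).trans_lt hlt
  obtain ⟨u, hu⟩ : ∃ u, u ∉ insert v T := by
    by_contra! hall
    have h1 : (Finset.univ : Finset V) ⊆ insert v T := fun u _ => hall u
    have h2 := Finset.card_le_card h1
    have h3 := Finset.card_insert_le v T
    rw [Finset.card_univ] at h2
    omega
  rw [Finset.mem_insert, not_or] at hu
  obtain ⟨l, h1, h2, h3, h4, h5⟩ := hconn T hTk v u (by simp [hT]) hu.2 (Ne.symm hu.1)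
  rcases l with _ | ⟨a, _ | ⟨b, l⟩⟩
  · simp at h3
  · simp only [List.head?_cons, Option.some.injEq] at h3
    simp only [List.getLast?_singleton, Option.some.injEq] at h4
    exact hu.1 (by rw [← h3, ← h4])
  · obtain rfl : a = v := by simpa using h3
    have hb : b ≠ a := by
      rintro rfl
      simp at h1
    refine h5 b (by simp) ?_
    simp only [hT, Finset.mem_erase, Finset.mem_filter, Finset.mem_univ, true_and]
    exact ⟨hb, (List.isChain_cons_cons.1 h2).1⟩

theorem exists_reverse_path {r : V → V → Prop} {k : ℕ}
    (hconn : ∀ T : Finset V, T.card < k → ∀ u v, u ∉ T → v ∉ T → u ≠ v →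
      ∃ l : List V, l.Nodup ∧ l.IsChain r ∧ l.head? = some u ∧ l.getLast? = some v ∧
        ∀ w ∈ l, w ∉ T) :
    ∀ T : Finset V, T.card < k → ∀ u v, u ∉ T → v ∉ T → u ≠ v →
      ∃ l : List V, l.Nodup ∧ l.IsChain (flip r) ∧ l.head? = some u ∧ l.getLast? = some v ∧
        ∀ w ∈ l, w ∉ T := by
  intro T hT u v hu hv huv
  obtain ⟨l, h1, h2, h3, h4, h5⟩ := hconn T hT v u hv hu huv.symm
  refine ⟨l.reverse, List.nodup_reverse.2 h1, ?_, by simpa using h4, by simpa using h3,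
    by simpa using h5⟩
  rw [List.isChain_reverse]
  exact h2

open scoped Classical in
theorem le_card_orient [Fintype V] {r : V → V → Prop} {k : ℕ} (hk : k + 1 ≤ Fintype.card V)
    (hconn : ∀ T : Finset V, T.card < k → ∀ u v, u ∉ T → v ∉ T → u ≠ v →
      ∃ l : List V, l.Nodup ∧ l.IsChain r ∧ l.head? = some u ∧ l.getLast? = some v ∧
        ∀ w ∈ l, w ∉ T) (s : Bool) (v : V) :
    k ≤ (Finset.univ.filter fun u => orient r s v u).card := by
  cases s
  · exact le_card_out hk hconn v
  · exact le_card_out hk (exists_reverse_path hconn) v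

open scoped Classical in
/-- Double counting: few elements lie in many of the small sets `{u ∈ U | p j u}`. -/
theorem card_frequent_le {α J : Type} [Fintype α] [Fintype J] {p : J → α → Prop} {U : Finset α}
    {K c d : ℕ} (hK : ∀ j, K * (U.filter fun u => p j u).card ≤ d) (hJ : 0 < Fintype.card J) :
    K * (U.filter fun u =>
      Fintype.card J ≤ c * (Finset.univ.filter fun j => p j u).card).card ≤ c * d := by
  set W := U.filter fun u => Fintype.card J ≤ c * (Finset.univ.filter fun j => p j u).card with hW
  have h1 : W.card * Fintype.card J ≤ ∑ u ∈ W, c * (Finset.univ.filter fun j => p j u).card := by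
    rw [← smul_eq_mul, ← Finset.sum_const]
    exact Finset.sum_le_sum fun u hu => (Finset.mem_filter.1 hu).2
  have h2 : ∑ u ∈ W, (Finset.univ.filter fun j => p j u).card =
      ∑ j, (W.filter fun u => p j u).card := by
    have := Finset.sum_card_bipartiteAbove_eq_sum_card_bipartiteBelow (s := W)
      (t := (Finset.univ : Finset J)) (fun u j => p j u)
    simpa only [Finset.bipartiteAbove, Finset.bipartiteBelow] using this
  have h3 : ∑ j, K * (W.filter fun u => p j u).card ≤ Fintype.card J * d := by
    rw [← Finset.card_univ, ← smul_eq_mul, ← Finset.sum_const]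
    refine Finset.sum_le_sum fun j _ => le_trans (Nat.mul_le_mul_left _ (Finset.card_le_card ?_)) (hK j)
    exact Finset.filter_subset_filter _ (Finset.filter_subset _ _)
  rw [← Finset.mul_sum, ← h2] at h3
  rw [← Finset.mul_sum] at h1
  have h4 : Fintype.card J * (K * W.card) ≤ Fintype.card J * (c * d) := by
    calc Fintype.card J * (K * W.card) = K * (W.card * Fintype.card J) := by ring
      _ ≤ K * (c * ∑ u ∈ W, (Finset.univ.filter fun j => p j u).card) := Nat.mul_le_mul_left _ h1
      _ = c * (K * ∑ u ∈ W, (Finset.univ.filter fun j => p j u).card) := by ring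
      _ ≤ c * (Fintype.card J * d) := Nat.mul_le_mul_left _ h3
      _ = _ := by ring
  exact Nat.le_of_mul_le_mul_left h4 hJ

theorem exists_injective_avoiding {Y : Type} [Fintype Y] [DecidableEq V] (N U : Y → Finset V)
    (Z : Finset V) (hU : ∀ k, 2 * (U k).card ≤ (N k).card)
    (hN : ∀ k, 2 * (Fintype.card Y + Z.card) ≤ (N k).card) :
    ∃ f : Y → V, Function.Injective f ∧ ∀ k, f k ∈ N k ∧ f k ∉ U k ∧ f k ∉ Z := by
  obtain ⟨f, hf, hf'⟩ := exists_injective_choice (fun k => (N k \ U k) \ Z) (by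
    intro k
    have h1 := Finset.le_card_sdiff (U k) (N k)
    have h2 := Finset.le_card_sdiff Z (N k \ U k)
    have := hU k
    have := hN k
    omega)
  refine ⟨f, hf, fun k => ?_⟩
  have := hf' k
  simp only [Finset.mem_sdiff] at this
  exact ⟨this.1.1, this.1.2, this.2⟩

open scoped Classical in
/-- Disjoint short paths, dominating almost everything for one of the two orientations. -/
theorem exists_oriented_family [Fintype V] {κ : Type} [Fintype κ] {r : V → V → Prop}
    (hr : ∀ u v, u ≠ v → r u v ∨ r v u) (X : Finset V) (c : ℕ)
    (hX : X.card + 2 * Fintype.card κ * (c + 1) < Fintype.card V) :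
    ∃ A : κ → Bool → List V, (∀ k s, A k s ≠ []) ∧ (∀ k s, (A k s).length ≤ c + 1) ∧
      (∀ k s, (A k s).Nodup) ∧ (∀ k s, (A k s).IsChain r) ∧ (∀ k s, ∀ a ∈ A k s, a ∉ X) ∧
      (∀ k s k' s', ∀ a ∈ A k s, a ∈ A k' s' → k = k' ∧ s = s') ∧
      ∀ R : Finset V, X ⊆ R → (∀ k s, ∀ a ∈ A k s, a ∈ R) → ∀ k s v, v ∉ R →
        2 ^ c * (Finset.univ.filter fun u => u ∉ R ∧ Undom (orient r s) (A k s) u).card ≤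
          (Finset.univ.filter fun u => orient r s u v).card := by
  obtain ⟨L, h0, hl, hn, hc, hx, hd, hb⟩ := exists_dominating_family
    (fun k : κ × Bool => orient r k.2)
    (by rintro ⟨k, _ | _⟩ u v huv; exacts [hr u v huv, (hr u v huv).symm]) X c
    (by rw [Fintype.card_prod, Fintype.card_bool, Nat.mul_comm (Fintype.card κ)]; exact hX)
  have hm : ∀ k s a, a ∈ (if s then (L (k, s)).reverse else L (k, s)) ↔ a ∈ L (k, s) := by
    rintro k (_ | _) a <;> simp
  refine ⟨fun k s => if s then (L (k, s)).reverse else L (k, s), ?_, ?_, ?_, ?_, ?_, ?_, ?_⟩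
  · rintro k (_ | _) <;> simp [h0]
  · rintro k (_ | _) <;> simp [hl]
  · rintro k (_ | _) <;> simp [hn]
  · rintro k (_ | _)
    · exact hc (k, false)
    · simp only [if_true]
      rw [List.isChain_reverse]
      exact hc (k, true)
  · intro k s a ha
    exact hx (k, s) a ((hm k s a).1 ha)
  · intro k s k' s' a ha ha'
    by_contra hne
    exact hd (k, s) (k', s') (by simpa [Prod.ext_iff] using hne) a ((hm k s a).1 ha)
      ((hm k' s' a).1 ha')
  · intro R hXR hR k s v hv
    have := hb R hXR (fun k a ha => hR k.1 k.2 a ((hm _ _ a).2 ha)) (k, s) v hv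
    refine le_trans (Nat.mul_le_mul_left _ (Finset.card_le_card ?_)) this
    intro u hu
    simp only [Finset.mem_filter, Finset.mem_univ, true_and] at hu ⊢
    exact ⟨hu.1, fun a ha => hu.2 a ((hm k s a).2 ha)⟩

/-- Indices for the short dominating paths: `linkers` indexed by `I × M`, and four pairs of
absorbers for each element of `I`. -/
abbrev Slot (I M : Type) := (I × M) ⊕ (I × Bool × Bool)

theorem orient_not {r : V → V → Prop} (s : Bool) (u v : V) :
    orient r (!s) u v ↔ orient r s v u := by
  cases s <;> rfl

open scoped Classical in
/-- A system of short disjoint dominating paths which avoids the prescribed end vertices. -/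
structure Toolkit {I M : Type} [Fintype V] (r : V → V → Prop) (x : I → Bool → V)
    (D : Slot I M → Bool → List V) (R : Finset V) : Prop where
  ne : ∀ k s, D k s ≠ []
  length_le : ∀ k s, (D k s).length ≤ 31
  nodup : ∀ k s, (D k s).Nodup
  chain : ∀ k s, (D k s).IsChain r
  avoid : ∀ k s i b, x i b ∉ D k s
  disj : ∀ k s k' s', ∀ a ∈ D k s, a ∈ D k' s' → k = k' ∧ s = s'
  ends : ∀ i b, x i b ∈ R
  mem : ∀ k s, ∀ a ∈ D k s, a ∈ R
  cover : ∀ v ∈ R, (∃ i b, v = x i b) ∨ ∃ k s, v ∈ D k s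
  dom : ∀ R', R ⊆ R' → ∀ k s v, v ∉ R' →
    2 ^ 30 * (Finset.univ.filter fun u => u ∉ R' ∧ Undom (orient r s) (D k s) u).card ≤
      (Finset.univ.filter fun u => orient r s u v).card

theorem exists_toolkit {I M : Type} [Fintype V] [Fintype I] [Fintype M] {r : V → V → Prop}
    (hr : ∀ u v, u ≠ v → r u v ∨ r v u) (x : I → Bool → V)
    (hV : Fintype.card I * (62 * Fintype.card M + 250) < Fintype.card V) :
    ∃ (D : Slot I M → Bool → List V) (R : Finset V), Toolkit r x D R ∧
      R.card ≤ Fintype.card I * (62 * Fintype.card M + 250) := by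
  classical
  set X : Finset V := Finset.univ.image (fun p : I × Bool => x p.1 p.2) with hX
  have hXc : X.card ≤ 2 * Fintype.card I := by
    refine Finset.card_image_le.trans ?_
    simp [Nat.mul_comm]
  have hκ : Fintype.card (Slot I M) = Fintype.card I * (Fintype.card M + 4) := by
    simp only [Fintype.card_sum, Fintype.card_prod, Fintype.card_bool]
    ring
  have hnum : 2 * Fintype.card I + 2 * Fintype.card (Slot I M) * 31 =
      Fintype.card I * (62 * Fintype.card M + 250) := by
    rw [hκ]; ring
  obtain ⟨D, h1, h2, h3, h4, h5, h6, h7⟩ := exists_oriented_family (κ := Slot I M) hr X 30 (by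
    show X.card + 2 * Fintype.card (Slot I M) * 31 < _
    omega)
  set R : Finset V := X ∪ Finset.univ.biUnion fun p : Slot I M × Bool => (D p.1 p.2).toFinset
  have hmem : ∀ k s, ∀ a ∈ D k s, a ∈ R := by
    intro k s a ha
    refine Finset.mem_union_right _ (Finset.mem_biUnion.2 ⟨(k, s), Finset.mem_univ _, ?_⟩)
    simpa using ha
  have hxX : ∀ i b, x i b ∈ X := fun i b => Finset.mem_image.2 ⟨(i, b), Finset.mem_univ _, rfl⟩
  refine ⟨D, R, ⟨h1, h2, h3, h4, fun k s i b h => h5 k s _ h (hxX i b), h6,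
    fun i b => Finset.mem_union_left _ (hxX i b), hmem, ?_, ?_⟩, ?_⟩
  · intro v hv
    rcases Finset.mem_union.1 hv with hv | hv
    · obtain ⟨p, _, rfl⟩ := Finset.mem_image.1 hv
      exact .inl ⟨_, _, rfl⟩
    · obtain ⟨p, _, hv⟩ := Finset.mem_biUnion.1 hv
      exact .inr ⟨_, _, List.mem_toFinset.1 hv⟩
  · intro R' hR'
    exact h7 R' (Finset.subset_union_left.trans hR') fun k s a ha => hR' (hmem k s a ha)
  · have hb : (Finset.univ.biUnion fun p : Slot I M × Bool => (D p.1 p.2).toFinset).card ≤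
        2 * Fintype.card (Slot I M) * 31 := by
      refine (Finset.card_biUnion_le_card_mul _ _ 31 fun p _ =>
        (List.toFinset_card_le _).trans (h2 _ _)).trans ?_
      rw [Finset.card_univ, Fintype.card_prod, Fintype.card_bool, Nat.mul_comm 2]
    refine (Finset.card_union_le _ _).trans ?_
    omega

/-- The vertices of the linkers. -/
abbrev Core {I M : Type} (D : Slot I M → Bool → List V) : Type :=
  {v : V // ∃ j s, v ∈ D (.inl j) s}

theorem Toolkit.card_core_le {I M : Type} [Fintype V] {r : V → V → Prop} {x : I → Bool → V}
    {D : Slot I M → Bool → List V} {R : Finset V} (h : Toolkit r x D R) [Fintype (Core D)] :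
    Fintype.card (Core D) ≤ R.card := by
  rw [← Fintype.card_coe R]
  exact Fintype.card_le_of_injective (fun v : Core D => ⟨v.1, by
    obtain ⟨j, s, hv⟩ := v.2
    exact h.mem _ _ _ hv⟩) fun v w hvw => Subtype.ext (by simpa using hvw)

theorem Toolkit.exists_site {I M : Type} [Fintype V] {r : V → V → Prop} {x : I → Bool → V}
    {D : Slot I M → Bool → List V} {R : Finset V} (h : Toolkit r x D R) :
    ∃ site : Core D → I × Bool, ∀ (v : Core D) j s, v.1 ∈ D (.inl j) s → site v = (j.1, s) := by
  choose j s hv using fun v : Core D => v.2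
  refine ⟨fun v => ((j v).1, s v), fun v j' s' hv' => ?_⟩
  obtain ⟨h1, h2⟩ := h.disj _ _ _ _ _ (hv v) hv'
  simp only [Sum.inl.injEq] at h1
  simp only [h1, h2]

open scoped Classical in
theorem exists_two_levels [Fintype V] {Z Y : Type} [Fintype Z] [Fintype Y] {r : V → V → Prop}
    {k : ℕ} (hdeg : ∀ s v, k ≤ (Finset.univ.filter fun u => orient r s v u).card)
    (R : Finset V) (hk : 2 * (Fintype.card Z + Fintype.card Y + R.card) ≤ k)
    (anchor : Z → V) (zs : Z → Bool) (par : Y → Z) (ys : Y → Bool) (bad : Y → Finset V)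
    (hbad : ∀ y v, v ∉ R →
      2 * (bad y).card ≤ (Finset.univ.filter fun u => orient r (ys y) v u).card) :
    ∃ (z : Z → V) (w : Y → V), Function.Injective z ∧ Function.Injective w ∧
      (∀ a, z a ∉ R) ∧ (∀ b, w b ∉ R) ∧ (∀ a b, z a ≠ w b) ∧
      (∀ a, orient r (zs a) (anchor a) (z a)) ∧
      (∀ b, orient r (ys b) (z (par b)) (w b)) ∧ ∀ b, w b ∉ bad b := by
  obtain ⟨z, hz, hz'⟩ := exists_injective_avoiding
    (fun a : Z => Finset.univ.filter fun u => orient r (zs a) (anchor a) u) (fun _ => ∅) R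
    (by simp) (fun a => by have := hdeg (zs a) (anchor a); omega)
  have hc : (R ∪ Finset.univ.image z).card ≤ R.card + Fintype.card Z :=
    (Finset.card_union_le _ _).trans (Nat.add_le_add_left Finset.card_image_le _)
  obtain ⟨w, hw, hw'⟩ := exists_injective_avoiding
    (fun b : Y => Finset.univ.filter fun u => orient r (ys b) (z (par b)) u) bad
    (R ∪ Finset.univ.image z) (fun b => hbad b _ (hz' _).2.2)
    (fun b => by have := hdeg (ys b) (z (par b)); omega)
  refine ⟨z, w, hz, hw, fun a => (hz' a).2.2, ?_, ?_, ?_, ?_, fun b => (hw' b).2.1⟩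
  · intro b hb
    exact (hw' b).2.2 (Finset.mem_union_left _ hb)
  · intro a b hab
    exact (hw' b).2.2 (Finset.mem_union_right _ (Finset.mem_image.2 ⟨a, Finset.mem_univ _, hab⟩))
  · intro a
    simpa using (hz' a).1
  · intro b
    simpa using (hw' b).1

section Pieces

variable {I M : Type} {D : Slot I M → Bool → List V}

/-- Indices of the vertices next to the end vertices of the connections and next to the
linker vertices. -/
abbrev Near (D : Slot I M → Bool → List V) : Type := ((I × GapKind) × Bool) ⊕ (Core D × Bool)

/-- Indices of the vertices at distance two from the end vertices of the connections and from
the linker vertices. -/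
abbrev Far (D : Slot I M → Bool → List V) : Type :=
  ((I × GapKind) × Bool) ⊕ ((Core D × Bool) × Bool)

/-- The linker vertices which are not used by the connections. -/
abbrev Free (D : Slot I M → Bool → List V) (mid : I × GapKind → List V) : Type :=
  {v : Core D // ∀ g, v.1 ∉ mid g}

def pieces (x : I → Bool → V) (z : Near D → V) (w : Far D → V) (mid : I × GapKind → List V) :
    Piece I (Core D × Bool) (Free D mid) → List V
  | .tip i b => [x i b]
  | .abs b s => D (.inr b) s
  | .gap g => z (.inl (g, false)) :: w (.inl (g, false)) ::
      (mid g ++ [w (.inl (g, true)), z (.inl (g, true))])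
  | .sand d => [w (.inr (d, false)), z (.inr d), w (.inr (d, true))]
  | .one e => [e.1.1]

/-- Every vertex of a piece belongs to exactly one part, determined by this predicate. -/
def InPart (x : I → Bool → V) (z : Near D → V) (w : Far D → V) (mid : I × GapKind → List V) :
    (I × Bool) ⊕ ((I × Bool × Bool) × Bool) ⊕ Near D ⊕ Far D ⊕ Free D mid ⊕ (I × GapKind) →
      V → Prop
  | .inl p, v => v = x p.1 p.2
  | .inr (.inl p), v => v ∈ D (.inr p.1) p.2
  | .inr (.inr (.inl a)), v => v = z a
  | .inr (.inr (.inr (.inl b))), v => v = w b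
  | .inr (.inr (.inr (.inr (.inl e)))), v => v = e.1.1
  | .inr (.inr (.inr (.inr (.inr g)))), v => v ∈ mid g

def partOwner (mid : I × GapKind → List V) :
    (I × Bool) ⊕ ((I × Bool × Bool) × Bool) ⊕ Near D ⊕ Far D ⊕ Free D mid ⊕ (I × GapKind) →
      Piece I (Core D × Bool) (Free D mid)
  | .inl p => .tip p.1 p.2
  | .inr (.inl p) => .abs p.1 p.2
  | .inr (.inr (.inl (.inl g))) => .gap g.1
  | .inr (.inr (.inl (.inr d))) => .sand d
  | .inr (.inr (.inr (.inl (.inl g)))) => .gap g.1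
  | .inr (.inr (.inr (.inl (.inr d)))) => .sand d.1
  | .inr (.inr (.inr (.inr (.inl e)))) => .one e
  | .inr (.inr (.inr (.inr (.inr g)))) => .gap g

theorem exists_part {x : I → Bool → V} {z : Near D → V} {w : Far D → V}
    {mid : I × GapKind → List V} {k : Piece I (Core D × Bool) (Free D mid)} {v : V}
    (hv : v ∈ pieces x z w mid k) : ∃ τ, InPart x z w mid τ v ∧ partOwner mid τ = k := by
  rcases k with ⟨i, b⟩ | ⟨b, s⟩ | g | d | e
  · exact ⟨.inl (i, b), by simpa [pieces, InPart] using hv, rfl⟩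
  · exact ⟨.inr (.inl (b, s)), hv, rfl⟩
  · simp only [pieces, List.mem_cons, List.mem_append, List.not_mem_nil, or_false] at hv
    rcases hv with h | h | h | h | h
    · exact ⟨.inr (.inr (.inl (.inl (g, false)))), h, rfl⟩
    · exact ⟨.inr (.inr (.inr (.inl (.inl (g, false))))), h, rfl⟩
    · exact ⟨.inr (.inr (.inr (.inr (.inr g)))), h, rfl⟩
    · exact ⟨.inr (.inr (.inr (.inl (.inl (g, true))))), h, rfl⟩
    · exact ⟨.inr (.inr (.inl (.inl (g, true)))), h, rfl⟩
  · simp only [pieces, List.mem_cons, List.not_mem_nil, or_false] at hv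
    rcases hv with h | h | h
    · exact ⟨.inr (.inr (.inr (.inl (.inr (d, false))))), h, rfl⟩
    · exact ⟨.inr (.inr (.inl (.inr d))), h, rfl⟩
    · exact ⟨.inr (.inr (.inr (.inl (.inr (d, true))))), h, rfl⟩
  · exact ⟨.inr (.inr (.inr (.inr (.inl e)))), by simpa [pieces, InPart] using hv, rfl⟩

theorem Toolkit.part_unique [Fintype V] {r : V → V → Prop} {x : I → Bool → V} {R : Finset V}
    (h : Toolkit r x D R) (hx : ∀ i b i' b', x i b = x i' b' → i = i' ∧ b = b')
    {z : Near D → V} {w : Far D → V} {mid : I × GapKind → List V}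
    (hz : Function.Injective z) (hw : Function.Injective w) (hzR : ∀ a, z a ∉ R)
    (hwR : ∀ b, w b ∉ R) (hzw : ∀ a b, z a ≠ w b)
    (hm : ∀ g, ∀ v ∈ mid g, (v ∉ R ∧ (∀ a, v ≠ z a) ∧ ∀ b, v ≠ w b) ∨ ∃ j s, v ∈ D (.inl j) s)
    (hmm : ∀ g g', g ≠ g' → ∀ v ∈ mid g, v ∉ mid g')
    (τ τ' : (I × Bool) ⊕ ((I × Bool × Bool) × Bool) ⊕ Near D ⊕ Far D ⊕ Free D mid ⊕
      (I × GapKind)) (v : V) (h₁ : InPart x z w mid τ v) (h₂ : InPart x z w mid τ' v) :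
    τ = τ' := by
  have dXD : ∀ i b k s, x i b ∈ D k s → False := fun i b k s => h.avoid k s i b
  have dD : ∀ b s j s' v, v ∈ D (.inr b) s → v ∈ D (.inl j) s' → False := by
    intro b s j s' v h₁ h₂
    have := (h.disj _ _ _ _ _ h₁ h₂).1
    simp at this
  have dmX : ∀ g i b, x i b ∈ mid g → False := by
    intro g i b hv
    rcases hm g _ hv with hv' | ⟨j, s, hv'⟩
    · exact hv'.1 (h.ends i b)
    · exact dXD _ _ _ _ hv'
  have dmD : ∀ g b s v, v ∈ D (.inr b) s → v ∈ mid g → False := by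
    intro g b s v hv₁ hv
    rcases hm g _ hv with hv' | ⟨j, s, hv'⟩
    · exact hv'.1 (h.mem _ _ _ hv₁)
    · exact dD _ _ _ _ _ hv₁ hv'
  have dmz : ∀ g a, z a ∈ mid g → False := by
    intro g a hv
    rcases hm g _ hv with hv' | ⟨j, s, hv'⟩
    · exact hv'.2.1 a rfl
    · exact hzR _ (h.mem _ _ _ hv')
  have dmw : ∀ g a, w a ∈ mid g → False := by
    intro g a hv
    rcases hm g _ hv with hv' | ⟨j, s, hv'⟩
    · exact hv'.2.2 a rfl
    · exact hwR _ (h.mem _ _ _ hv')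
  have dE : ∀ e : Free D mid, e.1.1 ∈ R := by
    intro e
    obtain ⟨j, s, hv⟩ := e.1.2
    exact h.mem _ _ _ hv
  have dEX : ∀ (e : Free D mid) i b, x i b = e.1.1 → False := by
    intro e i b he
    obtain ⟨j, s, hv⟩ := e.1.2
    exact dXD i b _ _ (he ▸ hv)
  have dED : ∀ (e : Free D mid) b s, e.1.1 ∈ D (.inr b) s → False := by
    intro e b s he
    obtain ⟨j, s, hv⟩ := e.1.2
    exact dD _ _ _ _ _ he hv
  have aux : ∀ τ τ' v, InPart x z w mid τ v → InPart x z w mid τ' v → τ ≠ τ' →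
      (match τ, τ' with
        | .inl _, .inr _ => False
        | .inr (.inl _), .inr (.inr _) => False
        | .inr (.inr (.inl _)), .inr (.inr (.inr _)) => False
        | .inr (.inr (.inr (.inl _))), .inr (.inr (.inr (.inr _))) => False
        | .inr (.inr (.inr (.inr (.inl _)))), .inr (.inr (.inr (.inr (.inr _)))) => False
        | .inl _, .inl _ => False
        | .inr (.inl _), .inr (.inl _) => False
        | .inr (.inr (.inl _)), .inr (.inr (.inl _)) => False
        | .inr (.inr (.inr (.inl _))), .inr (.inr (.inr (.inl _))) => False
        | .inr (.inr (.inr (.inr (.inl _)))), .inr (.inr (.inr (.inr (.inl _)))) => False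
        | .inr (.inr (.inr (.inr (.inr _)))), .inr (.inr (.inr (.inr (.inr _)))) => False
        | _, _ => True) := by
    rintro (p | p | p | p | p | p) (p' | p' | p' | p' | p' | p') v h₁ h₂ hne <;>
      simp only [InPart] at h₁ h₂
    case inl.inl =>
      obtain ⟨h3, h4⟩ := hx _ _ _ _ (h₁.symm.trans h₂)
      exact absurd (congrArg Sum.inl (Prod.ext h3 h4)) hne
    case inl.inr.inl => subst h₁; exact (dXD _ _ _ _ h₂).elim
    case inl.inr.inr.inl => subst h₁; exact (hzR _ (h₂ ▸ h.ends _ _)).elim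
    case inl.inr.inr.inr.inl => subst h₁; exact (hwR _ (h₂ ▸ h.ends _ _)).elim
    case inl.inr.inr.inr.inr.inl => subst h₁; exact (dEX _ _ _ h₂).elim
    case inl.inr.inr.inr.inr.inr => subst h₁; exact (dmX _ _ _ h₂).elim
    case inr.inl.inr.inl =>
      obtain ⟨h3, h4⟩ := h.disj _ _ _ _ _ h₁ h₂
      exact absurd (congrArg (Sum.inr ∘ Sum.inl) (Prod.ext (Sum.inr_injective h3) h4)) hne
    case inr.inl.inr.inr.inl => subst h₂; exact (hzR _ (h.mem _ _ _ h₁)).elim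
    case inr.inl.inr.inr.inr.inl => subst h₂; exact (hwR _ (h.mem _ _ _ h₁)).elim
    case inr.inl.inr.inr.inr.inr.inl => subst h₂; exact (dED _ _ _ h₁).elim
    case inr.inl.inr.inr.inr.inr.inr => exact (dmD _ _ _ _ h₁ h₂).elim
    case inr.inr.inl.inr.inr.inl => exact absurd (by rw [hz (h₁.symm.trans h₂)]) hne
    case inr.inr.inl.inr.inr.inr.inl => exact (hzw _ _ (h₁.symm.trans h₂)).elim
    case inr.inr.inl.inr.inr.inr.inr.inl => subst h₁; exact (hzR _ (h₂ ▸ dE _)).elim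
    case inr.inr.inl.inr.inr.inr.inr.inr => subst h₁; exact (dmz _ _ h₂).elim
    case inr.inr.inr.inl.inr.inr.inr.inl => exact absurd (by rw [hw (h₁.symm.trans h₂)]) hne
    case inr.inr.inr.inl.inr.inr.inr.inr.inl => subst h₁; exact (hwR _ (h₂ ▸ dE _)).elim
    case inr.inr.inr.inl.inr.inr.inr.inr.inr => subst h₁; exact (dmw _ _ h₂).elim
    case inr.inr.inr.inr.inl.inr.inr.inr.inr.inl =>
      exact absurd (by rw [Subtype.ext (Subtype.ext (h₁.symm.trans h₂))]) hne
    case inr.inr.inr.inr.inl.inr.inr.inr.inr.inr => subst h₁; exact (p.2 _ h₂).elim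
    case inr.inr.inr.inr.inr.inr.inr.inr.inr.inr =>
      by_contra
      refine hmm _ _ (fun h' => hne (by rw [h'])) _ h₁ h₂
    all_goals trivial
  by_contra hne
  have e1 := aux τ τ' v h₁ h₂ hne
  have e2 := aux τ' τ v h₂ h₁ (Ne.symm hne)
  rcases τ with (p | p | p | p | p | p) <;> rcases τ' with (p' | p' | p' | p' | p' | p') <;>
    simp at e1 e2

theorem Toolkit.fam_pieces [Fintype V] {r : V → V → Prop} {x : I → Bool → V} {R : Finset V}
    (h : Toolkit r x D R) (hx : ∀ i b i' b', x i b = x i' b' → i = i' ∧ b = b')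
    {z : Near D → V} {w : Far D → V} {mid : I × GapKind → List V}
    (hz : Function.Injective z) (hw : Function.Injective w) (hzR : ∀ a, z a ∉ R)
    (hwR : ∀ b, w b ∉ R) (hzw : ∀ a b, z a ≠ w b)
    (hm : ∀ g, ∀ v ∈ mid g, (v ∉ R ∧ (∀ a, v ≠ z a) ∧ ∀ b, v ≠ w b) ∨ ∃ j s, v ∈ D (.inl j) s)
    (hmm : ∀ g g', g ≠ g' → ∀ v ∈ mid g, v ∉ mid g') (hmn : ∀ g, (mid g).Nodup)
    (hgap : ∀ g, (z (.inl (g, false)) :: w (.inl (g, false)) ::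
      (mid g ++ [w (.inl (g, true)), z (.inl (g, true))])).IsChain r)
    (hsand : ∀ d, r (w (.inr (d, false))) (z (.inr d)) ∧ r (z (.inr d)) (w (.inr (d, true)))) :
    Fam r (pieces x z w mid) := by
  have hu := h.part_unique hx hz hw hzR hwR hzw hm hmm
  refine ⟨?_, ?_, ?_⟩
  · rintro (⟨i, b⟩ | ⟨b, s⟩ | g | d | e)
    · simp [pieces]
    · exact h.chain _ _
    · exact hgap g
    · simpa [pieces] using hsand d
    · simp [pieces]
  · rintro (⟨i, b⟩ | ⟨b, s⟩ | g | d | e)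
    · simp [pieces]
    · exact h.nodup _ _
    · have m1 : ∀ a, z a ∉ mid g := fun a ha => by
        have := hu (.inr (.inr (.inl a))) (.inr (.inr (.inr (.inr (.inr g))))) _ rfl ha
        simp at this
      have m2 : ∀ a, w a ∉ mid g := fun a ha => by
        have := hu (.inr (.inr (.inr (.inl a)))) (.inr (.inr (.inr (.inr (.inr g))))) _ rfl ha
        simp at this
      simp only [pieces, List.nodup_cons, List.mem_cons, List.mem_append, List.nodup_append,
        hmn g, m1, m2, hzw, hz.eq_iff, hw.eq_iff, (hzw _ _).symm]
      simp only [List.not_mem_nil, or_false, Sum.inl.injEq, Prod.mk.injEq, reduceCtorEq,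
        and_false, not_false_eq_true, true_and, List.nodup_nil, and_true]
      rintro a ha b (rfl | rfl) rfl
      · exact m2 _ ha
      · exact m1 _ ha
    · simp [pieces, hzw, hw.eq_iff, (hzw _ _).symm]
    · simp [pieces]
  · intro k k' hne v hv hv'
    obtain ⟨τ, h1, rfl⟩ := exists_part hv
    obtain ⟨τ', h2, rfl⟩ := exists_part hv'
    exact hne (by rw [hu τ τ' v h1 h2])

end Pieces

open scoped Classical in
theorem Toolkit.two_mul_card_bad_le {I M : Type} [Fintype V] [Fintype I] [Fintype M]
    {r : V → V → Prop} {x : I → Bool → V} {D : Slot I M → Bool → List V} {R : Finset V}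
    (h : Toolkit r x D R) (hM : 0 < Fintype.card (I × M)) (s : Bool) {v : V} (hv : v ∉ R) :
    2 * ((Finset.univ.filter fun u => u ∉ R).filter fun u => Fintype.card (I × M) ≤
      10 * (Finset.univ.filter fun j => Undom (orient r !s) (D (.inl j) !s) u).card).card ≤
      (Finset.univ.filter fun u => orient r s v u).card := by
  have := card_frequent_le (p := fun j : I × M => Undom (orient r !s) (D (.inl j) !s))
    (U := Finset.univ.filter fun u => u ∉ R) (K := 2 ^ 30) (c := 10)
    (d := (Finset.univ.filter fun u => orient r s v u).card) (by
      intro j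
      have := h.dom R subset_rfl (.inl j) (!s) v hv
      simpa only [Finset.filter_filter, orient_not] using this) hM
  omega

open scoped Classical in
theorem Toolkit.exists_layout {I M : Type} [Fintype V] [Fintype I] [Fintype M]
    {r : V → V → Prop} (hr : ∀ u v, u ≠ v → r u v ∨ r v u) {k : ℕ}
    (hkV : k + 1 ≤ Fintype.card V)
    (hconn : ∀ T : Finset V, T.card < k → ∀ u v, u ∉ T → v ∉ T → u ≠ v →
      ∃ l : List V, l.Nodup ∧ l.IsChain r ∧ l.head? = some u ∧ l.getLast? = some v ∧
        ∀ w ∈ l, w ∉ T)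
    {x : I → Bool → V} {D : Slot I M → Bool → List V} {R₀ : Finset V} (h : Toolkit r x D R₀)
    (hk : 2 * (Fintype.card (Near D) + Fintype.card (Far D) + R₀.card) + Fintype.card (I × M) ≤ k)
    (hS : 10 * Fintype.card (I × GapKind) < Fintype.card (I × M))
    (en : I × GapKind → Bool → V) (site : Core D → I × Bool) :
    ∃ (R : Finset V) (z : Near D → V) (w : Far D → V) (β q α : I × GapKind → List V),
      R₀ ⊆ R ∧ R.card ≤ R₀.card + Fintype.card (Near D) + Fintype.card (Far D) ∧
      Function.Injective z ∧ Function.Injective w ∧ (∀ a, z a ∉ R₀) ∧ (∀ b, w b ∉ R₀) ∧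
      (∀ a b, z a ≠ w b) ∧ (∀ v ∈ R, v ∈ R₀ ∨ (∃ a, v = z a) ∨ ∃ b, v = w b) ∧
      (∀ a, z a ∈ R) ∧ (∀ b, w b ∈ R) ∧
      (∀ g b, orient r b (en g b) (z (.inl (g, b)))) ∧
      (∀ g b, orient r b (z (.inl (g, b))) (w (.inl (g, b)))) ∧
      (∀ v p, orient r p (z (.inr (v, p))) v.1) ∧
      (∀ d b, orient r b (w (.inr (d, b))) (z (.inr d))) ∧
      (∀ d b, ∃ a ∈ D (.inr ((site d.1).1, (site d.1).2, d.2)) b,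
        orient r b a (w (.inr (d, b)))) ∧
      GapSystem r R (fun j => D (.inl j) false) (fun j => D (.inl j) true)
        (fun g => w (.inl (g, false))) (fun g => w (.inl (g, true))) 31
        (4 * Fintype.card V / Fintype.card (I × M)) β q α ∧
      ∀ s u, u ∉ R → (∀ g, u ∉ q g) → Fintype.card (I × M) ≤
        5 * (Finset.univ.filter fun j => Undom (orient r s) (D (.inl j) s) u).card →
        ∀ g, ((q g).toFinset.filter fun v => orient r s v u).card ≤ 33 := by
  have hM : 0 < Fintype.card (I × M) := by omega
  obtain ⟨z, w, hz, hw, hzR, hwR, hzw, hza, hwz, hwb⟩ := exists_two_levels (Z := Near D)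
    (Y := Far D) (r := r) (k := k) (le_card_orient hkV hconn) R₀ (by omega)
    (Sum.elim (fun g => en g.1 g.2) fun d => d.1.1) (Sum.elim (fun g => g.2) fun d => !d.2)
    (Sum.elim (fun g => .inl g) fun d => .inr d.1) (Sum.elim (fun g => g.2) fun d => !d.2)
    (Sum.elim (fun g => (Finset.univ.filter fun u => u ∉ R₀).filter fun u =>
        Fintype.card (I × M) ≤
        10 * (Finset.univ.filter fun j => Undom (orient r !g.2) (D (.inl j) !g.2) u).card)
      fun d => Finset.univ.filter fun u => u ∉ R₀ ∧ Undom (orient r d.2)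
        (D (.inr ((site d.1.1).1, (site d.1.1).2, d.1.2)) d.2) u)
    (by
      rintro (⟨g, b⟩ | ⟨d, b⟩) v hv
      · exact h.two_mul_card_bad_le hM b hv
      · have := h.dom R₀ subset_rfl (.inr ((site d.1).1, (site d.1).2, d.2)) b v hv
        simp only [Sum.elim_inr, orient_not]
        omega)
  set R := R₀ ∪ (Finset.univ.image z ∪ Finset.univ.image w) with hR
  have hRc : R.card ≤ R₀.card + Fintype.card (Near D) + Fintype.card (Far D) := by
    have h1 := Finset.card_union_le R₀ (Finset.univ.image z ∪ Finset.univ.image w)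
    have h2 := Finset.card_union_le (Finset.univ.image z) (Finset.univ.image w)
    have h3 : (Finset.univ.image z).card ≤ Fintype.card (Near D) := Finset.card_image_le
    have h4 : (Finset.univ.image w).card ≤ Fintype.card (Far D) := Finset.card_image_le
    rw [hR]
    omega
  have hb : ∀ g b, 10 * (Finset.univ.filter fun j =>
      Undom (orient r !b) (D (.inl j) !b) (w (.inl (g, b)))).card ≤ Fintype.card (I × M) := by
    intro g b
    have h1 := hwb (.inl (g, b))
    simp only [Sum.elim_inl, Finset.mem_filter, Finset.mem_univ, true_and, hwR, not_false_eq_true,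
      not_le] at h1
    exact h1.le
  have hinl : ∀ {s j s' j'}, ∀ a ∈ D (.inl j) s, a ∈ D (.inl j') s' → j = j' ∧ s = s' := by
    intro s j s' j' a ha ha'
    obtain ⟨h1, h2⟩ := h.disj _ _ _ _ a ha ha'
    exact ⟨Sum.inl_injective h1, h2⟩
  have hsub : R₀ ⊆ R := Finset.subset_union_left
  obtain ⟨β, q, α, hG, ht₁, ht₂⟩ := exists_thin_gapSystem (R := R) (k := k) (c := 31) hr hconn
    (by omega) (A := fun j => D (.inl j) false) (B := fun j => D (.inl j) true)
    (e := fun g => w (.inl (g, false))) (f := fun g => w (.inl (g, true)))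
    (fun j => h.chain _ _) (fun j => h.ne _ _) (fun j => h.length_le _ _) (fun j => h.nodup _ _)
    (fun j a ha => hsub (h.mem _ _ _ ha))
    (fun j j' hj a ha ha' => hj (hinl a ha ha').1)
    (fun j => h.chain _ _) (fun j => h.ne _ _) (fun j => h.length_le _ _) (fun j => h.nodup _ _)
    (fun j a ha => hsub (h.mem _ _ _ ha))
    (fun j j' hj a ha ha' => hj (hinl a ha ha').1)
    (fun j j' a ha ha' => by simpa using (hinl a ha ha').2)
    (fun g => hb g true) (fun g => hb g false) hS
  refine ⟨R, z, w, β, q, α, hsub, hRc, hz, hw, hzR, hwR, hzw, ?_, ?_, ?_,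
    fun g b => hza (.inl (g, b)), fun g b => hwz (.inl (g, b)), ?_, ?_, ?_, hG, ?_⟩
  · intro v hv
    simp only [hR, Finset.mem_union, Finset.mem_image, Finset.mem_univ, true_and] at hv
    rcases hv with hv | ⟨a, rfl⟩ | ⟨b, rfl⟩
    exacts [.inl hv, .inr (.inl ⟨a, rfl⟩), .inr (.inr ⟨b, rfl⟩)]
  · intro a
    simp [hR]
  · intro b
    simp [hR]
  · intro v p
    rw [← orient_not]
    exact hza (.inr (v, p))
  · intro d b
    rw [← orient_not]
    exact hwz (.inr (d, b))
  · intro d b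
    have h1 : ¬ Undom (orient r b) (D (.inr ((site d.1).1, (site d.1).2, d.2)) b)
        (w (.inr (d, b))) := fun hu => hwb (.inr (d, b)) (Finset.mem_filter.2
      ⟨Finset.mem_univ _, hwR _, hu⟩)
    simp only [Undom, not_forall, not_not] at h1
    obtain ⟨a, ha, ha'⟩ := h1
    exact ⟨a, ha, ha'⟩
  · rintro (_ | _) u hu hq hc
    · exact ht₁ u hu hq hc
    · exact ht₂ u hu hq hc

theorem isChain_cons_append {r : V → V → Prop} {l : List V} {u v a b : V} (h : l.IsChain r)
    (ha : l.head? = some a) (hb : l.getLast? = some b) (hu : r u a) (hv : r b v) :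
    (u :: l ++ [v]).IsChain r := by
  have h₁ : (u :: l).IsChain r := by
    rcases l with _ | ⟨c, l⟩
    · simp
    · obtain rfl : c = a := by simpa using ha
      exact List.isChain_cons_cons.2 ⟨hu, h⟩
  refine List.isChain_append.2 ⟨h₁, List.isChain_singleton _, ?_⟩
  intro p hp q hq
  obtain rfl : v = q := by simpa using hq
  rw [List.getLast?_cons, hb] at hp
  obtain rfl : b = p := by simpa using hp
  exact hv

/-- The prescribed end vertices of the connections. -/
def gapEnds {I : Type} (x : I → Bool → V) (aH aL bH bL : I × Bool × Bool → V) :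
    I × GapKind → Bool → V
  | (i, .inl p), false => aL (i, p)
  | (i, .inl p), true => bH (i, p)
  | (i, .inr (.inl h)), false => bL (i, h, false)
  | (i, .inr (.inl h)), true => aH (i, h, true)
  | (i, .inr (.inr m)), false => ![x i false, bL (i, false, true), bL (i, true, true)] m
  | (i, .inr (.inr m)), true => ![aH (i, false, false), aH (i, true, false), x i true] m

open scoped Classical in
theorem Toolkit.card_core_fiber_le {I M : Type} [Fintype V] [Fintype M] {r : V → V → Prop}
    {x : I → Bool → V} {D : Slot I M → Bool → List V} {R : Finset V} (h : Toolkit r x D R)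
    {site : Core D → I × Bool}
    (hs : ∀ (v : Core D) j s, v.1 ∈ D (.inl j) s → site v = (j.1, s)) (i : I) :
    (Finset.univ.filter fun v => (site v).1 = i).card ≤ 62 * Fintype.card M := by
  have h1 : ((Finset.univ.filter fun v => (site v).1 = i).image Subtype.val) ⊆
      Finset.univ.biUnion fun p : M × Bool => (D (.inl (i, p.1)) p.2).toFinset := by
    intro v hv
    obtain ⟨u, hu, rfl⟩ := Finset.mem_image.1 hv
    obtain ⟨⟨i', m⟩, s, hvs⟩ := u.2
    have hv' := (Finset.mem_filter.1 hu).2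
    rw [hs u _ _ hvs] at hv'
    obtain rfl : i' = i := hv'
    exact Finset.mem_biUnion.2 ⟨(m, s), Finset.mem_univ _, by simpa using hvs⟩
  have h2 := Finset.card_le_card h1
  rw [Finset.card_image_of_injective _ Subtype.val_injective] at h2
  have h3 := Finset.card_biUnion_le_card_mul Finset.univ
    (fun p : M × Bool => (D (.inl (i, p.1)) p.2).toFinset) 31 fun p _ =>
        (List.toFinset_card_le _).trans (h.length_le _ _)
  rw [Finset.card_univ, Fintype.card_prod, Fintype.card_bool] at h3
  omega

open scoped Classical in
theorem Toolkit.length_le_of_owner {I M : Type} [Fintype V] [Fintype M] {r : V → V → Prop}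
    {x : I → Bool → V} {D : Slot I M → Bool → List V} {R : Finset V} (h : Toolkit r x D R)
    {site : Core D → I × Bool}
    (hs : ∀ (v : Core D) j s, v.1 ∈ D (.inl j) s → site v = (j.1, s))
    {z : Near D → V} {w : Far D → V} {mid : I × GapKind → List V} {L : ℕ}
    (hL : ∀ g, (mid g).length ≤ 62 + L) {i : I} {P : List V} (hP : P.Nodup)
    (hm : ∀ v ∈ P, ∃ k, Piece.owner (fun d : Core D × Bool => ((site d.1).1, (site d.1).2, d.2))
      (fun e : Free D mid => site e.1) k = i ∧ v ∈ pieces x z w mid k) :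
    P.length ≤ 9 * L + 434 * Fintype.card M + 844 := by
  have hf := h.card_core_fiber_le hs i
  set C := Finset.univ.filter fun v => (site v).1 = i with hC
  set U₁ := Finset.univ.image (x i) with hU₁
  set U₂ := Finset.univ.biUnion fun p : (Bool × Bool) × Bool =>
    (D (.inr (i, p.1)) p.2).toFinset with hU₂
  set U₃ := Finset.univ.biUnion fun κ : GapKind =>
    (pieces x z w mid (.gap (i, κ))).toFinset with hU₃
  set U₄ := (C ×ˢ (Finset.univ : Finset Bool)).biUnion fun d =>
    (pieces x z w mid (.sand d)).toFinset with hU₄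
  set U₅ := C.image Subtype.val with hU₅
  have c₁ : U₁.card ≤ 2 := Finset.card_image_le
  have c₂ : U₂.card ≤ 8 * 31 := Finset.card_biUnion_le_card_mul _ _ 31 fun p _ =>
    (List.toFinset_card_le _).trans (h.length_le _ _)
  have c₃ : U₃.card ≤ 9 * (66 + L) := Finset.card_biUnion_le_card_mul _ _ _ fun κ _ => by
    refine (List.toFinset_card_le _).trans ?_
    have := hL (i, κ)
    simp only [pieces, List.length_cons, List.length_append, List.length_nil]
    omega
  have c₄ : U₄.card ≤ (C.card * 2) * 3 := by
    refine (Finset.card_biUnion_le_card_mul _ _ 3 fun κ _ =>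
      (List.toFinset_card_le _).trans (by simp [pieces])).trans ?_
    rw [Finset.card_product]
    simp
  have c₅ : U₅.card ≤ C.card := Finset.card_image_le
  have hsub : P.toFinset ⊆ U₁ ∪ (U₂ ∪ (U₃ ∪ (U₄ ∪ U₅))) := by
    intro v hv
    obtain ⟨k, hk, hvk⟩ := hm v (List.mem_toFinset.1 hv)
    simp only [Finset.mem_union]
    rcases k with ⟨i, b⟩ | ⟨⟨i, b⟩, s⟩ | ⟨i, κ⟩ | d | e <;> simp only [Piece.owner] at hk <;>
      subst hk
    · exact .inl (Finset.mem_image.2 ⟨b, Finset.mem_univ _, (List.mem_singleton.1 hvk).symm⟩)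
    · exact .inr (.inl (Finset.mem_biUnion.2 ⟨(b, s), Finset.mem_univ _,
        List.mem_toFinset.2 hvk⟩))
    · exact .inr (.inr (.inl (Finset.mem_biUnion.2 ⟨κ, Finset.mem_univ _,
        List.mem_toFinset.2 hvk⟩)))
    · exact .inr (.inr (.inr (.inl (Finset.mem_biUnion.2 ⟨d, by simp [hC],
        List.mem_toFinset.2 hvk⟩))))
    · refine .inr (.inr (.inr (.inr (Finset.mem_image.2 ⟨e.1, by simp [hC], ?_⟩))))
      exact (List.mem_singleton.1 hvk).symm
  have h1 := Finset.card_le_card hsub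
  rw [List.toFinset_card_of_nodup hP] at h1
  have h2 := Finset.card_union_le U₁ (U₂ ∪ (U₃ ∪ (U₄ ∪ U₅)))
  have h3 := Finset.card_union_le U₂ (U₃ ∪ (U₄ ∪ U₅))
  have h4 := Finset.card_union_le U₃ (U₄ ∪ U₅)
  have h5 := Finset.card_union_le U₄ U₅
  omega

open scoped Classical in
/-- Disjoint paths between prescribed pairs of vertices, most of whose linkers and absorbers are
available for insertions. -/
structure Frame {I M : Type} [Fintype V] [Fintype I] [Fintype M] (r : V → V → Prop)
    (x : I → Bool → V) (D : Slot I M → Bool → List V) (R : Finset V)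
    (q : I × GapKind → List V) (P : I → List V) (T : Finset (I × M)) : Prop where
  card_le : R.card ≤ Fintype.card I * (434 * Fintype.card M + 1786)
  fam : Fam r P
  head : ∀ i, (P i).head? = some (x i false)
  last : ∀ i, (P i).getLast? = some (x i true)
  cover : ∀ v ∈ R, ∃ i, v ∈ P i
  mem : ∀ i, ∀ v ∈ P i, v ∈ R ∨ ∃ g, v ∈ q g
  length_le : ∀ i, (P i).length ≤ 9 * (4 * Fintype.card V / Fintype.card (I × M)) +
    434 * Fintype.card M + 844
  touched : T.card ≤ 18 * Fintype.card I
  order : ∀ i a b,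
    (a ∈ D (.inr (i, false, false)) false ∨ ∃ m, (i, m) ∉ T ∧ a ∈ D (.inl (i, m)) false) →
    (b ∈ D (.inr (i, true, true)) true ∨ ∃ m, (i, m) ∉ T ∧ b ∈ D (.inl (i, m)) true) →
    [a, b].Sublist (P i)
  thin : ∀ s u, (∀ i, u ∉ P i) → Fintype.card (I × M) ≤
    5 * (Finset.univ.filter fun j => Undom (orient r s) (D (.inl j) s) u).card →
    ∀ g, ((q g).toFinset.filter fun v => orient r s v u).card ≤ 33

open scoped Classical in
theorem exists_frame {I M : Type} [Fintype V] [Fintype I] [Fintype M]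
    {r : V → V → Prop} (hr : ∀ u v, u ≠ v → r u v ∨ r v u) {k : ℕ}
    (hkV : k + 1 ≤ Fintype.card V)
    (hconn : ∀ T : Finset V, T.card < k → ∀ u v, u ∉ T → v ∉ T → u ≠ v →
      ∃ l : List V, l.Nodup ∧ l.IsChain r ∧ l.head? = some u ∧ l.getLast? = some v ∧
        ∀ w ∈ l, w ∉ T)
    {x : I → Bool → V} (hx : ∀ i b i' b', x i b = x i' b' → i = i' ∧ b = b')
    (hI : 0 < Fintype.card I) (hM : 90 < Fintype.card M)
    (hk : Fintype.card I * (869 * Fintype.card M + 3572) ≤ k) :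
    ∃ (D : Slot I M → Bool → List V) (R₀ R : Finset V) (q : I × GapKind → List V)
      (P : I → List V) (T : Finset (I × M)),
      Toolkit r x D R₀ ∧ R₀ ⊆ R ∧ Frame r x D R q P T := by
  obtain ⟨D, R₀, h, hR₀⟩ := exists_toolkit (M := M) hr x (by
    refine lt_of_le_of_lt ?_ (lt_of_lt_of_le (Nat.lt_succ_self k) hkV)
    refine le_trans (Nat.mul_le_mul_left _ ?_) hk
    omega)
  obtain ⟨site, hs⟩ := h.exists_site
  have hG : Fintype.card (I × GapKind) = 9 * Fintype.card I := by
    simp only [Fintype.card_prod, Fintype.card_sum, Fintype.card_bool, Fintype.card_fin]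
    ring
  have hCo := h.card_core_le
  have hNear : Fintype.card (Near D) = 18 * Fintype.card I + 2 * Fintype.card (Core D) := by
    rw [Fintype.card_sum, Fintype.card_prod (I × GapKind), Fintype.card_prod (Core D), hG,
      Fintype.card_bool]
    ring
  have hFar : Fintype.card (Far D) = 18 * Fintype.card I + 4 * Fintype.card (Core D) := by
    rw [Fintype.card_sum, Fintype.card_prod (I × GapKind), Fintype.card_prod (Core D × Bool),
      Fintype.card_prod (Core D), hG, Fintype.card_bool]
    ring
  have hIM : Fintype.card (I × M) = Fintype.card I * Fintype.card M := Fintype.card_prod _ _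
  have hIM' : Fintype.card I * 91 ≤ Fintype.card I * Fintype.card M := Nat.mul_le_mul_left _ hM
  rw [Nat.mul_add] at hR₀ hk
  rw [Nat.mul_left_comm] at hR₀ hk
  choose aH haH using fun b : I × Bool × Bool =>
    show ∃ a, (D (.inr b) false).head? = some a from ⟨_, List.head?_eq_some_head (h.ne _ _)⟩
  choose aL haL using fun b : I × Bool × Bool =>
    show ∃ a, (D (.inr b) false).getLast? = some a from ⟨_, List.getLast?_eq_some_getLast (h.ne _ _)⟩
  choose bH hbH using fun b : I × Bool × Bool =>
    show ∃ a, (D (.inr b) true).head? = some a from ⟨_, List.head?_eq_some_head (h.ne _ _)⟩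
  choose bL hbL using fun b : I × Bool × Bool =>
    show ∃ a, (D (.inr b) true).getLast? = some a from ⟨_, List.getLast?_eq_some_getLast (h.ne _ _)⟩
  obtain ⟨R, z, w, β, q, α, hsub, hRc, hz, hw, hzR, hwR, hzw, hRm, hzm, hwm, hen, hgz, hzv, hsd,
    hsb, hGS, hthin⟩ := h.exists_layout hr hkV hconn (by omega) (by omega)
    (gapEnds x aH aL bH bL) site
  obtain ⟨mid, hmid⟩ : ∃ mid : I × GapKind → List V, mid = fun g => β g ++ q g ++ α g := ⟨_, rfl⟩
  have hmid' : ∀ g, β g ++ q g ++ α g = mid g := fun g => by rw [hmid]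
  choose jβ hjβ using fun g => (hGS.left g).2
  choose jα hjα using fun g => (hGS.right g).2
  have hmm : ∀ g, ∀ v ∈ mid g, v ∈ q g ∨ v ∈ D (.inl (jβ g)) true ∨ v ∈ D (.inl (jα g)) false := by
    intro g v hv
    simp only [hmid, List.mem_append] at hv
    rcases hv with (hv | hv) | hv
    exacts [.inr (.inl (hjβ g v hv)), .inl hv, .inr (.inr (hjα g v hv))]
  have hqm : ∀ g, ∀ v ∈ q g, v ∈ mid g := by
    intro g v hv
    simp [hmid, hv]
  have hm : ∀ g, ∀ v ∈ mid g, (v ∉ R₀ ∧ (∀ a, v ≠ z a) ∧ ∀ b, v ≠ w b) ∨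
      ∃ j s, v ∈ D (.inl j) s := by
    intro g v hv
    rcases hmm g v hv with hv | hv | hv
    · have hvR := (hGS.mid g).2 v hv
      exact .inl ⟨fun h' => hvR (hsub h'), fun a ha => hvR (ha ▸ hzm a),
        fun b hb => hvR (hb ▸ hwm b)⟩
    · exact .inr ⟨_, _, hv⟩
    · exact .inr ⟨_, _, hv⟩
  have hgap : ∀ g, (w (.inl (g, false)) :: mid g ++ [w (.inl (g, true))]).IsChain r := by
    intro g
    rw [← hmid']
    exact hGS.chain g
  have hgap' : ∀ g, (z (.inl (g, false)) :: (w (.inl (g, false)) :: mid g ++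
      [w (.inl (g, true))]) ++ [z (.inl (g, true))]).IsChain r := fun g =>
    isChain_cons_append (hgap g) rfl (by simp [List.getLast?_cons]) (hgz g false) (hgz g true)
  have hpg : ∀ g, pieces x z w mid (.gap g) = z (.inl (g, false)) :: (w (.inl (g, false)) ::
      mid g ++ [w (.inl (g, true))]) ++ [z (.inl (g, true))] := fun g => by simp [pieces]
  have hconnect : ∀ g, (gapEnds x aH aL bH bL g false :: pieces x z w mid (.gap g) ++
      [gapEnds x aH aL bH bL g true]).IsChain r := by
    intro g
    rw [hpg]
    exact isChain_cons_append (hgap' g) rfl (by rw [List.getLast?_concat]) (hen g false)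
      (hen g true)
  have hF : Fam r (pieces x z w mid) := by
    refine h.fam_pieces hx hz hw hzR hwR hzw hm ?_ ?_ (fun g => by simpa using hgap' g) ?_
    · intro g g' hne v hv hv'
      rw [← hmid'] at hv hv'
      exact hGS.disj g g' hne v hv hv'
    · intro g
      rw [← hmid']
      exact hGS.nodup g
    · intro d
      exact ⟨hsd d false, hsd d true⟩
  obtain ⟨P, hP, hPh, hPl, hPm, hPo⟩ := exists_skeleton hr hF
    (blk := fun d : Core D × Bool => ((site d.1).1, (site d.1).2, d.2))
    (half := fun e : Free D mid => site e.1) (x := fun i => x i false) (y := fun i => x i true)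
    (aH := aH) (aL := aL) (bH := bH) (bL := bL)
    (fun i => rfl) (fun i => rfl) haH haL hbH hbL
    (fun i h p => hconnect (i, .inl (h, p))) (fun i h => hconnect (i, .inr (.inl h)))
    (fun i => hconnect (i, .inr (.inr 0))) (fun i => hconnect (i, .inr (.inr 1)))
    (fun i => hconnect (i, .inr (.inr 2)))
    (by
      intro d
      obtain ⟨a, ha, ha'⟩ := hsb d false
      obtain ⟨b, hb, hb'⟩ := hsb d true
      refine ⟨⟨a, ha, ?_⟩, b, hb, ?_⟩
      · intro v hv
        obtain rfl : w (.inr (d, false)) = v := by simpa [pieces] using hv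
        exact ha'
      · intro v hv
        obtain rfl : w (.inr (d, true)) = v := by simpa [pieces] using hv
        exact hb')
    (by
      intro e
      refine ⟨(e.1, false), (e.1, true), z (.inr (e.1, false)), z (.inr (e.1, true)), e.1.1, rfl,
        rfl, rfl, by simp [pieces], by simp [pieces], hzv e.1 false, hzv e.1 true⟩)
  have hfree : ∀ (v : Core D), (∃ g, v.1 ∈ mid g) ∨ ∃ e : Free D mid, e.1 = v := by
    intro v
    by_cases hv : ∃ g, v.1 ∈ mid g
    · exact .inl hv
    · exact .inr ⟨⟨v, fun g hg => hv ⟨g, hg⟩⟩, rfl⟩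
  have hgm : ∀ g, ∀ v ∈ mid g, ∃ i, v ∈ P i := fun g v hv =>
    ⟨g.1, (hPm _ v).2 ⟨.gap g, rfl, by simp [pieces, hv]⟩⟩
  set T : Finset (I × M) := Finset.univ.image jβ ∪ Finset.univ.image jα with hT
  have hreach : ∀ i s a m, (i, m) ∉ T → a ∈ D (.inl (i, m)) s →
      ∃ e : Free D mid, site e.1 = (i, s) ∧ a ∈ pieces x z w mid (.one e) := by
    intro i s a m hmT ha
    simp only [hT, Finset.mem_union, Finset.mem_image, Finset.mem_univ, true_and, not_or,
      not_exists] at hmT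
    rcases hfree ⟨a, _, _, ha⟩ with ⟨g, hg⟩ | ⟨e, he⟩
    · exfalso
      rcases hmm g _ hg with hv | hv | hv
      · exact (hGS.mid g).2 _ hv (hsub (h.mem _ _ _ ha))
      · exact hmT.1 g (Sum.inl_injective (h.disj _ _ _ _ _ hv ha).1)
      · exact hmT.2 g (Sum.inl_injective (h.disj _ _ _ _ _ hv ha).1)
    · refine ⟨e, hs e.1 (i, m) s (by rw [he]; exact ha), ?_⟩
      simp [pieces, he]
  have hcov : ∀ v ∈ R, ∃ i, v ∈ P i := by
    have hp : ∀ k, ∀ v ∈ pieces x z w mid k, ∃ i, v ∈ P i := fun k v hv =>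
      ⟨_, (hPm _ v).2 ⟨k, rfl, hv⟩⟩
    intro v hv
    rcases hRm v hv with hv | ⟨g | d, rfl⟩ | ⟨g | d, rfl⟩
    · rcases h.cover v hv with ⟨i, b, rfl⟩ | ⟨j | b, s, hv⟩
      · exact hp (.tip i b) _ (by simp [pieces])
      · rcases hfree ⟨v, j, s, hv⟩ with ⟨g, hg⟩ | ⟨e, he⟩
        · exact hgm g v hg
        · exact hp (.one e) _ (by simp [pieces, he])
      · exact hp (.abs b s) _ hv
    · obtain ⟨g, _ | _⟩ := g <;> exact hp (.gap g) _ (by simp [pieces])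
    · exact hp (.sand d) _ (by simp [pieces])
    · obtain ⟨g, _ | _⟩ := g <;> exact hp (.gap g) _ (by simp [pieces])
    · obtain ⟨d, _ | _⟩ := d <;> exact hp (.sand d) _ (by simp [pieces])
  refine ⟨D, R₀, R, q, P, T, h, hsub, ?_, hP, hPh, hPl, hcov, ?_, ?_, ?_, ?_, ?_⟩
  · rw [Nat.mul_add, Nat.mul_left_comm]
    omega
  · intro i v hv
    obtain ⟨k, -, hk⟩ := (hPm i v).1 hv
    obtain ⟨τ, hτ, -⟩ := exists_part hk
    rcases τ with p | p | a | b | e | g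
    · exact .inl (hsub (by rw [show v = _ from hτ]; exact h.ends _ _))
    · exact .inl (hsub (h.mem _ _ _ hτ))
    · exact .inl (by rw [show v = _ from hτ]; exact hzm a)
    · exact .inl (by rw [show v = _ from hτ]; exact hwm b)
    · obtain ⟨j, s, he⟩ := e.1.2
      exact .inl (hsub (by rw [show v = _ from hτ]; exact h.mem _ _ _ he))
    · rcases hmm g v hτ with hv | hv | hv
      exacts [.inr ⟨g, hv⟩, .inl (hsub (h.mem _ _ _ hv)), .inl (hsub (h.mem _ _ _ hv))]
  · intro i
    refine h.length_le_of_owner hs (z := z) (w := w) (mid := mid) ?_ (hP.nodup i)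
      fun v hv => (hPm i v).1 hv
    intro g
    have h1 := (hGS.left g).1
    have h2 := (hGS.right g).1
    have h3 := (hGS.mid g).1
    rw [← hmid', List.length_append, List.length_append]
    omega
  · have h1 : (Finset.univ.image jβ).card ≤ Fintype.card (I × GapKind) := Finset.card_image_le
    have h2 : (Finset.univ.image jα).card ≤ Fintype.card (I × GapKind) := Finset.card_image_le
    have h3 := Finset.card_union_le (Finset.univ.image jβ) (Finset.univ.image jα)
    rw [hT]
    omega
  · intro i a b ha hb
    refine hPo i a b ?_ ?_
    · rcases ha with ha | ⟨m, hm, ha⟩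
      exacts [.inl ha, .inr (hreach i false a m hm ha)]
    · rcases hb with hb | ⟨m, hm, hb⟩
      exacts [.inl hb, .inr (hreach i true b m hm hb)]
  · intro s u hu hc g
    refine hthin s u (fun h' => ?_) (fun g hg => ?_) hc g
    · obtain ⟨i, hi⟩ := hcov u h'
      exact hu i hi
    · obtain ⟨i, hi⟩ := hgm g u (hqm g u hg)
      exact hu i hi

open scoped Classical in
/-- Disjoint paths, each of which accepts almost every vertex, such that every chain with ends
outside small exceptional sets is accepted by at least half of the paths. -/
structure Absorbing {I : Type} [Fintype V] [Fintype I] (r : V → V → Prop) (P : I → List V)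
    (F : Finset V) (W : Bool → Finset V) : Prop where
  fam : Fam r P
  mem_iff : ∀ v, v ∈ F ↔ ∃ i, v ∈ P i
  avoid : ∀ s, ∀ w ∈ W s, w ∉ F
  card_le : ∀ s, 2 ^ 30 * (W s).card ≤ 5 * Fintype.card V
  degree : ∀ s, ∀ w ∈ W s,
    4 * (W s).card ≤ (Finset.univ.filter fun u => orient r s u w ∧ u ∉ F).card
  chain : ∀ C : List V, (∀ c ∈ C.head?, c ∉ F ∧ c ∉ W false) →
    (∀ c ∈ C.getLast?, c ∉ F ∧ c ∉ W true) →
    2 * (Finset.univ.filter fun i => ¬ Insertable r (P i) C).card ≤ Fintype.card I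
  single : ∀ i, 2 ^ 29 * (Finset.univ.filter fun v => v ∉ F ∧ ¬ Insertable r (P i) [v]).card ≤
    Fintype.card V

section Frame

variable {I M : Type} [Fintype V] [Fintype I] [Fintype M] {r : V → V → Prop}
  {x : I → Bool → V} {D : Slot I M → Bool → List V} {R : Finset V}
  {q : I × GapKind → List V} {P : I → List V} {T : Finset (I × M)}

open scoped Classical in
theorem card_mul_card_fiber_le (p : I × M → Prop) :
    Fintype.card M * (Finset.univ.filter fun i => ∀ m, (i, m) ∈ T ∨ p (i, m)).card ≤
      T.card + (Finset.univ.filter p).card := by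
  have h : (Finset.univ.filter fun i => ∀ m, (i, m) ∈ T ∨ p (i, m)) ×ˢ
      (Finset.univ : Finset M) ⊆ T ∪ Finset.univ.filter p := by
    rintro ⟨i, m⟩ h
    simp only [Finset.mem_product, Finset.mem_filter, Finset.mem_univ, true_and, and_true] at h
    simpa using h m
  have h1 := (Finset.card_le_card h).trans (Finset.card_union_le _ _)
  rw [Finset.card_product, Finset.card_univ, Nat.mul_comm] at h1
  exact h1

open scoped Classical in
theorem Frame.card_not_insertable_le (hF : Frame r x D R q P T) (hM : 360 ≤ Fintype.card M)
    (C : List V)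
    (hC : ∀ c ∈ C.head?, 5 * (Finset.univ.filter fun j => Undom r (D (.inl j) false) c).card <
      Fintype.card (I × M))
    (hC' : ∀ c ∈ C.getLast?, 5 * (Finset.univ.filter fun j =>
      Undom (flip r) (D (.inl j) true) c).card < Fintype.card (I × M)) :
    2 * (Finset.univ.filter fun i => ¬ Insertable r (P i) C).card ≤ Fintype.card I := by
  rcases C.eq_nil_or_concat with rfl | ⟨C', c', hCc⟩
  · simp [Insertable]
  obtain ⟨c, hc⟩ : ∃ c, C.head? = some c := by
    rw [hCc]
    cases C' <;> simp
  have hc' : C.getLast? = some c' := by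
    rw [hCc, List.concat_eq_append, List.getLast?_concat]
  have aux : ∀ p : I × M → Prop, 5 * (Finset.univ.filter p).card < Fintype.card (I × M) →
      4 * (Finset.univ.filter fun i => ∀ m, (i, m) ∈ T ∨ p (i, m)).card ≤ Fintype.card I := by
    intro p hp
    have h1 := card_mul_card_fiber_le (T := T) p
    have h2 := hF.touched
    have h3 : Fintype.card (I × M) = Fintype.card M * Fintype.card I := by
      rw [Fintype.card_prod, Nat.mul_comm]
    set b := (Finset.univ.filter fun i => ∀ m, (i, m) ∈ T ∨ p (i, m)).card
    have h4 : 360 * Fintype.card I ≤ Fintype.card M * Fintype.card I := Nat.mul_le_mul_right _ hM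
    by_contra! hlt
    have h5 : Fintype.card M * (Fintype.card I + 1) ≤ Fintype.card M * (4 * b) :=
      Nat.mul_le_mul_left _ hlt
    rw [Nat.mul_add, Nat.mul_left_comm] at h5
    omega
  have h₁ := aux (fun j => Undom r (D (.inl j) false) c) (hC c hc)
  have h₂ := aux (fun j => Undom (flip r) (D (.inl j) true) c') (hC' c' hc')
  have hsub : (Finset.univ.filter fun i => ¬ Insertable r (P i) C) ⊆
      (Finset.univ.filter fun i => ∀ m, (i, m) ∈ T ∨ Undom r (D (.inl (i, m)) false) c) ∪
      Finset.univ.filter fun i => ∀ m, (i, m) ∈ T ∨ Undom (flip r) (D (.inl (i, m)) true) c' := by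
    intro i hi
    simp only [Finset.mem_union, Finset.mem_filter, Finset.mem_univ, true_and] at hi ⊢
    by_contra! hne
    obtain ⟨⟨m, hm, ha⟩, m', hm', hb⟩ := hne
    simp only [Undom, not_forall, not_not] at ha hb
    obtain ⟨a, ha, hac⟩ := ha
    obtain ⟨b, hb, hbc⟩ := hb
    refine hi (Or.inr ⟨a, b, hF.order i a b (.inr ⟨m, hm, ha⟩) (.inr ⟨m', hm', hb⟩), ?_, ?_⟩)
    · rw [hc]
      rintro _ ⟨⟩
      exact hac
    · rw [hc']
      rintro _ ⟨⟩
      exact hbc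
  have := (Finset.card_le_card hsub).trans (Finset.card_union_le _ _)
  omega

open scoped Classical in
theorem Frame.absorbing {R₀ : Finset V} (hT : Toolkit r x D R₀) (hR : R₀ ⊆ R)
    (hF : Frame r x D R q P T) (hM : 360 ≤ Fintype.card M) (hI : 0 < Fintype.card I) {k : ℕ}
    (hdeg : ∀ s v, k ≤ (Finset.univ.filter fun u => orient r s v u).card)
    (hk : Fintype.card I * (868 * Fintype.card M + 4166) ≤ k) :
    ∃ F W, Absorbing r P F W := by
  set F : Finset V := Finset.univ.filter fun v => ∃ i, v ∈ P i with hFd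
  have hFm : ∀ v, v ∈ F ↔ ∃ i, v ∈ P i := by simp [hFd]
  have hRF : R ⊆ F := fun v hv => (hFm v).2 (hF.cover v hv)
  have hIM : 0 < Fintype.card (I × M) := by
    rw [Fintype.card_prod]
    exact Nat.mul_pos hI (by omega)
  set W : Bool → Finset V := fun s => (Finset.univ.filter fun u => u ∉ F).filter fun u =>
    Fintype.card (I × M) ≤
      5 * (Finset.univ.filter fun j => Undom (orient r s) (D (.inl j) s) u).card with hW
  have hWm : ∀ s u, u ∈ W s ↔ u ∉ F ∧ Fintype.card (I × M) ≤
      5 * (Finset.univ.filter fun j => Undom (orient r s) (D (.inl j) s) u).card := by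
    simp [hW]
  have hdom : ∀ k s v, v ∉ F →
      2 ^ 30 * (Finset.univ.filter fun u => u ∉ F ∧ Undom (orient r s) (D k s) u).card ≤
      (Finset.univ.filter fun u => orient r s u v).card := hT.dom F (hR.trans hRF)
  have hWd : ∀ s, ∀ v ∉ F, 2 ^ 30 * (W s).card ≤
      5 * (Finset.univ.filter fun u => orient r s u v).card := by
    intro s v hv
    refine card_frequent_le (p := fun j : I × M => Undom (orient r s) (D (.inl j) s)) ?_ hIM
    intro j
    have := hdom (.inl j) s v hv
    rwa [Finset.filter_filter]
  refine ⟨F, W, hF.fam, hFm, fun s w hw => ((hWm s w).1 hw).1, ?_, ?_, ?_, ?_⟩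
  · intro s
    rcases (W s).eq_empty_or_nonempty with h | ⟨v, hv⟩
    · simp [h]
    · exact (hWd s v ((hWm s v).1 hv).1).trans (Nat.mul_le_mul_left _ (Finset.card_le_univ _))
  · intro s w hw
    have hwF := ((hWm s w).1 hw).1
    have h1 := hWd s w hwF
    have h2 : k ≤ (Finset.univ.filter fun u => orient r s u w).card := by
      simpa only [orient_not] using hdeg (!s) w
    have hsub : (Finset.univ.filter fun u => orient r s u w) ⊆
        (Finset.univ.filter fun u => orient r s u w ∧ u ∉ F) ∪
        (R ∪ Finset.univ.biUnion fun g => (q g).toFinset.filter fun u => orient r s u w) := by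
      intro u hu
      simp only [Finset.mem_filter, Finset.mem_univ, true_and] at hu
      by_cases huF : u ∈ F
      · refine Finset.mem_union_right _ ?_
        obtain ⟨i, hi⟩ := (hFm u).1 huF
        rcases hF.mem i u hi with h | ⟨g, hg⟩
        · exact Finset.mem_union_left _ h
        · exact Finset.mem_union_right _ (Finset.mem_biUnion.2 ⟨g, Finset.mem_univ _,
            Finset.mem_filter.2 ⟨List.mem_toFinset.2 hg, hu⟩⟩)
      · exact Finset.mem_union_left _ (by simp [hu, huF])
    have h3 := Finset.card_le_card hsub
    have h4 := (Finset.card_union_le _ _).trans (Nat.add_le_add_left (Finset.card_union_le R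
      (Finset.univ.biUnion fun g => (q g).toFinset.filter fun u => orient r s u w))
      (Finset.univ.filter fun u => orient r s u w ∧ u ∉ F).card)
    have h5 := Finset.card_biUnion_le_card_mul Finset.univ
      (fun g => (q g).toFinset.filter fun u => orient r s u w) 33 fun g _ =>
        hF.thin s w (fun i hi => hwF ((hFm w).2 ⟨i, hi⟩)) ((hWm s w).1 hw).2 g
    have h6 := hF.card_le
    have hG : Fintype.card (I × GapKind) = 9 * Fintype.card I := by
      simp only [Fintype.card_prod, Fintype.card_sum, Fintype.card_bool, Fintype.card_fin]
      ring
    rw [Finset.card_univ, hG] at h5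
    rw [Nat.mul_add, Nat.mul_left_comm] at h6 hk
    omega
  · intro C hC hC'
    refine hF.card_not_insertable_le hM C ?_ ?_
    · intro c hc
      obtain ⟨h1, h2⟩ := hC c hc
      by_contra! hlt
      exact h2 ((hWm _ _).2 ⟨h1, hlt⟩)
    · intro c hc
      obtain ⟨h1, h2⟩ := hC' c hc
      by_contra! hlt
      exact h2 ((hWm _ _).2 ⟨h1, hlt⟩)
  · intro i
    set U := Finset.univ.filter fun v => v ∉ F ∧ ¬ Insertable r (P i) [v] with hU
    rcases U.eq_empty_or_nonempty with h | ⟨u, hu⟩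
    · simp [h]
    have huF : u ∉ F := by
      rw [hU, Finset.mem_filter] at hu
      exact hu.2.1
    have h1 := (hdom (.inr (i, false, false)) false u huF).trans (Finset.card_le_univ _)
    have h2 := (hdom (.inr (i, true, true)) true u huF).trans (Finset.card_le_univ _)
    have hsub : U ⊆ (Finset.univ.filter fun u => u ∉ F ∧
          Undom (orient r false) (D (.inr (i, false, false)) false) u) ∪
        Finset.univ.filter fun u => u ∉ F ∧
          Undom (orient r true) (D (.inr (i, true, true)) true) u := by
      intro v hv
      simp only [hU, Finset.mem_union, Finset.mem_filter, Finset.mem_univ, true_and] at hv ⊢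
      by_contra! hne
      have ha := hne.1 hv.1
      have hb := hne.2 hv.1
      simp only [Undom, not_forall, not_not] at ha hb
      obtain ⟨a, ha, hac⟩ := ha
      obtain ⟨b, hb, hbc⟩ := hb
      refine hv.2 (Or.inr ⟨a, b, hF.order i a b (.inl ha) (.inl hb), ?_, ?_⟩)
      · rintro _ ⟨⟩
        exact hac
      · rintro _ ⟨⟩
        exact hbc
    have h3 := (Finset.card_le_card hsub).trans (Finset.card_union_le _ _)
    omega

end Frame

open scoped Classical in
theorem Fam.insert {I J : Type} [Fintype I] [Fintype J] {r : V → V → Prop}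
    (hr : ∀ u v, u ≠ v → r u v ∨ r v u) {P : I → List V} {C : J → List V}
    (h : Fam r (Sum.elim P C)) (asg : J → I) (hi : ∀ j, Insertable r (P (asg j)) (C j)) :
    ∃ Q : I → List V, Fam r Q ∧ ∀ i, (P i).Sublist (Q i) ∧ (Q i).head? = (P i).head? ∧
      (Q i).getLast? = (P i).getLast? ∧ (∀ v, v ∈ Q i ↔ v ∈ P i ∨ ∃ j, asg j = i ∧ v ∈ C j) ∧
      (Q i).length = (P i).length +
        ∑ j ∈ Finset.univ.filter (fun j => asg j = i), (C j).length := by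
  obtain ⟨Q, hQ, hQ'⟩ := Fam.merge hr h (fun i => [Sum.inl i])
    (Sum.elim (fun _ => none) fun j => some (asg j)) (by simp)
    (by
      intro k b b' hb hb'
      rw [List.mem_singleton] at hb hb'
      exact Sum.inl_injective (hb.symm.trans hb'))
    (by
      intro k b hb
      rw [List.mem_singleton] at hb
      rw [hb]
      rfl)
    (by
      intro b
      rw [List.flatMap_singleton]
      exact h.chain (Sum.inl b))
    (by
      rintro (k | j) b hb
      · simp at hb
      · rw [List.flatMap_singleton]
        have e : asg j = b := by simpa using hb
        rw [← e]
        exact hi j)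
  refine ⟨Q, ⟨fun i => hQ.chain (.inl i), fun i => hQ.nodup (.inl i), fun i i' hii v hv hv' =>
    hQ.disj (.inl i) (.inl i') (by simpa using hii) v hv hv'⟩, fun i => ?_⟩
  obtain ⟨h1, h2, h3, h4, h5⟩ := hQ' i
  rw [List.flatMap_singleton] at h1 h2 h3 h5
  refine ⟨h1, h2, h3, fun v => ?_, ?_⟩
  · rw [h4]
    simp
  · rw [h5, Finset.sum_filter, Finset.sum_filter, Fintype.sum_sum_type]
    simp

open scoped Classical in
/-- The exceptional vertices of an absorbing family can be inserted into its paths. -/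
theorem Absorbing.exists_cover {I : Type} [Fintype V] [Fintype I] {r : V → V → Prop}
    (hr : ∀ u v, u ≠ v → r u v ∨ r v u) {P : I → List V} {F : Finset V} {W : Bool → Finset V}
    (h : Absorbing r P F W) {κ : ℕ}
    (hκ : 2 * ((W false).card + (W true).card) ≤ Fintype.card I * κ) :
    ∃ Q : I → List V, Fam r Q ∧ (∀ i, (P i).Sublist (Q i) ∧ (Q i).head? = (P i).head? ∧
      (Q i).getLast? = (P i).getLast? ∧ (Q i).length ≤ (P i).length + 3 * κ) ∧
      ∀ s, ∀ w ∈ W s, ∃ i, w ∈ Q i := by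
  obtain ⟨C, hC⟩ := exists_chainCover (r := r) (F := F) (h.avoid false) (h.avoid true)
    (h.degree false) (h.degree true)
  have hcand : ∀ w, 2 * (Finset.univ.filter fun i => ¬ Insertable r (P i) (C w)).card ≤
      Fintype.card I := fun w => h.chain _
    (fun c hc => ⟨hC.avoid w c (List.mem_of_mem_head? hc), hC.head w c hc⟩)
    (fun c hc => ⟨hC.avoid w c (List.mem_of_mem_getLast? hc), hC.last w c hc⟩)
  obtain ⟨f, hf, hf'⟩ := exists_injective_choice
    (ι := {w // w ∈ W false ∪ W true}) (α := I × Fin κ)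
    (fun w => (Finset.univ.filter fun i => Insertable r (P i) (C w.1)) ×ˢ Finset.univ) (by
      intro w
      have e1 := hcand w.1
      have e2 := Finset.card_filter_add_card_filter_not (s := (Finset.univ : Finset I))
        (fun i => Insertable r (P i) (C w.1))
      have e3 := Finset.card_union_le (W false) (W true)
      rw [Fintype.card_coe, Finset.card_product, Finset.card_univ, Fintype.card_fin]
      rw [Finset.card_univ] at e2
      have e4 : Fintype.card I * κ ≤
          2 * (Finset.univ.filter fun i => Insertable r (P i) (C w.1)).card * κ :=
        Nat.mul_le_mul_right _ (by omega)
      rw [Nat.mul_assoc] at e4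
      omega)
  have hfam : Fam r (Sum.elim P fun w : {w // w ∈ W false ∪ W true} => C w.1) := by
    refine ⟨?_, ?_, ?_⟩
    · rintro (i | w)
      exacts [h.fam.chain i, hC.chain w.1]
    · rintro (i | w)
      exacts [h.fam.nodup i, hC.nodup w.1]
    · rintro (i | w) (i' | w') hne v hv hv'
      · exact h.fam.disj i i' (fun e => hne (by rw [e])) v hv hv'
      · exact hC.avoid w'.1 v hv' ((h.mem_iff v).2 ⟨i, hv⟩)
      · exact hC.avoid w.1 v hv ((h.mem_iff v).2 ⟨i', hv'⟩)
      · exact hC.disj w.1 w'.1 (fun e => hne (by rw [Subtype.ext e])) v hv hv'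
  obtain ⟨Q, hQ, hQ'⟩ := hfam.insert hr (fun w => (f w).1) (fun w => by
    have := hf' w
    rw [Finset.mem_product, Finset.mem_filter] at this
    exact this.1.2)
  refine ⟨Q, hQ, fun i => ?_, fun s w hw => ?_⟩
  · obtain ⟨h1, h2, h3, -, h5⟩ := hQ' i
    refine ⟨h1, h2, h3, ?_⟩
    rw [h5]
    have e1 : (Finset.univ.filter fun w => (f w).1 = i).card ≤ κ := by
      have := Finset.card_le_card_of_injOn (s := Finset.univ.filter fun w => (f w).1 = i)
        (t := (Finset.univ : Finset (Fin κ))) (fun w => (f w).2) (fun _ _ => Finset.mem_univ _)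
        (by
          intro a ha b hb hab
          have ha' := (Finset.mem_filter.1 (Finset.mem_coe.1 ha)).2
          have hb' := (Finset.mem_filter.1 (Finset.mem_coe.1 hb)).2
          exact hf (Prod.ext (ha'.trans hb'.symm) hab))
      rwa [Finset.card_univ, Fintype.card_fin] at this
    have e2 := Finset.sum_le_card_nsmul (Finset.univ.filter fun w => (f w).1 = i)
      (fun w => (C w.1).length) 3 (fun w _ => hC.length_le w.1)
    rw [smul_eq_mul] at e2
    omega
  · obtain ⟨w', hw'⟩ := hC.cover w (by cases s <;> simp [hw])
    have hmem : w' ∈ W false ∪ W true := by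
      by_contra hn
      rw [Finset.mem_union, not_or] at hn
      rw [hC.empty w' hn.1 hn.2] at hw'
      simp at hw'
    obtain ⟨-, -, -, h4, -⟩ := hQ' (f ⟨w', hmem⟩).1
    exact ⟨_, (h4 w).2 (Or.inr ⟨_, rfl, hw'⟩)⟩

open scoped Classical in
theorem Fam.card_uncovered {I : Type} [Fintype V] [Fintype I] {r : V → V → Prop}
    {Q : I → List V} (h : Fam r Q) :
    (Finset.univ.filter fun v => ∀ i, v ∉ Q i).card + ∑ i, (Q i).length = Fintype.card V := by
  have e1 : (Finset.univ.biUnion fun i => (Q i).toFinset).card = ∑ i, (Q i).length := by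
    rw [Finset.card_biUnion]
    · exact Finset.sum_congr rfl fun i _ => List.toFinset_card_of_nodup (h.nodup i)
    · intro i _ j _ hij
      refine Finset.disjoint_left.2 ?_
      intro v hv hv'
      exact h.disj i j hij v (List.mem_toFinset.1 hv) (List.mem_toFinset.1 hv')
  have e2 : (Finset.univ.filter fun v => ∀ i, v ∉ Q i) =
      (Finset.univ.biUnion fun i => (Q i).toFinset)ᶜ := by
    ext v
    simp
  rw [e2, ← e1, Finset.card_compl_add_card]

open scoped Classical in
/-- An absorbing family covering its exceptional vertices can be enlarged to have any prescribed
lengths that are not too small. -/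
theorem Absorbing.exists_lengths {I : Type} [Fintype V] [Fintype I] {r : V → V → Prop}
    (hr : ∀ u v, u ≠ v → r u v ∨ r v u) {P : I → List V} {F : Finset V} {W : Bool → Finset V}
    (h : Absorbing r P F W) {Q : I → List V} (hQ : Fam r Q) (hPQ : ∀ i, (P i).Sublist (Q i))
    (hW : ∀ s, ∀ w ∈ W s, ∃ i, w ∈ Q i) {κ : I → ℕ}
    (hκ : ∀ i, Fintype.card V ≤ 2 ^ 28 * Fintype.card I * κ i)
    (hsum : ∑ i, ((Q i).length + κ i) ≤ Fintype.card V) :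
    ∃ Q' : I → List V, Fam r Q' ∧ ∀ i, (Q' i).head? = (Q i).head? ∧
      (Q' i).getLast? = (Q i).getLast? ∧ (Q' i).length = (Q i).length + κ i := by
  set L : Finset V := Finset.univ.filter fun v => ∀ i, v ∉ Q i with hL
  have hLc : ∑ i, κ i ≤ L.card := by
    have e := hQ.card_uncovered
    rw [← hL] at e
    rw [Finset.sum_add_distrib] at hsum
    omega
  have hLF : ∀ v ∈ L, v ∉ F := by
    intro v hv hF
    obtain ⟨i, hi⟩ := (h.mem_iff v).1 hF
    exact (Finset.mem_filter.1 hv).2 i ((hPQ i).subset hi)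
  have hLW : ∀ v ∈ L, ∀ s, v ∉ W s := by
    intro v hv s hs
    obtain ⟨i, hi⟩ := hW s v hs
    exact (Finset.mem_filter.1 hv).2 i hi
  obtain ⟨f, hf, hf'⟩ := (Finset.all_card_le_biUnion_card_iff_exists_injective
    (fun j : Σ i, Fin (κ i) => L.filter fun v => Insertable r (P j.1) [v])).1 (by
    intro s
    rcases s.eq_empty_or_nonempty with rfl | ⟨j, hj⟩
    · simp
    set S := s.image Sigma.fst with hS
    have e1 : s.card ≤ ∑ i ∈ S, κ i := by
      have e : s ⊆ S.sigma fun i => (Finset.univ : Finset (Fin (κ i))) := by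
        intro a ha
        rw [Finset.mem_sigma]
        exact ⟨Finset.mem_image_of_mem _ ha, Finset.mem_univ _⟩
      have := Finset.card_le_card e
      simpa using this
    have e2 : ∑ i ∈ S, κ i + ∑ i ∈ Sᶜ, κ i = ∑ i, κ i := Finset.sum_add_sum_compl S κ
    have e3 : S.card + Sᶜ.card = Fintype.card I := Finset.card_add_card_compl S
    rcases Nat.lt_or_ge (Fintype.card I) (2 * S.card) with hlt | hge
    · have hsub : L ⊆ s.biUnion fun j => L.filter fun v => Insertable r (P j.1) [v] := by
        intro v hv
        have e4 := h.chain [v]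
          (fun c hc => by
            obtain rfl : v = c := by simpa using hc
            exact ⟨hLF v hv, hLW v hv _⟩)
          (fun c hc => by
            obtain rfl : v = c := by simpa using hc
            exact ⟨hLF v hv, hLW v hv _⟩)
        obtain ⟨i, hi, hi'⟩ : ∃ i ∈ S, Insertable r (P i) [v] := by
          by_contra hno
          push Not at hno
          have : S.card ≤ (Finset.univ.filter fun i => ¬ Insertable r (P i) [v]).card :=
            Finset.card_le_card fun i hi => Finset.mem_filter.2 ⟨Finset.mem_univ _, hno i hi⟩
          omega
        obtain ⟨a, ha, rfl⟩ := Finset.mem_image.1 hi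
        exact Finset.mem_biUnion.2 ⟨a, ha, Finset.mem_filter.2 ⟨hv, hi'⟩⟩
      have e5 := Finset.card_le_card hsub
      omega
    · have e4 := h.single j.1
      have e5 : (L.filter fun v => ¬ Insertable r (P j.1) [v]).card ≤
          (Finset.univ.filter fun v => v ∉ F ∧ ¬ Insertable r (P j.1) [v]).card :=
        Finset.card_le_card fun v hv => by
          rw [Finset.mem_filter] at hv
          exact Finset.mem_filter.2 ⟨Finset.mem_univ _, hLF v hv.1, hv.2⟩
      have e6 := Finset.card_filter_add_card_filter_not (s := L)
        (fun v => Insertable r (P j.1) [v])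
      have e7 : (L.filter fun v => Insertable r (P j.1) [v]).card ≤
          (s.biUnion fun j => L.filter fun v => Insertable r (P j.1) [v]).card :=
        Finset.card_le_card (Finset.subset_biUnion_of_mem
          (fun j : Σ i, Fin (κ i) => L.filter fun v => Insertable r (P j.1) [v]) hj)
      have e8 : Sᶜ.card * Fintype.card V ≤ 2 ^ 28 * Fintype.card I * ∑ i ∈ Sᶜ, κ i := by
        rw [Finset.mul_sum, ← smul_eq_mul]
        exact Finset.card_nsmul_le_sum _ _ _ fun i _ => hκ i
      have hI : 0 < Fintype.card I := Fintype.card_pos_iff.2 ⟨j.1⟩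
      have e9 : Fintype.card V ≤ 2 ^ 29 * ∑ i ∈ Sᶜ, κ i := by
        have : Fintype.card I * Fintype.card V ≤ 2 * Sᶜ.card * Fintype.card V :=
          Nat.mul_le_mul_right _ (by omega)
        refine Nat.le_of_mul_le_mul_left ?_ hI
        calc Fintype.card I * Fintype.card V ≤ 2 * (Sᶜ.card * Fintype.card V) := by
              rw [← Nat.mul_assoc]; exact this
          _ ≤ 2 * (2 ^ 28 * Fintype.card I * ∑ i ∈ Sᶜ, κ i) := Nat.mul_le_mul_left _ e8
          _ = Fintype.card I * (2 ^ 29 * ∑ i ∈ Sᶜ, κ i) := by ring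
      omega)
  have hfam : Fam r (Sum.elim Q fun j => [f j]) := by
    refine ⟨?_, ?_, ?_⟩
    · rintro (i | j)
      exacts [hQ.chain i, List.isChain_singleton _]
    · rintro (i | j)
      exacts [hQ.nodup i, List.nodup_singleton _]
    · have key : ∀ j i, f j ∉ Q i := fun j i =>
        (Finset.mem_filter.1 (Finset.mem_filter.1 (hf' j)).1).2 i
      rintro (i | j) (i' | j') hne v hv hv'
      · exact hQ.disj i i' (fun e => hne (by rw [e])) v hv hv'
      · exact key j' i (List.mem_singleton.1 hv' ▸ hv)
      · exact key j i' (List.mem_singleton.1 hv ▸ hv')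
      · exact hne (by rw [hf ((List.mem_singleton.1 hv).symm.trans (List.mem_singleton.1 hv'))])
  obtain ⟨Q', hQ', h'⟩ := hfam.insert hr (fun j => j.1) (fun j =>
    (Finset.mem_filter.1 (hf' j)).2.mono (hPQ _))
  refine ⟨Q', hQ', fun i => ?_⟩
  obtain ⟨-, h2, h3, -, h5⟩ := h' i
  refine ⟨h2, h3, ?_⟩
  rw [h5]
  congr 1
  have e : (Finset.univ.filter fun j : Σ i, Fin (κ i) => j.1 = i) =
      Finset.univ.map (Function.Embedding.sigmaMk (β := fun i => Fin (κ i)) i) := by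
    ext ⟨a, b⟩
    simp only [Finset.mem_filter, Finset.mem_univ, true_and, Finset.mem_map,
      Function.Embedding.sigmaMk_apply]
    constructor
    · rintro rfl
      exact ⟨b, rfl⟩
    · rintro ⟨c, hc⟩
      exact (congrArg Sigma.fst hc).symm
  simp [e]

theorem exists_linkage_aux {I M : Type} [Fintype V] [Fintype I] [Fintype M]
    (hM : Fintype.card M = 10 ^ 6) {r : V → V → Prop} (hr : ∀ u v, u ≠ v → r u v ∨ r v u)
    {k : ℕ} (hkV : k + 1 ≤ Fintype.card V) (hk : k = 10 ^ 14 * Fintype.card I)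
    (hconn : ∀ T : Finset V, T.card < k → ∀ u v, u ∉ T → v ∉ T → u ≠ v →
      ∃ l : List V, l.Nodup ∧ l.IsChain r ∧ l.head? = some u ∧ l.getLast? = some v ∧
        ∀ w ∈ l, w ∉ T)
    {x : I → Bool → V} (hx : ∀ i b i' b', x i b = x i' b' → i = i' ∧ b = b')
    (hI : 0 < Fintype.card I) {ℓ : I → ℕ}
    (hℓ : ∀ i, Fintype.card V ≤ 100 * Fintype.card I * ℓ i)
    (hsum : ∑ i, ℓ i ≤ Fintype.card V) :
    ∃ Q : I → List V, Fam r Q ∧ ∀ i, (Q i).head? = some (x i false) ∧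
      (Q i).getLast? = some (x i true) ∧ (Q i).length = ℓ i := by
  obtain ⟨D, R₀, R, q, P, T, hT, hR, hF⟩ := exists_frame (M := M) hr hkV hconn hx hI
    (by omega) (by rw [hM]; omega)
  obtain ⟨F, W, hA⟩ := hF.absorbing hT hR (by omega) hI (le_card_orient hkV hconn)
    (by rw [hM]; omega)
  set κ := Fintype.card V / (2 ^ 25 * Fintype.card I) + 1 with hκ
  have h25 : Fintype.card V / (2 ^ 25 * Fintype.card I) * (2 ^ 25 * Fintype.card I) ≤
    Fintype.card V := Nat.div_mul_le_self _ _
  obtain ⟨Q, hQ, hPQ, hW⟩ := hA.exists_cover hr (κ := κ) (by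
    have e := Nat.lt_mul_div_succ (Fintype.card V)
      (show 0 < 2 ^ 25 * Fintype.card I by omega)
    rw [← hκ, Nat.mul_assoc] at e
    have e1 := hA.card_le false
    have e2 := hA.card_le true
    omega)
  have hlen : ∀ i, 200 * Fintype.card I * (Q i).length ≤ Fintype.card V := by
    intro i
    have e1 := hF.length_le i
    have e2 := (hPQ i).2.2.2
    have e3 := Nat.div_mul_le_self (4 * Fintype.card V) (Fintype.card (I × M))
    rw [Fintype.card_prod, hM] at e1 e3
    rw [hκ] at e2
    generalize 4 * Fintype.card V / (Fintype.card I * 10 ^ 6) = a at e1 e3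
    generalize Fintype.card V / (2 ^ 25 * Fintype.card I) = b at e2 h25
    have e4 : Fintype.card I * (Q i).length ≤
        Fintype.card I * (9 * a + 434 * 10 ^ 6 + 844 + 3 * (b + 1)) :=
      Nat.mul_le_mul_left _ (by omega)
    nlinarith
  have hle : ∀ i, 2 * (Q i).length ≤ ℓ i := by
    intro i
    refine Nat.le_of_mul_le_mul_left ?_ (show 0 < 100 * Fintype.card I by omega)
    refine le_trans (le_trans (le_of_eq ?_) (hlen i)) (hℓ i)
    ring
  have hadd : ∀ i, (Q i).length + (ℓ i - (Q i).length) = ℓ i := by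
    intro i
    have := hle i
    omega
  obtain ⟨Q', hQ', h'⟩ := hA.exists_lengths hr hQ (fun i => (hPQ i).1) hW
    (κ := fun i => ℓ i - (Q i).length)
    (by
      intro i
      refine (hℓ i).trans ?_
      calc 100 * Fintype.card I * ℓ i
          ≤ 100 * Fintype.card I * (2 * (ℓ i - (Q i).length)) :=
            Nat.mul_le_mul_left _ (by have := hle i; omega)
        _ = 200 * (Fintype.card I * (ℓ i - (Q i).length)) := by ring
        _ ≤ 2 ^ 28 * (Fintype.card I * (ℓ i - (Q i).length)) :=
            Nat.mul_le_mul_right _ (by norm_num)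
        _ = _ := (Nat.mul_assoc _ _ _).symm)
    (by
      rw [Finset.sum_congr rfl fun i _ => hadd i]
      exact hsum)
  refine ⟨Q', hQ', fun i => ?_⟩
  obtain ⟨h1, h2, h3⟩ := h' i
  exact ⟨h1.trans ((hPQ i).2.1.trans (hF.head i)), h2.trans ((hPQ i).2.2.1.trans (hF.last i)),
    h3.trans (hadd i)⟩

theorem exists_linkage {I : Type} [Fintype V] [Fintype I]
    {r : V → V → Prop} (hr : ∀ u v, u ≠ v → r u v ∨ r v u)
    {k : ℕ} (hkV : k + 1 ≤ Fintype.card V) (hk : k = 10 ^ 14 * Fintype.card I)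
    (hconn : ∀ T : Finset V, T.card < k → ∀ u v, u ∉ T → v ∉ T → u ≠ v →
      ∃ l : List V, l.Nodup ∧ l.IsChain r ∧ l.head? = some u ∧ l.getLast? = some v ∧
        ∀ w ∈ l, w ∉ T)
    {x : I → Bool → V} (hx : ∀ i b i' b', x i b = x i' b' → i = i' ∧ b = b')
    (hI : 0 < Fintype.card I) {ℓ : I → ℕ}
    (hℓ : ∀ i, Fintype.card V ≤ 100 * Fintype.card I * ℓ i)
    (hsum : ∑ i, ℓ i ≤ Fintype.card V) :
    ∃ Q : I → List V, Fam r Q ∧ ∀ i, (Q i).head? = some (x i false) ∧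
      (Q i).getLast? = some (x i true) ∧ (Q i).length = ℓ i :=
  exists_linkage_aux (M := Fin (10 ^ 6)) (Fintype.card_fin _) hr hkV hk hconn hx hI hℓ hsum

end Linkage

/-- **Theorem 1.6.** For `n, t ≥ 1` and `ℓ_i ≥ n/(100t)` with `∑ ℓ_i ≤ n`, every strongly
`10¹⁴ t`-connected `n`-vertex semicomplete digraph with `2t` distinct vertices
`x₁,…,x_t,y₁,…,y_t` contains pairwise vertex-disjoint paths `P_i` from `x_i` to `y_i`
with `|V(P_i)| = ℓ_i`. -/
theorem stmt5 {V : Type} [Fintype V] (n t : ℕ) (hn1 : 1 ≤ n) (ht1 : 1 ≤ t)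
    (ℓ : Fin t → ℕ) (hℓ : ∀ i, (n : ℝ) / (100 * t) ≤ ℓ i)
    (hsum : ∑ i, ℓ i ≤ n)
    (D : Digr V) (hD : D.IsSemicomplete) (hn : Fintype.card V = n)
    (hconn : D.StronglyConnOn Set.univ (10 ^ 14 * t))
    (x y : Fin t → V)
    (hdist : Function.Injective (Sum.elim x y : Fin t ⊕ Fin t → V)) :
    ∃ P : Fin t → List V,
      (∀ i j, i ≠ j → ∀ v, v ∈ P i → v ∉ P j) ∧
      ∀ i, D.IsPathOn Set.univ (x i) (y i) (P i) ∧ (P i).length = ℓ i := by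
  classical
  have hr : ∀ u v, u ≠ v → D.Adj u v ∨ D.Adj v u := hD.2
  obtain ⟨hcard, hpath⟩ := hconn
  rw [Set.ncard_univ, Nat.card_eq_fintype_card] at hcard
  have ht : Fintype.card (Fin t) = t := Fintype.card_fin t
  obtain ⟨Q, hQ, hQ'⟩ := Linkage.exists_linkage hr (k := 10 ^ 14 * t) hcard (by rw [ht])
    (fun T hT u v hu hv huv => by
      obtain ⟨l, h1, h2, h3, h4, h5⟩ := hpath u (Set.mem_univ _) v (Set.mem_univ _) huv
        (T : Set V)
        (fun w hw => ⟨Set.mem_univ _, by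
          rintro (rfl | rfl)
          exacts [hu hw, hv hw]⟩)
        (by rwa [Set.ncard_coe_finset])
      exact ⟨l, h1, h2, h4, h5, fun w hw hwT => (h3 w hw).2 hwT⟩)
    (x := fun i b => Sum.elim x y (if b then .inr i else .inl i))
    (fun i b i' b' h => by
      have := hdist h
      cases b <;> cases b' <;> simp_all)
    (by omega) (ℓ := ℓ)
    (fun i => by
      have h := hℓ i
      have ht' : (0 : ℝ) < 100 * t := by
        have : (0 : ℝ) < t := by exact_mod_cast ht1
        positivity
      rw [div_le_iff₀ ht', mul_comm] at h
      rw [hn, ht]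
      exact_mod_cast h)
    (hn ▸ hsum)
  refine ⟨Q, hQ.disj, fun i => ?_⟩
  obtain ⟨h1, h2, h3⟩ := hQ' i
  exact ⟨⟨hQ.nodup i, hQ.chain i, fun _ _ => Set.mem_univ _, h1, h2⟩, h3⟩
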